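/- Let A > 0 and c > 0 be fixed. There exists B₀ = B₀(A, c) > 0 such that the following holds for every B ≥ B₀. Let x be sufficiently large, L = log x, and x^{1/2} ≤ y ≤ x. Suppose α ∈ ℝ and a, q ∈ ℤ satisfy L^B ≤ q ≤ y L^{−B}, gcd(a,q) = 1 and |α − a/q| < q^{−2}. Let (a_m) be complex numbers with |a_m| ≤ τ(m)^c, and suppose 1 ≤ M ≤ x^{1/4} L^{−2B} and 2 ≤ z ≤ y x^{−1/2} L^{−2B}. Then ∫_x^{2x} |∑_{M ≤ m < 2M} ∑_{k : t < m²k² ≤ t+y} a_m Φ(k,z) e(α m²k²)|² dt ≤ C y² L^{−A}, where C depends only on A and c. -/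

import Mathlib

open scoped Classical
open MeasureTheory

noncomputable section

/-- `e x = exp(2 π i x)`. -/
def e (x : ℝ) : ℂ := Complex.exp (2 * Real.pi * Complex.I * x)

/-- `Φ(n,z) = 1` if every prime divisor of `n` is `≥ z`, and `0` otherwise. -/
def Phi (n : ℕ) (z : ℝ) : ℕ :=
  if ∀ p : ℕ, p.Prime → p ∣ n → z ≤ (p : ℝ) then 1 else 0


/-- distance to nearest integer -/
def dn (β : ℝ) : ℝ := |β - round β|
def FF (K β : ℝ) : ℝ := K / (1 + K * dn β)

lemma dn_nonneg (β : ℝ) : 0 ≤ dn β := abs_nonneg _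

lemma dn_le_half (β : ℝ) : dn β ≤ 1/2 := abs_sub_round β

lemma FF_nonneg {K : ℝ} (hK : 0 ≤ K) (β : ℝ) : 0 ≤ FF K β := by
  have := dn_nonneg β
  unfold FF; positivity

lemma FF_le {K : ℝ} (hK : 0 ≤ K) (β : ℝ) : FF K β ≤ K := by
  have := dn_nonneg β
  unfold FF
  apply div_le_self hK
  have : 0 ≤ K * dn β := by positivity
  linarith

lemma FF_mul_le {K g : ℝ} (hK : 0 ≤ K) (hg : 1 ≤ g) (β : ℝ) : FF (g*K) β ≤ g * FF K β := by
  have := dn_nonneg β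
  unfold FF
  rw [← mul_div_assoc]
  apply div_le_div_of_nonneg_left
  · positivity
  · positivity
  · have : K * dn β ≤ g * K * dn β := by
      rw [mul_assoc]
      exact le_mul_of_one_le_left (by positivity) hg
    linarith

lemma e_add (x y : ℝ) : e (x + y) = e x * e y := by
  unfold e; rw [← Complex.exp_add]; congr 1; push_cast; ring

lemma e_norm (x : ℝ) : ‖e x‖ = 1 := by
  unfold e
  rw [show 2 * (Real.pi:ℂ) * Complex.I * x = ((2 * Real.pi * x : ℝ) : ℂ) * Complex.I by push_cast; ring]
  exact Complex.norm_exp_ofReal_mul_I _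

lemma e_zero : e 0 = 1 := by simp [e]

lemma e_int (n : ℤ) : e n = 1 := by
  unfold e
  rw [Complex.exp_eq_one_iff]
  exact ⟨n, by push_cast; ring⟩

lemma e_neg_conj (x : ℝ) : (starRingEnd ℂ) (e x) = e (-x) := by
  unfold e
  rw [← Complex.exp_conj]
  congr 1
  simp
  left; exact map_ofNat _ 2

lemma e_nat_mul (x : ℝ) (n : ℕ) : e (x * n) = e x ^ n := by
  unfold e
  rw [← Complex.exp_nat_mul]; congr 1; push_cast; ring

lemma e_sub_one_norm (β : ℝ) : 4 * dn β ≤ ‖e β - 1‖ := by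
  have h1 : e β = e (β - round β) := by
    have : e β = e ((β - round β) + ((round β : ℤ) : ℝ)) := by congr 1; ring
    rw [this, e_add, e_int, mul_one]
  rw [h1]
  unfold dn
  have hb := abs_sub_round β
  set θ := β - round β with hθ
  have h2 : e θ - 1 = Complex.exp (Complex.I * ((2 * Real.pi * θ : ℝ):ℂ)) - 1 := by
    unfold e; congr 2; push_cast; ring
  rw [h2, Complex.norm_exp_I_mul_ofReal_sub_one]
  rw [Real.norm_eq_abs, abs_mul, abs_of_pos (by norm_num : (0:ℝ) < 2)]
  have h3 : 2 * Real.pi * θ / 2 = Real.pi * θ := by ring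
  rw [h3]
  have h4 : 2 / Real.pi * |Real.pi * θ| ≤ |Real.sin (Real.pi * θ)| := by
    apply Real.mul_abs_le_abs_sin
    rw [abs_mul, abs_of_pos Real.pi_pos]
    nlinarith [Real.pi_pos]
  rw [abs_mul, abs_of_pos Real.pi_pos] at h4
  have : 2 / Real.pi * (Real.pi * |θ|) = 2 * |θ| := by field_simp
  linarith

lemma geom_bound (β : ℝ) (a b : ℕ) (K : ℝ) (hK : 0 ≤ K) (hab : (b:ℝ) - a ≤ K) :
    ‖∑ j ∈ Finset.Ico a b, e (β * j)‖ ≤ 2 * FF K β := by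
  rcases le_or_gt b a with hba | hba
  · rw [Finset.Ico_eq_empty (by omega)]; simp [FF_nonneg hK]
  have hd := dn_nonneg β
  set S := ∑ j ∈ Finset.Ico a b, e (β * j) with hS
  have h1 : ‖S‖ ≤ K := by
    refine le_trans (norm_sum_le _ _) ?_
    simp only [e_norm]
    simp only [Finset.sum_const, Nat.card_Ico, nsmul_eq_mul, mul_one]
    rw [Nat.cast_sub hba.le]; exact hab
  have h2 : S * (e β - 1) = e β ^ b - e β ^ a := by
    rw [hS]; simp only [e_nat_mul]
    exact geom_sum_Ico_mul _ hba.le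
  have h3 : ‖S‖ * ‖e β - 1‖ ≤ 2 := by
    rw [← norm_mul, h2]
    refine le_trans (norm_sub_le _ _) ?_
    simp only [norm_pow, e_norm, one_pow]; norm_num
  have h4 := e_sub_one_norm β
  have h5 : ‖S‖ * (4 * dn β) ≤ 2 := le_trans (mul_le_mul_of_nonneg_left h4 (norm_nonneg _)) h3
  unfold FF
  rw [← mul_div_assoc, le_div_iff₀ (by positivity)]
  nlinarith [norm_nonneg S]

lemma dn_le_abs_sub (β : ℝ) (n : ℤ) : dn β ≤ |β - n| := round_le β n

lemma spacing (α : ℝ) (a : ℤ) (q : ℕ) (hq : 1 ≤ q) (hco : Int.gcd a q = 1)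
    (hα : |α - a / q| ≤ 1 / (q:ℝ)^2) (n : ℤ) (hn : n ≠ 0) (hn2 : 2 * |n| ≤ q) :
    1 / (2 * (q:ℝ)) ≤ dn (α * n) := by
  have hq0 : (0:ℝ) < q := by exact_mod_cast hq
  set r := round (α * n) with hr
  have h1 : (1:ℝ) ≤ |(a * n - r * q : ℤ)| := by
    have : a * n - r * q ≠ 0 := by
      intro h
      have h2 : (q:ℤ) ∣ a * n := ⟨r, by linarith⟩
      have h3 : (q:ℤ) ∣ n := by
        apply Int.dvd_of_dvd_mul_right_of_gcd_one h2
        rw [Int.gcd_comm]; exact hco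
      have h4 := Int.le_of_dvd (abs_pos.mpr hn) ((dvd_abs _ _).mpr h3)
      have := abs_pos.mpr hn
      omega
    exact_mod_cast Int.one_le_abs this
  have h2 : α * n - r = (α - a / q) * n + ((a * n - r * q : ℤ) : ℝ) / q := by
    push_cast; field_simp; ring
  unfold dn
  rw [← hr, h2]
  have h3 : |(α - a/q) * n| ≤ 1 / (2 * (q:ℝ)) := by
    rw [abs_mul]
    have h5 : 2 * |(n:ℝ)| ≤ q := by exact_mod_cast hn2
    calc |α - a/q| * |(n:ℝ)| ≤ 1 / (q:ℝ)^2 * (q/2) := by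
          apply mul_le_mul hα (by linarith) (abs_nonneg _) (by positivity)
      _ = 1 / (2 * (q:ℝ)) := by field_simp
  have h4 : 1 / (q:ℝ) ≤ |((a * n - r * q : ℤ) : ℝ) / q| := by
    rw [abs_div, abs_of_pos hq0]
    gcongr
    exact_mod_cast h1
  have h5 := abs_sub_abs_le_abs_add (((a * n - r * q : ℤ) : ℝ) / q) ((α - a/q) * n)
  rw [add_comm] at h5
  have : 1 / (q:ℝ) = 1 / (2*q) + 1/(2*(q:ℝ)) := by field_simp; norm_num
  linarith

lemma harm_bound (q : ℕ) (hq : 1 ≤ q) (K : ℝ) (hK : 0 < K) :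
    ∑ i ∈ Finset.range (q+1), K / (1 + K * (i / (2 * (q:ℝ)))) ≤ K + 2 * q * (1 + Real.log q) := by
  have hq0 : (0:ℝ) < q := by exact_mod_cast hq
  rw [Finset.sum_range_succ']
  have h1 : ∑ k ∈ Finset.range q, K / (1 + K * (((k+1:ℕ):ℝ) / (2 * (q:ℝ)))) ≤
      ∑ k ∈ Finset.range q, 2 * q * (((k+1:ℕ):ℝ))⁻¹ := by
    apply Finset.sum_le_sum
    intro k _
    have hk : (0:ℝ) < ((k+1:ℕ):ℝ) := by positivity
    rw [← div_eq_mul_inv, div_le_div_iff₀ (by positivity) hk]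
    have : K * ((k+1:ℕ):ℝ) = 2 * q * (K * (((k+1:ℕ):ℝ) / (2 * (q:ℝ)))) := by field_simp
    rw [this]
    nlinarith
  rw [← Finset.mul_sum] at h1
  have h2 : ∑ k ∈ Finset.range q, (((k+1:ℕ):ℝ))⁻¹ ≤ 1 + Real.log q := by
    have := harmonic_le_one_add_log q
    rw [harmonic] at this
    push_cast at this ⊢
    exact this
  have h3 : 2 * (q:ℝ) * ∑ k ∈ Finset.range q, (((k+1:ℕ):ℝ))⁻¹ ≤ 2 * q * (1 + Real.log q) := by
    gcongr
  simp only [Nat.cast_zero, zero_div, mul_zero, add_zero, div_one]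
  linarith

lemma block_bound (α : ℝ) (a : ℤ) (q : ℕ) (hq : 1 ≤ q) (hco : Int.gcd a q = 1)
    (hα : |α - a / q| ≤ 1 / (q:ℝ)^2) (K : ℝ) (hK : 0 < K) (s : Finset ℕ)
    (hs : ∀ i ∈ s, ∀ j ∈ s, 2 * |(i:ℤ) - j| ≤ q) :
    ∑ i ∈ s, FF K (α * i) ≤ 2 * (K + 2 * q * (1 + Real.log q)) := by
  have hq0 : (0:ℝ) < q := by exact_mod_cast hq
  set fl : ℕ → ℤ := fun i => ⌊2 * q * (α * i - round (α * i))⌋ with hfl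
  set G : ℕ → ℝ := fun i => K / (1 + K * (i / (2 * (q:ℝ)))) with hG
  have hGn : ∀ i, 0 ≤ G i := by intro i; simp only [hG]; positivity
  -- injectivity
  have hinj : Set.InjOn fl s := by
    intro i hi j hj hij
    by_contra hne
    have h1 := Int.abs_sub_lt_one_of_floor_eq_floor hij
    have h2 := spacing α a q hq hco hα ((i:ℤ) - j) (by omega) (hs i hi j hj)
    have h3 := dn_le_abs_sub (α * ((i:ℤ)-j : ℤ)) (round (α * i) - round (α * j))
    have h4 : 2 * q * (α * i - round (α * i)) - 2 * q * (α * j - round (α * j)) =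
      2 * q * (α * ((i:ℤ)-j : ℤ) - ((round (α * i) - round (α * j) : ℤ):ℝ)) := by push_cast; ring
    rw [h4, abs_mul, abs_of_pos (by positivity)] at h1
    have h5 : 1 / (2 * (q:ℝ)) ≤ |α * ((i:ℤ)-j : ℤ) - ((round (α * i) - round (α * j) : ℤ):ℝ)| := le_trans h2 h3
    rw [div_le_iff₀ (by positivity)] at h5
    linarith
  have hb : ∀ i, |2 * q * (α * i - round (α * i))| ≤ q := by
    intro i
    rw [abs_mul, abs_of_pos (by positivity)]
    have := dn_le_half (α * i)
    unfold dn at this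
    nlinarith
  have key : ∀ j : ℤ, 0 ≤ j → ∀ i, j ≤ 2 * q * dn (α * i) → FF K (α * i) ≤ G j.toNat := by
    intro j hj i h
    simp only [hG]; unfold FF
    have : ((j.toNat : ℕ) : ℝ) = (j:ℝ) := by exact_mod_cast Int.toNat_of_nonneg hj
    rw [this]
    have hj' : (0:ℝ) ≤ j := by exact_mod_cast hj
    apply div_le_div_of_nonneg_left hK.le (by positivity)
    gcongr
    rw [div_le_iff₀ (by positivity)]; linarith
  rw [← Finset.sum_filter_add_sum_filter_not s (fun i => 0 ≤ fl i)]
  have A1 : ∑ i ∈ s with 0 ≤ fl i, FF K (α * i) ≤ ∑ i ∈ Finset.range (q+1), G i := by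
    calc _ ≤ ∑ i ∈ s with 0 ≤ fl i, G (fl i).toNat := by
          apply Finset.sum_le_sum
          intro i hi
          simp only [Finset.mem_filter] at hi
          apply key _ hi.2
          have := Int.floor_le (2 * q * (α * i - round (α * i)))
          refine le_trans this ?_
          unfold dn
          exact mul_le_mul_of_nonneg_left (le_abs_self _) (by positivity)
      _ = ∑ j ∈ (s.filter (fun i => 0 ≤ fl i)).image (fun i => (fl i).toNat), G j := by
          rw [Finset.sum_image]
          intro i hi j hj hij
          simp only [Finset.coe_filter, Set.mem_ofPred_eq] at hi hj
          apply hinj hi.1 hj.1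
          simp only at hij
          omega
      _ ≤ _ := by
          apply Finset.sum_le_sum_of_subset_of_nonneg
          · intro j hj
            simp only [Finset.mem_image, Finset.mem_filter, Finset.mem_range] at hj ⊢
            obtain ⟨i, ⟨hi, hi0⟩, rfl⟩ := hj
            have h1 : fl i ≤ q := by
              have h2 := Int.floor_le (2 * q * (α * i - round (α * i)))
              have h3 := (abs_le.mp (hb i)).2
              have : ((fl i : ℤ):ℝ) ≤ q := le_trans h2 h3
              exact_mod_cast this
            omega
          · intros; exact hGn _
  have A2 : ∑ i ∈ s with ¬ 0 ≤ fl i, FF K (α * i) ≤ ∑ i ∈ Finset.range (q+1), G i := by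
    calc _ ≤ ∑ i ∈ s with ¬ 0 ≤ fl i, G (- fl i - 1).toNat := by
          apply Finset.sum_le_sum
          intro i hi
          simp only [Finset.mem_filter] at hi
          apply key _ (by omega)
          have := Int.lt_floor_add_one (2 * q * (α * i - round (α * i)))
          have h2 : 2 * q * (-(α * i - round (α * i))) ≤ 2 * q * dn (α * i) := by
            unfold dn
            exact mul_le_mul_of_nonneg_left (neg_le_abs _) (by positivity)
          push_cast
          simp only [hfl]
          linarith
      _ = ∑ j ∈ (s.filter (fun i => ¬ 0 ≤ fl i)).image (fun i => (-fl i-1).toNat), G j := by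
          rw [Finset.sum_image]
          intro i hi j hj hij
          simp only [Finset.coe_filter, Set.mem_ofPred_eq] at hi hj
          apply hinj hi.1 hj.1
          simp only at hij
          omega
      _ ≤ _ := by
          apply Finset.sum_le_sum_of_subset_of_nonneg
          · intro j hj
            simp only [Finset.mem_image, Finset.mem_filter, Finset.mem_range] at hj ⊢
            obtain ⟨i, ⟨hi, hi0⟩, rfl⟩ := hj
            have h1 : -(q:ℤ) ≤ fl i := by
              apply Int.le_floor.mpr
              have h3 := (abs_le.mp (hb i)).1
              push_cast; exact h3
            omega
          · intros; exact hGn _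
  have := harm_bound q hq K hK
  linarith

lemma vino (α : ℝ) (a : ℤ) (q : ℕ) (hq : 1 ≤ q) (hco : Int.gcd a q = 1)
    (hα : |α - a / q| ≤ 1 / (q:ℝ)^2) (K : ℝ) (hK : 0 < K) (X : ℕ) :
    ∑ i ∈ Finset.Icc 1 X, FF K (α * i) ≤ 8 * (X / q + 1) * (K + q * (1 + Real.log q)) := by
  have hq0 : (0:ℝ) < q := by exact_mod_cast hq
  set b := q / 2 + 1 with hb
  have hl : 0 ≤ Real.log q := Real.log_nonneg (by exact_mod_cast hq)
  rw [← Finset.sum_fiberwise_of_maps_to (s := Finset.Icc 1 X) (t := Finset.range (X / b + 1)) (g := fun i => i / b)]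
  · have h1 : ∀ j ∈ Finset.range (X / b + 1), ∑ i ∈ Finset.Icc 1 X with i / b = j, FF K (α * i) ≤ 2 * (K + 2 * q * (1 + Real.log q)) := by
      intro j _
      apply block_bound α a q hq hco hα K hK
      intro i hi k hk
      simp only [Finset.mem_filter] at hi hk
      have h2 := Nat.div_add_mod i b
      have h3 := Nat.div_add_mod k b
      have h4 := Nat.mod_lt i (show 0 < b by omega)
      have h5 := Nat.mod_lt k (show 0 < b by omega)
      rw [hi.2] at h2
      rw [hk.2] at h3
      rcases abs_cases ((i:ℤ) - k) with h | h <;> omega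
    refine le_trans (Finset.sum_le_sum h1) ?_
    simp only [Finset.sum_const, Finset.card_range, nsmul_eq_mul]
    have h2 : ((X / b + 1 : ℕ):ℝ) ≤ 2 * (X / q + 1) := by
      push_cast
      have h3 : ((X / b : ℕ) : ℝ) ≤ X / b := Nat.cast_div_le
      have h4 : (X:ℝ) / b ≤ X / (q / 2) := by
        apply div_le_div_of_nonneg_left (by positivity) (by positivity)
        have : q ≤ 2 * b := by omega
        have : (q:ℝ) ≤ 2 * b := by exact_mod_cast this
        linarith
      have h5 : (X:ℝ) / (q/2) = 2 * (X / q) := by field_simp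
      linarith
    calc _ ≤ 2 * ((X:ℝ) / q + 1) * (2 * (K + 2 * q * (1 + Real.log q))) := by
          gcongr
      _ ≤ 2 * ((X:ℝ) / q + 1) * (4 * (K + q * (1 + Real.log q))) := by
          apply mul_le_mul_of_nonneg_left _ (by positivity)
          nlinarith
      _ = _ := by ring
  · intro i hi
    simp only [Finset.mem_Icc, Finset.mem_range] at hi ⊢
    have := Nat.div_le_div_right (c := b) hi.2
    omega


def tau (n : ℕ) : ℝ := (n.divisors.card : ℝ)

lemma tau_nonneg (n : ℕ) : 0 ≤ tau n := by unfold tau; positivity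

lemma one_le_tau {n : ℕ} (hn : 1 ≤ n) : 1 ≤ tau n := by
  unfold tau
  have : 0 < n.divisors.card := Finset.card_pos.mpr ⟨1, by simp; omega⟩
  exact_mod_cast this

lemma tau_mul_le (m n : ℕ) : tau (m * n) ≤ tau m * tau n := by
  unfold tau
  have h := Nat.divisors_mul m n
  rw [h]
  exact_mod_cast Finset.card_mul_le

lemma tau_mono {m n : ℕ} (h : m ∣ n) (hn : n ≠ 0) : tau m ≤ tau n := by
  unfold tau
  exact_mod_cast Finset.card_le_card (Nat.divisors_subset_of_dvd hn h)

/-- log factor -/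
def LL (X : ℝ) : ℝ := 1 + Real.log X

lemma conv_sum_le (X : ℕ) (f g : ℕ → ℝ) (hf : ∀ n, 0 ≤ f n) (hg : ∀ n, 0 ≤ g n) :
    ∑ n ∈ Finset.Icc 1 X, ∑ p ∈ n.divisorsAntidiagonal, f p.1 * g p.2 ≤
    (∑ n ∈ Finset.Icc 1 X, f n) * (∑ n ∈ Finset.Icc 1 X, g n) := by
  rw [Finset.sum_mul_sum, ← Finset.sum_product', Finset.sum_sigma']
  have hmaps : ∀ a ∈ (Finset.Icc 1 X).sigma (fun n => n.divisorsAntidiagonal), a.2.1 * a.2.2 = a.1 := by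
    intro a ha
    simp only [Finset.mem_sigma, Nat.mem_divisorsAntidiagonal] at ha
    exact ha.2.1
  calc _ = ∑ p ∈ ((Finset.Icc 1 X).sigma (fun n => n.divisorsAntidiagonal)).image (fun a => a.2), f p.1 * g p.2 := by
        rw [Finset.sum_image]
        intro a ha b hb hab
        simp only at hab
        have h1 := hmaps a ha
        have h2 := hmaps b hb
        rw [hab, h2] at h1
        ext
        · exact h1.symm
        · simp [hab]
    _ ≤ _ := by
        apply Finset.sum_le_sum_of_subset_of_nonneg
        · intro p hp
          simp only [Finset.mem_image, Finset.mem_sigma, Nat.mem_divisorsAntidiagonal, Finset.mem_Icc] at hp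
          obtain ⟨⟨n, p'⟩, ⟨h1, h2, h3⟩, rfl⟩ := hp
          simp only at h1 h2 h3 ⊢
          simp only [Finset.mem_product, Finset.mem_Icc]
          have hp1 : p'.1 ≠ 0 := by rintro h; rw [h] at h2; simp at h2; omega
          have hp2 : p'.2 ≠ 0 := by rintro h; rw [h] at h2; simp at h2; omega
          have := Nat.le_mul_of_pos_right p'.1 (Nat.pos_of_ne_zero hp2)
          have := Nat.le_mul_of_pos_left p'.2 (Nat.pos_of_ne_zero hp1)
          refine ⟨⟨?_, ?_⟩, ?_, ?_⟩ <;> omega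
        · intros; exact mul_nonneg (hf _) (hg _)

lemma tau_moment_log (E : ℕ) (X : ℕ) :
    ∑ n ∈ Finset.Icc 1 X, tau n ^ E / n ≤ (LL X) ^ (2^E) := by
  induction E with
  | zero =>
    simp only [pow_zero, pow_one]
    have := harmonic_le_one_add_log X
    rw [harmonic_eq_sum_Icc] at this
    push_cast at this
    simpa [LL] using this
  | succ E ih =>
    have h0 : 0 ≤ ∑ n ∈ Finset.Icc 1 X, tau n ^ E / n :=
      Finset.sum_nonneg (fun n _ => div_nonneg (pow_nonneg (tau_nonneg _) _) (by positivity))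
    calc _ ≤ ∑ n ∈ Finset.Icc 1 X, ∑ p ∈ n.divisorsAntidiagonal, (tau p.1 ^ E / p.1) * (tau p.2 ^ E / p.2) := by
          apply Finset.sum_le_sum
          intro n hn
          simp only [Finset.mem_Icc] at hn
          have h1 : tau n ^ (E+1) / n = ∑ p ∈ n.divisorsAntidiagonal, tau n ^ E / n := by
            rw [Finset.sum_const, nsmul_eq_mul]
            have : (n.divisorsAntidiagonal.card : ℝ) = tau n := by
              unfold tau
              rw [← Nat.map_div_right_divisors, Finset.card_map]
            rw [this]; ring
          rw [h1]
          apply Finset.sum_le_sum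
          intro p hp
          simp only [Nat.mem_divisorsAntidiagonal] at hp
          rw [div_mul_div_comm, ← mul_pow]
          have h2 : ((p.1:ℝ) * p.2) = n := by rw [← hp.1]; push_cast; ring
          rw [h2]
          have h3 : tau n ≤ tau p.1 * tau p.2 := by rw [← hp.1]; exact tau_mul_le _ _
          have := tau_nonneg n
          gcongr
      _ ≤ _ := conv_sum_le X (fun n => tau n ^ E / n) (fun n => tau n ^ E / n)
          (fun n => div_nonneg (pow_nonneg (tau_nonneg _) _) (by positivity))
          (fun n => div_nonneg (pow_nonneg (tau_nonneg _) _) (by positivity))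
      _ ≤ (LL X) ^ (2^E) * (LL X) ^ (2^E) := mul_le_mul ih ih h0 (h0.trans ih)
      _ = _ := by rw [← pow_add]; congr 1; ring

lemma tau_moment (E : ℕ) (X : ℕ) :
    ∑ n ∈ Finset.Icc 1 X, tau n ^ E ≤ X * (LL X) ^ (2^E) := by
  refine le_trans ?_ (mul_le_mul_of_nonneg_left (tau_moment_log E X) (by positivity))
  rw [Finset.mul_sum]
  apply Finset.sum_le_sum
  intro n hn
  simp only [Finset.mem_Icc] at hn
  have h1 : (0:ℝ) < n := by exact_mod_cast hn.1
  have h2 : (n:ℝ) ≤ X := by exact_mod_cast hn.2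
  rw [← mul_div_assoc, le_div_iff₀ h1, mul_comm]
  exact mul_le_mul_of_nonneg_right h2 (pow_nonneg (tau_nonneg _) _)

lemma LL_mono {X Y : ℝ} (hX : 0 < X) (h : X ≤ Y) : LL X ≤ LL Y := by
  unfold LL; linarith [Real.log_le_log hX h]

/-- real form: n ≤ X ≤ Y -/
lemma tau_moment' (E : ℕ) (X : ℕ) (V Y : ℝ) (h : (X:ℝ) ≤ V) (hV : 0 ≤ V) (hY : 1 ≤ Y) (hVY : V ≤ Y) :
    ∑ n ∈ Finset.Icc 1 X, tau n ^ E ≤ V * (LL Y) ^ (2^E) := by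
  have hY0 : 0 ≤ LL Y := by unfold LL; linarith [Real.log_nonneg hY]
  rcases Nat.eq_zero_or_pos X with h0 | h0
  · subst h0; simp; positivity
  refine le_trans (tau_moment E X) ?_
  have hX : (1:ℝ) ≤ X := by exact_mod_cast h0
  have : 0 ≤ LL X := by unfold LL; linarith [Real.log_nonneg hX]
  have := LL_mono (show (0:ℝ) < X by linarith) (h.trans hVY)
  gcongr

lemma weighted_vino (α : ℝ) (a : ℤ) (q : ℕ) (hq : 1 ≤ q) (hco : Int.gcd a q = 1)
    (hα : |α - a / q| ≤ 1 / (q:ℝ)^2) (K : ℝ) (hK : 0 < K) (X : ℕ) (V Y : ℝ) (h : (X:ℝ) ≤ V)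
    (hY : 1 ≤ Y) (hVY : V ≤ Y) (hqY : q ≤ Y) :
    ∑ i ∈ Finset.Icc 1 X, tau i ^ 2 * FF K (α * i) ≤
      3 * (LL Y)^9 * Real.sqrt ((V * K) * ((V/q + 1) * (K + q))) := by
  have hq0 : (0:ℝ) < q := by exact_mod_cast hq
  have hV : 0 ≤ V := le_trans (by positivity) h
  have hY1 : 1 ≤ LL Y := by unfold LL; linarith [Real.log_nonneg hY]
  have hY0 : 0 ≤ LL Y := by linarith
  have h1 : (∑ i ∈ Finset.Icc 1 X, tau i ^ 2 * FF K (α * i))^2 ≤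
     (∑ i ∈ Finset.Icc 1 X, tau i ^ 4 * K) * (∑ i ∈ Finset.Icc 1 X, FF K (α * i)) := by
    apply Finset.sum_sq_le_sum_mul_sum_of_sq_le_mul
    · intro i _; exact mul_nonneg (pow_nonneg (tau_nonneg _) _) hK.le
    · intro i _; exact FF_nonneg hK.le _
    · intro i _
      have h1 := FF_le hK.le (α * i)
      have h2 := FF_nonneg hK.le (α * i)
      have : (tau i ^ 2 * FF K (α * i))^2 = tau i ^ 4 * FF K (α*i) * FF K (α * i) := by ring
      rw [this]
      have := tau_nonneg i
      gcongr
  have h2 : ∑ i ∈ Finset.Icc 1 X, tau i ^ 4 * K ≤ V * (LL Y)^16 * K := by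
    rw [← Finset.sum_mul]
    have := tau_moment' 4 X V Y h hV hY hVY
    norm_num at this
    gcongr
  have h3 : ∑ i ∈ Finset.Icc 1 X, FF K (α * i) ≤ 8 * (V/q+1) * ((K + q) * LL Y) := by
    refine le_trans (vino α a q hq hco hα K hK X) ?_
    have h4 : 1 + Real.log q ≤ LL Y := LL_mono hq0 hqY
    have h5 : K + q * (1 + Real.log q) ≤ (K + q) * LL Y := by nlinarith
    have : 0 ≤ Real.log q := Real.log_nonneg (by exact_mod_cast hq)
    gcongr
  have h30 : 0 ≤ ∑ i ∈ Finset.Icc 1 X, FF K (α * i) := Finset.sum_nonneg (fun i _ => FF_nonneg hK.le _)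
  refine (le_abs_self _).trans (abs_le_of_sq_le_sq ?_ (by positivity))
  calc _ ≤ _ := h1
    _ ≤ (V * (LL Y)^16 * K) * (8 * (V/q+1) * ((K + q) * LL Y)) := by gcongr
    _ = 8 * LL Y ^ 17 * ((V * K) * ((V/q + 1) * (K + q))) := by ring
    _ ≤ 9 * LL Y ^ 18 * ((V * K) * ((V/q + 1) * (K + q))) := by
        have : LL Y ^ 17 ≤ LL Y ^ 18 := pow_le_pow_right₀ hY1 (by norm_num)
        gcongr
        norm_num
    _ = _ := by
        rw [mul_pow, Real.sq_sqrt (by positivity)]; ring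

lemma multi_vino {ι : Type*} (s : Finset ι) (l p1 p2 : ι → ℕ) (α : ℝ) (K : ℝ) (hK : 0 ≤ K) (X : ℕ)
   (hl : ∀ i ∈ s, 1 ≤ l i ∧ l i ≤ X) (h1 : ∀ i ∈ s, p1 i ∣ l i) (h2 : ∀ i ∈ s, p2 i ∣ l i)
   (hinj : ∀ i ∈ s, ∀ j ∈ s, l i = l j → p1 i = p1 j → p2 i = p2 j → i = j) :
   ∑ i ∈ s, FF K (α * l i) ≤ ∑ n ∈ Finset.Icc 1 X, tau n ^ 2 * FF K (α * n) := by
  rw [← Finset.sum_fiberwise_of_maps_to (s := s) (t := Finset.Icc 1 X) (g := l) 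
    (by intro i hi; exact Finset.mem_Icc.mpr (hl i hi))]
  apply Finset.sum_le_sum
  intro n hn
  simp only [Finset.mem_Icc] at hn
  have : ∑ i ∈ s with l i = n, FF K (α * l i) = ∑ i ∈ s with l i = n, FF K (α * n) := by
    apply Finset.sum_congr rfl
    intro i hi
    simp only [Finset.mem_filter] at hi
    rw [hi.2]
  rw [this, Finset.sum_const, nsmul_eq_mul]
  apply mul_le_mul_of_nonneg_right _ (FF_nonneg hK _)
  have hc : (s.filter (fun i => l i = n)).card ≤ (n.divisors ×ˢ n.divisors).card := by
    apply Finset.card_le_card_of_injOn (fun i => (p1 i, p2 i))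
    · intro i hi
      have hi' := Finset.mem_coe.mp hi
      simp only [Finset.mem_filter] at hi'
      simp only [Finset.coe_product, Set.mem_prod, Finset.mem_coe, Nat.mem_divisors]
      have a1 := h1 i hi'.1
      have a2 := h2 i hi'.1
      rw [hi'.2] at a1 a2
      exact ⟨⟨a1, by omega⟩, a2, by omega⟩
    · intro i hi j hj hij
      have hi' := Finset.mem_coe.mp hi
      have hj' := Finset.mem_coe.mp hj
      simp only [Finset.mem_filter] at hi' hj'
      simp only [Prod.mk.injEq] at hij
      exact hinj i hi'.1 j hj'.1 (by rw [hi'.2, hj'.2]) hij.1 hij.2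
  rw [Finset.card_product] at hc
  unfold tau
  rw [sq]
  exact_mod_cast hc


def ww (x y t : ℝ) (n : ℕ) : ℝ :=
  if x < t ∧ t ≤ 2*x ∧ t < (n:ℝ)^2 ∧ (n:ℝ)^2 ≤ t+y then 1 else 0

def WW (x y : ℝ) (n n' : ℕ) : ℝ := ∫ t, ww x y t n * ww x y t n'

lemma ww_cases (x y t : ℝ) (n : ℕ) : ww x y t n = 0 ∨ ww x y t n = 1 := by
  unfold ww; split_ifs <;> simp

lemma ww_nonneg (x y t : ℝ) (n : ℕ) : 0 ≤ ww x y t n := by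
  rcases ww_cases x y t n with h | h <;> rw [h] <;> norm_num

lemma ww_le_one (x y t : ℝ) (n : ℕ) : ww x y t n ≤ 1 := by
  rcases ww_cases x y t n with h | h <;> rw [h] <;> norm_num

lemma ww_eq_ind (x y : ℝ) (n : ℕ) : (fun t => ww x y t n) =
    Set.indicator (Set.Ioc x (2*x) ∩ Set.Ico ((n:ℝ)^2 - y) ((n:ℝ)^2)) (fun _ => (1:ℝ)) := by
  ext t
  unfold ww Set.indicator
  congr 1
  simp only [Set.mem_inter_iff, Set.mem_Ioc, Set.mem_Ico, eq_iff_iff]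
  constructor
  · rintro ⟨a, b, c, d⟩; exact ⟨⟨a, b⟩, by linarith, c⟩
  · rintro ⟨⟨a, b⟩, c, d⟩; exact ⟨a, b, d, by linarith⟩

lemma ww_meas (x y : ℝ) (n : ℕ) : Measurable (fun t => ww x y t n) := by
  rw [ww_eq_ind]
  exact measurable_const.indicator (measurableSet_Ioc.inter measurableSet_Ico)

lemma int_ww (x y : ℝ) (n n' : ℕ) : Integrable (fun t => ww x y t n * ww x y t n') := by
  have h1 : Integrable (fun t => Set.indicator (Set.Ioc x (2*x)) (fun _ => (1:ℝ)) t) := by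
    rw [integrable_indicator_iff measurableSet_Ioc]
    exact integrableOn_const (by simp)
  apply h1.mono' ((ww_meas x y n).mul (ww_meas x y n')).aestronglyMeasurable
  filter_upwards with t
  simp only [Pi.mul_apply]
  rw [Real.norm_eq_abs, abs_of_nonneg (mul_nonneg (ww_nonneg _ _ _ _) (ww_nonneg _ _ _ _))]
  by_cases ht : t ∈ Set.Ioc x (2*x)
  · rw [Set.indicator_of_mem ht]
    exact mul_le_one₀ (ww_le_one _ _ _ _) (ww_nonneg _ _ _ _) (ww_le_one _ _ _ _)
  · rw [Set.indicator_of_notMem ht]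
    have : ww x y t n = 0 := by
      unfold ww; rw [if_neg]; rintro ⟨a, b, _⟩; exact ht ⟨a, b⟩
    rw [this, zero_mul]

lemma quad_pt {ι : Type*} (s : Finset ι) (z : ι → ℂ) (n : ι → ℕ) (x y t : ℝ) :
    ((‖∑ i ∈ s, z i * (ww x y t (n i) : ℂ)‖^2 : ℝ) : ℂ) =
    ∑ i ∈ s, ∑ j ∈ s, z i * (starRingEnd ℂ) (z j) * ((ww x y t (n i) * ww x y t (n j) : ℝ) : ℂ) := by
  push_cast
  rw [← Complex.mul_conj', map_sum, Finset.sum_mul_sum]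
  apply Finset.sum_congr rfl; intro i _
  apply Finset.sum_congr rfl; intro j _
  rw [map_mul, Complex.conj_ofReal]; ring

lemma quad_int_aux {ι : Type*} (s : Finset ι) (z : ι → ℂ) (n : ι → ℕ) (x y : ℝ) :
    Integrable (fun t => ∑ i ∈ s, ∑ j ∈ s, z i * (starRingEnd ℂ) (z j) * ((ww x y t (n i) * ww x y t (n j) : ℝ) : ℂ)) := by
  apply integrable_finsetSum; intro i _
  apply integrable_finsetSum; intro j _
  exact ((int_ww x y (n i) (n j)).ofReal).const_mul _

lemma quad_int {ι : Type*} (s : Finset ι) (z : ι → ℂ) (n : ι → ℕ) (x y : ℝ) :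
    Integrable (fun t => ‖∑ i ∈ s, z i * (ww x y t (n i) : ℂ)‖^2) := by
  have h := (quad_int_aux s z n x y).re
  refine h.congr ?_
  filter_upwards with t
  rw [← quad_pt]
  exact Complex.ofReal_re _

lemma quad_exp {ι : Type*} (s : Finset ι) (z : ι → ℂ) (n : ι → ℕ) (x y : ℝ) :
    ((∫ t, ‖∑ i ∈ s, z i * (ww x y t (n i) : ℂ)‖^2 : ℝ) : ℂ) =
    ∑ i ∈ s, ∑ j ∈ s, z i * (starRingEnd ℂ) (z j) * (WW x y (n i) (n j) : ℂ) := by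
  rw [← integral_complex_ofReal]
  simp only [quad_pt]
  rw [integral_finsetSum]
  · apply Finset.sum_congr rfl; intro i _
    rw [integral_finsetSum]
    · apply Finset.sum_congr rfl; intro j _
      rw [integral_const_mul]
      congr 1
      exact integral_complex_ofReal
    · intro j _
      exact ((int_ww x y (n i) (n j)).ofReal).const_mul _
  · intro i _
    apply integrable_finsetSum; intro j _
    exact ((int_ww x y (n i) (n j)).ofReal).const_mul _

lemma convex_finset_Ico (S : Finset ℕ) (h : ∀ a ∈ S, ∀ b ∈ S, ∀ c, a ≤ c → c ≤ b → c ∈ S) (hS : S.Nonempty) :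
    S = Finset.Ico (S.min' hS) (S.max' hS + 1) := by
  ext c
  simp only [Finset.mem_Ico]
  constructor
  · intro hc
    have := S.min'_le c hc
    have := S.le_max' c hc
    omega
  · rintro ⟨h1, h2⟩
    exact h _ (S.min'_mem hS) _ (S.max'_mem hS) c h1 (by omega)

lemma key_bound (x y : ℝ) (hy : 0 ≤ y) (a0 b0 : ℕ) (P Q : ℕ → ℕ) (f : ℕ → ℂ) (R : ℝ)
    (hP : ∀ i j, a0 ≤ i → i ≤ j → j < b0 → P i ≤ P j)
    (hPQ : (∀ i j, a0 ≤ i → i ≤ j → j < b0 → (P i:ℝ)^2 - (Q i:ℝ)^2 ≤ (P j:ℝ)^2 - (Q j:ℝ)^2) ∨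
      (∀ i j, a0 ≤ i → i ≤ j → j < b0 → (P j:ℝ)^2 - (Q j:ℝ)^2 ≤ (P i:ℝ)^2 - (Q i:ℝ)^2))
    (hR : ∀ a b, a0 ≤ a → b ≤ b0 → ‖∑ i ∈ Finset.Ico a b, f i‖ ≤ R) :
    ‖∑ i ∈ Finset.Ico a0 b0, f i * (WW x y (P i) (Q i) : ℂ)‖ ≤ y * R := by
  have hR0 : 0 ≤ R := by
    have := hR b0 b0
    by_cases h : a0 ≤ b0
    · exact le_trans (norm_nonneg _) (hR b0 b0 h le_rfl)
    · exact le_trans (norm_nonneg _) (hR a0 b0 le_rfl le_rfl)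
  set v : ℕ → ℝ → ℝ := fun i s => ww x y ((P i:ℝ)^2 - s) (P i) * ww x y ((P i:ℝ)^2 - s) (Q i) with hv
  have hvint : ∀ i, Integrable (v i) := fun i =>
    (int_ww x y (P i) (Q i)).comp_sub_left ((P i:ℝ)^2)
  have hW : ∀ i, WW x y (P i) (Q i) = ∫ s, v i s := by
    intro i
    unfold WW
    exact (integral_sub_left_eq_self (fun t => ww x y t (P i) * ww x y t (Q i)) volume ((P i:ℝ)^2)).symm
  have h1 : ∑ i ∈ Finset.Ico a0 b0, f i * (WW x y (P i) (Q i) : ℂ) =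
      ∫ s, ∑ i ∈ Finset.Ico a0 b0, f i * (v i s : ℂ) := by
    rw [integral_finsetSum]
    · apply Finset.sum_congr rfl; intro i _
      rw [integral_const_mul, hW i]
      congr 1
      exact integral_complex_ofReal.symm
    · intro i _
      exact ((hvint i).ofReal).const_mul _
  rw [h1]
  have hg : Integrable (Set.indicator (Set.Ioc (0:ℝ) y) (fun _ => R)) := by
    rw [integrable_indicator_iff measurableSet_Ioc]
    exact integrableOn_const (by simp)
  have h2 : ∫ s, Set.indicator (Set.Ioc (0:ℝ) y) (fun _ => R) s = y * R := by
    rw [integral_indicator measurableSet_Ioc, setIntegral_const]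
    simp [Measure.real, hy]
  rw [← h2]
  apply norm_integral_le_of_norm_le hg
  filter_upwards with s
  have hvc : ∀ i, v i s = if (x < (P i:ℝ)^2 - s ∧ (P i:ℝ)^2 - s ≤ 2 * x ∧ 0 < s ∧ s ≤ y ∧
      (P i:ℝ)^2 - (Q i:ℝ)^2 < s ∧ s - y ≤ (P i:ℝ)^2 - (Q i:ℝ)^2) then 1 else 0 := by
    intro i
    simp only [hv]; unfold ww
    by_cases h1 : x < (P i:ℝ)^2 - s ∧ (P i:ℝ)^2 - s ≤ 2 * x ∧ (P i:ℝ)^2 - s < (P i:ℝ)^2 ∧ (P i:ℝ)^2 ≤ (P i:ℝ)^2 - s + y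
    · by_cases h2 : x < (P i:ℝ)^2 - s ∧ (P i:ℝ)^2 - s ≤ 2 * x ∧ (P i:ℝ)^2 - s < (Q i:ℝ)^2 ∧ (Q i:ℝ)^2 ≤ (P i:ℝ)^2 - s + y
      · rw [if_pos h1, if_pos h2, if_pos, mul_one]
        obtain ⟨a1,a2,a3,a4⟩ := h1
        obtain ⟨c1,c2,c3,c4⟩ := h2
        exact ⟨a1, a2, by linarith, by linarith, by linarith, by linarith⟩
      · rw [if_neg h2, mul_zero, if_neg]
        rintro ⟨a1,a2,a3,a4,a5,a6⟩
        exact h2 ⟨a1, a2, by linarith, by linarith⟩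
    · rw [if_neg h1, zero_mul, if_neg]
      rintro ⟨a1,a2,a3,a4,a5,a6⟩
      exact h1 ⟨a1, a2, by linarith, by linarith⟩
  by_cases hs : s ∈ Set.Ioc (0:ℝ) y
  · rw [Set.indicator_of_mem hs]
    set Sset := (Finset.Ico a0 b0).filter (fun i => (x < (P i:ℝ)^2 - s ∧ (P i:ℝ)^2 - s ≤ 2 * x ∧ 0 < s ∧ s ≤ y ∧
      (P i:ℝ)^2 - (Q i:ℝ)^2 < s ∧ s - y ≤ (P i:ℝ)^2 - (Q i:ℝ)^2)) with hSs
    have h3 : ∑ i ∈ Finset.Ico a0 b0, f i * (v i s : ℂ) = ∑ i ∈ Sset, f i := by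
      rw [hSs, Finset.sum_filter]
      apply Finset.sum_congr rfl; intro i _
      rw [hvc i]
      split_ifs <;> simp
    rw [h3]
    rcases Finset.eq_empty_or_nonempty Sset with h0 | h0
    · rw [h0]; simpa using hR0
    have hconv := convex_finset_Ico Sset (by
      intro a ha b hb c hac hcb
      simp only [hSs, Finset.mem_filter, Finset.mem_Ico] at ha hb ⊢
      obtain ⟨⟨ha0, ha1⟩, a1,a2,a3,a4,a5,a6⟩ := ha
      obtain ⟨⟨hb0, hb1⟩, b1,b2,b3,b4,b5,b6⟩ := hb
      have p1 : (P a:ℝ)^2 ≤ (P c:ℝ)^2 := by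
        have := hP a c ha0 hac (by omega)
        gcongr
      have p2 : (P c:ℝ)^2 ≤ (P b:ℝ)^2 := by
        have := hP c b (by omega) hcb (by omega)
        gcongr
      refine ⟨by omega, by linarith, by linarith, a3, a4, ?_⟩
      rcases hPQ with h | h
      · have q1 := h a c ha0 hac (by omega)
        have q2 := h c b (by omega) hcb (by omega)
        exact ⟨by linarith, by linarith⟩
      · have q1 := h a c ha0 hac (by omega)
        have q2 := h c b (by omega) hcb (by omega)
        exact ⟨by linarith, by linarith⟩) h0
    rw [hconv]
    have m1 := Sset.min'_mem h0
    have m2 := Sset.max'_mem h0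
    have m1' := Finset.mem_Ico.mp (Finset.mem_of_mem_filter _ m1)
    have m2' := Finset.mem_Ico.mp (Finset.mem_of_mem_filter _ m2)
    apply hR <;> omega
  · rw [Set.indicator_of_notMem hs]
    have : ∀ i, v i s = 0 := by
      intro i
      rw [hvc i, if_neg]
      rintro ⟨_, _, a, b, _⟩
      exact hs ⟨a, b⟩
    simp [this]

lemma WW_nonneg (x y : ℝ) (n n' : ℕ) : 0 ≤ WW x y n n' :=
  integral_nonneg (fun _ => mul_nonneg (ww_nonneg _ _ _ _) (ww_nonneg _ _ _ _))

lemma WW_le (x y : ℝ) (hy : 0 ≤ y) (n n' : ℕ) : WW x y n n' ≤ y := by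
  have := key_bound x y hy 0 1 (fun _ => n) (fun _ => n') (fun _ => 1) 1
    (by intros; rfl) (Or.inl (by intros; rfl)) (by
      intro a b _ hb
      simp only [Finset.sum_const, Nat.card_Ico, nsmul_eq_mul, mul_one]
      rw [Complex.norm_natCast]
      have : b - a ≤ 1 := by omega
      exact_mod_cast this)
  simpa [abs_of_nonneg (WW_nonneg x y n n')] using this

lemma WW_ne_zero {x y : ℝ} {n n' : ℕ} (hyx : y ≤ x) (h : WW x y n n' ≠ 0) :
    x < (n:ℝ)^2 ∧ (n:ℝ)^2 ≤ 3 * x ∧ x < (n':ℝ)^2 ∧ (n':ℝ)^2 ≤ 3 * x ∧ |(n:ℝ)^2 - (n':ℝ)^2| ≤ y := by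
  have : ∃ t, ww x y t n * ww x y t n' ≠ 0 := by
    by_contra! hc
    apply h
    unfold WW
    simp [hc]
  obtain ⟨t, ht⟩ := this
  have h1 : ww x y t n ≠ 0 := left_ne_zero_of_mul ht
  have h2 : ww x y t n' ≠ 0 := right_ne_zero_of_mul ht
  unfold ww at h1 h2
  simp only [ne_eq, ite_eq_right_iff, one_ne_zero, imp_false, not_not] at h1 h2
  obtain ⟨a1,a2,a3,a4⟩ := h1
  obtain ⟨c1,c2,c3,c4⟩ := h2
  refine ⟨by linarith, by linarith, by linarith, by linarith, ?_⟩
  rw [abs_le]; constructor <;> linarith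

lemma WW_comm (x y : ℝ) (n n' : ℕ) : WW x y n n' = WW x y n' n := by
  unfold WW; simp only [mul_comm]

/-- the main functional -/
def JJ (x y α : ℝ) (N : ℕ) (c : ℕ → ℂ) : ℝ :=
  ∫ t, ‖∑ n ∈ Finset.Icc 1 N, c n * e (α * (n:ℝ)^2) * (ww x y t n : ℂ)‖^2

lemma wsum_sq {ι : Type*} (s : Finset ι) (w : ι → ℝ) (hw : ∀ i ∈ s, 0 ≤ w i) (z : ι → ℂ) :
    ‖∑ i ∈ s, (w i : ℂ) * z i‖^2 ≤ (∑ i ∈ s, w i) * ∑ i ∈ s, w i * ‖z i‖^2 := by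
  have h1 : ‖∑ i ∈ s, (w i : ℂ) * z i‖ ≤ ∑ i ∈ s, w i * ‖z i‖ := by
    refine le_trans (norm_sum_le _ _) (Finset.sum_le_sum ?_)
    intro i hi
    rw [norm_mul, Complex.norm_real, Real.norm_eq_abs, abs_of_nonneg (hw i hi)]
  calc _ ≤ (∑ i ∈ s, w i * ‖z i‖)^2 := by gcongr
    _ ≤ _ := by
      apply Finset.sum_sq_le_sum_mul_sum_of_sq_le_mul
      · exact hw
      · intro i hi; exact mul_nonneg (hw i hi) (by positivity)
      · intro i hi; apply le_of_eq; ring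

lemma JJ_sum {ι : Type*} (s : Finset ι) (w : ι → ℝ) (hw : ∀ i ∈ s, 0 ≤ w i) (c : ι → ℕ → ℂ)
    (x y α : ℝ) (N : ℕ) (R : ℝ) (h : ∀ i ∈ s, JJ x y α N (c i) ≤ R) :
    JJ x y α N (fun n => ∑ i ∈ s, (w i : ℂ) * c i n) ≤ (∑ i ∈ s, w i)^2 * R := by
  have hint : ∀ c : ℕ → ℂ, Integrable (fun t => ‖∑ n ∈ Finset.Icc 1 N, c n * e (α * (n:ℝ)^2) * (ww x y t n : ℂ)‖^2) :=
    fun c => quad_int (Finset.Icc 1 N) (fun n => c n * e (α * (n:ℝ)^2)) (fun n => n) x y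
  have hsw : 0 ≤ ∑ i ∈ s, w i := Finset.sum_nonneg hw
  calc JJ x y α N (fun n => ∑ i ∈ s, (w i : ℂ) * c i n)
      ≤ ∫ t, (∑ i ∈ s, w i) * ∑ i ∈ s, w i * ‖∑ n ∈ Finset.Icc 1 N, c i n * e (α * (n:ℝ)^2) * (ww x y t n : ℂ)‖^2 := by
        unfold JJ
        apply integral_mono (hint _)
        · apply Integrable.const_mul
          apply integrable_finsetSum; intro i _
          exact (hint (c i)).const_mul _
        · intro t
          simp only
          refine le_trans (le_of_eq ?_) (wsum_sq s w hw _)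
          congr 2
          simp only [Finset.mul_sum, Finset.sum_mul]
          rw [Finset.sum_comm]
          apply Finset.sum_congr rfl; intro i _
          apply Finset.sum_congr rfl; intro n _
          ring
    _ = (∑ i ∈ s, w i) * ∑ i ∈ s, w i * JJ x y α N (c i) := by
        rw [integral_const_mul, integral_finsetSum]
        · simp only [integral_const_mul]; rfl
        · intro i _
          exact (hint (c i)).const_mul _
    _ ≤ (∑ i ∈ s, w i) * ∑ i ∈ s, w i * R := by
        apply mul_le_mul_of_nonneg_left _ hsw
        apply Finset.sum_le_sum
        intro i hi
        exact mul_le_mul_of_nonneg_left (h i hi) (hw i hi)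
    _ = _ := by rw [← Finset.sum_mul]; ring

lemma JJ_add (c₁ c₂ : ℕ → ℂ) (x y α : ℝ) (N : ℕ) (R : ℝ) (h1 : JJ x y α N c₁ ≤ R) (h2 : JJ x y α N c₂ ≤ R) :
    JJ x y α N (fun n => c₁ n + c₂ n) ≤ 4 * R := by
  have := JJ_sum (Finset.univ : Finset Bool) (fun _ => 1) (by simp) (fun b => if b then c₁ else c₂) x y α N R
    (by intro b _; cases b <;> simpa)
  simp at this
  norm_num at this
  exact this


lemma conv_expand (a b : ArithmeticFunction ℂ) (g : ℕ → ℂ) (N : ℕ) (hg : ∀ n, N < n → g n = 0) :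
    ∑ n ∈ Finset.Icc 1 N, (a * b) n * g n =
    ∑ u ∈ Finset.Icc 1 N, ∑ v ∈ Finset.Icc 1 N, a u * b v * g (u * v) := by
  rw [← Finset.sum_product']
  have h1 : ∑ p ∈ Finset.Icc 1 N ×ˢ Finset.Icc 1 N, a p.1 * b p.2 * g (p.1 * p.2) =
      ∑ p ∈ Finset.Icc 1 N ×ˢ Finset.Icc 1 N with p.1 * p.2 ∈ Finset.Icc 1 N, a p.1 * b p.2 * g (p.1 * p.2) := by
    symm
    apply Finset.sum_filter_of_ne
    intro p hp hne
    simp only [Finset.mem_product, Finset.mem_Icc] at hp ⊢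
    refine ⟨Nat.mul_pos hp.1.1 hp.2.1, ?_⟩
    by_contra hlt
    apply hne
    rw [hg _ (by omega), mul_zero]
  rw [h1, ← Finset.sum_fiberwise_of_maps_to (t := Finset.Icc 1 N) (g := fun p : ℕ × ℕ => p.1 * p.2)
    (by intro p hp; exact (Finset.mem_filter.mp hp).2)]
  apply Finset.sum_congr rfl
  intro n hn
  rw [ArithmeticFunction.mul_apply, Finset.sum_mul]
  have hn' := Finset.mem_Icc.mp hn
  have : n.divisorsAntidiagonal = ((Finset.Icc 1 N ×ˢ Finset.Icc 1 N).filter (fun p => p.1 * p.2 ∈ Finset.Icc 1 N)).filter (fun p => p.1 * p.2 = n) := by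
    ext ⟨u, v⟩
    simp only [Nat.mem_divisorsAntidiagonal, Finset.mem_filter, Finset.mem_product, Finset.mem_Icc]
    constructor
    · rintro ⟨h, h0⟩
      have hu : u ≠ 0 := by rintro rfl; simp at h; omega
      have hv : v ≠ 0 := by rintro rfl; simp at h; omega
      have := Nat.le_mul_of_pos_right u (Nat.pos_of_ne_zero hv)
      have := Nat.le_mul_of_pos_left v (Nat.pos_of_ne_zero hu)
      refine ⟨⟨⟨⟨?_, ?_⟩, ?_, ?_⟩, ?_, ?_⟩, h⟩ <;> omega
    · rintro ⟨_, h⟩; exact ⟨h, by omega⟩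
  rw [this]
  apply Finset.sum_congr rfl
  intro p hp
  rw [(Finset.mem_filter.mp hp).2]

lemma ww_zero {x y : ℝ} (hyx : y ≤ x) {N : ℕ} (hN : ∀ n : ℕ, (n:ℝ)^2 ≤ 3 * x → n ≤ N) (t : ℝ) (n : ℕ)
    (h : N < n) : ww x y t n = 0 := by
  unfold ww; rw [if_neg]
  rintro ⟨_, h1, _, h2⟩
  have := hN n (by linarith)
  omega

lemma sum_lower (s : ℕ) (f : ℕ → ℂ) (a : ℕ) :
   ∑ u ∈ Finset.Ico a s, ∑ u' ∈ Finset.Ico a u, f u * (starRingEnd ℂ) (f u') =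
   ∑ r ∈ Finset.Ico 1 (s - a), ∑ u' ∈ Finset.Ico a (s - r), f (u' + r) * (starRingEnd ℂ) (f u') := by
  rw [Finset.sum_sigma', Finset.sum_sigma']
  apply Finset.sum_nbij' (fun p => ⟨p.1 - p.2, p.2⟩) (fun p => ⟨p.2 + p.1, p.2⟩)
  · intro p hp; simp only [Finset.mem_sigma, Finset.mem_Ico] at hp ⊢; omega
  · intro p hp; simp only [Finset.mem_sigma, Finset.mem_Ico] at hp ⊢; omega
  · rintro ⟨p, q⟩ hp; simp only [Finset.mem_sigma, Finset.mem_Ico] at hp ⊢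
    rw [show q + (p - q) = p by omega]
  · rintro ⟨p, q⟩ hp; simp only [Finset.mem_sigma, Finset.mem_Ico] at hp ⊢
    rw [show q + p - q = p by omega]
  · rintro ⟨p, q⟩ hp; simp only [Finset.mem_sigma, Finset.mem_Ico] at hp ⊢
    rw [show q + (p - q) = p by omega]

lemma sum_symm_split (s : Finset ℕ) (G : ℕ → ℕ → ℝ) (hG : ∀ v v', G v v' = G v' v) :
    ∑ v ∈ s, ∑ v' ∈ s, G v v' = ∑ v ∈ s, G v v + 2 * ∑ v ∈ s, ∑ v' ∈ s with v' < v, G v v' := by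
  have h1 : ∀ v ∈ s, ∑ v' ∈ s, G v v' = G v v + ∑ v' ∈ s with v' < v, G v v' + ∑ v' ∈ s with v < v', G v v' := by
    intro v hv
    rw [Finset.sum_filter, Finset.sum_filter]
    have : G v v = ∑ v' ∈ s, if v = v' then G v v' else 0 := by
      rw [Finset.sum_ite_eq, if_pos hv]
    rw [this, ← Finset.sum_add_distrib, ← Finset.sum_add_distrib]
    apply Finset.sum_congr rfl
    intro v' _
    rcases lt_trichotomy v v' with h | h | h
    · simp [h, h.ne, h.not_gt]
    · simp [h]
    · simp [h, h.ne', h.not_gt]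
  rw [Finset.sum_congr rfl h1, Finset.sum_add_distrib, Finset.sum_add_distrib]
  have h2 : ∑ v ∈ s, ∑ v' ∈ s with v < v', G v v' = ∑ v ∈ s, ∑ v' ∈ s with v' < v, G v v' := by
    simp only [Finset.sum_filter]
    rw [Finset.sum_comm]
    apply Finset.sum_congr rfl; intro v _
    apply Finset.sum_congr rfl; intro v' _
    rw [hG]
  rw [h2]; ring

lemma norm_sq_split (a b : ℕ) (f : ℕ → ℂ) (hf : ∀ u, ‖f u‖ = 1) :
    ‖∑ u ∈ Finset.Ico a b, f u‖^2 ≤ ((b - a : ℕ) : ℝ) +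
     2 * ‖∑ u ∈ Finset.Ico a b, ∑ u' ∈ Finset.Ico a u, f u * (starRingEnd ℂ) (f u')‖ := by
  have h1 : ‖∑ u ∈ Finset.Ico a b, f u‖^2 = ∑ u ∈ Finset.Ico a b, ∑ u' ∈ Finset.Ico a b, (f u * (starRingEnd ℂ) (f u')).re := by
    have : ((‖∑ u ∈ Finset.Ico a b, f u‖^2 : ℝ) : ℂ) = ∑ u ∈ Finset.Ico a b, ∑ u' ∈ Finset.Ico a b, (f u * (starRingEnd ℂ) (f u')) := by
      push_cast
      rw [← Complex.mul_conj', map_sum, Finset.sum_mul_sum]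
    have h2 := congrArg Complex.re this
    rw [Complex.ofReal_re] at h2
    rw [h2]; simp only [Complex.re_sum]
  rw [h1, sum_symm_split]
  · have h3 : ∑ v ∈ Finset.Ico a b, (f v * (starRingEnd ℂ) (f v)).re = ((b - a : ℕ) : ℝ) := by
      rw [Finset.sum_congr rfl (g := fun _ => (1:ℝ))]
      · simp
      · intro v _
        rw [Complex.mul_conj', hf]; simp
    rw [h3]
    gcongr
    have h4 : ∑ v ∈ Finset.Ico a b, ∑ v' ∈ Finset.Ico a b with v' < v, (f v * (starRingEnd ℂ) (f v')).re =
       (∑ u ∈ Finset.Ico a b, ∑ u' ∈ Finset.Ico a u, f u * (starRingEnd ℂ) (f u')).re := by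
      simp only [Complex.re_sum]
      apply Finset.sum_congr rfl; intro v hv
      apply Finset.sum_congr _ (fun _ _ => rfl)
      ext w; simp only [Finset.mem_filter, Finset.mem_Ico] at hv ⊢; omega
    rw [h4]
    exact Complex.re_le_norm _
  · intro v v'
    have : f v' * (starRingEnd ℂ) (f v) = (starRingEnd ℂ) (f v * (starRingEnd ℂ) (f v')) := by
      simp [mul_comm]
    rw [this, Complex.conj_re]

lemma weyl_bound (β : ℝ) (a b U : ℕ) (h : b ≤ a + U) :
    ‖∑ u ∈ Finset.Ico a b, e (β * (u:ℝ)^2)‖^2 ≤ U + 4 * ∑ r ∈ Finset.Icc 1 U, FF U (2 * β * r) := by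
  refine le_trans (norm_sq_split a b (fun u => e (β * (u:ℝ)^2)) (fun u => e_norm _)) ?_
  rw [sum_lower b (fun u => e (β * (u:ℝ)^2)) a]
  have h1 : ‖∑ r ∈ Finset.Ico 1 (b - a), ∑ u' ∈ Finset.Ico a (b - r),
      e (β * ((u' + r : ℕ):ℝ)^2) * (starRingEnd ℂ) (e (β * (u':ℝ)^2))‖ ≤ ∑ r ∈ Finset.Icc 1 U, 2 * FF U (2 * β * r) := by
    refine le_trans (norm_sum_le _ _) ?_
    calc _ ≤ ∑ r ∈ Finset.Ico 1 (b - a), 2 * FF U (2 * β * r) := by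
          apply Finset.sum_le_sum
          intro r hr
          have h2 : ∑ u' ∈ Finset.Ico a (b - r), e (β * ((u' + r : ℕ):ℝ)^2) * (starRingEnd ℂ) (e (β * (u':ℝ)^2))
             = e (β * (r:ℝ)^2) * ∑ u' ∈ Finset.Ico a (b - r), e (2 * β * r * u') := by
            rw [Finset.mul_sum]
            apply Finset.sum_congr rfl
            intro u' _
            rw [e_neg_conj, ← e_add, ← e_add]
            congr 1; push_cast; ring
          rw [h2, norm_mul, e_norm, one_mul]
          apply geom_bound _ _ _ _ (by positivity)
          have : b - r ≤ U + a := by omega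
          have : ((b - r : ℕ):ℝ) ≤ U + a := by exact_mod_cast this
          linarith
      _ ≤ _ := by
          apply Finset.sum_le_sum_of_subset_of_nonneg
          · intro r hr; simp only [Finset.mem_Ico, Finset.mem_Icc] at hr ⊢; omega
          · intros; exact mul_nonneg (by norm_num) (FF_nonneg (by positivity) _)
  rw [← Finset.mul_sum] at h1
  have h3 : ((b - a : ℕ) : ℝ) ≤ U := by
    have : b - a ≤ U := by omega
    exact_mod_cast this
  linarith


def BB (x y α : ℝ) (U v v' : ℕ) : ℝ :=
  ‖∑ u ∈ Finset.Ico U (2*U), e (α * ((v:ℝ)^2 - (v':ℝ)^2) * (u:ℝ)^2) * (WW x y (u*v) (u*v') : ℂ)‖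

lemma BB_symm (x y α : ℝ) (U v v' : ℕ) : BB x y α U v v' = BB x y α U v' v := by
  unfold BB
  rw [← RCLike.norm_conj, map_sum]
  congr 1
  apply Finset.sum_congr rfl
  intro u _
  rw [map_mul, Complex.conj_ofReal, e_neg_conj, WW_comm]
  congr 2; ring

lemma BB_nonneg (x y α : ℝ) (U v v' : ℕ) : 0 ≤ BB x y α U v v' := norm_nonneg _

lemma JJ_le_of_pt (x y α : ℝ) (N : ℕ) (c : ℕ → ℂ) (F : ℝ → ℝ) (hF : Integrable F)
    (h : ∀ t, ‖∑ n ∈ Finset.Icc 1 N, c n * e (α * (n:ℝ)^2) * (ww x y t n : ℂ)‖^2 ≤ F t) :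
    JJ x y α N c ≤ ∫ t, F t := by
  have hint := quad_int (Finset.Icc 1 N) (fun n => c n * e (α * (n:ℝ)^2)) (fun n => n) x y
  exact integral_mono hint hF h

lemma typeII_red (x y α : ℝ) (hyx : y ≤ x) (N U : ℕ) (hN : ∀ n : ℕ, (n:ℝ)^2 ≤ 3 * x → n ≤ N)
    (a b : ArithmeticFunction ℂ) (ha : ∀ u, ‖a u‖ ≤ 1) (ha2 : ∀ u, a u ≠ 0 → U ≤ u ∧ u < 2 * U) :
    JJ x y α N (fun n => (a * b) n) ≤ U * ∑ v ∈ Finset.Icc 1 N, ∑ v' ∈ Finset.Icc 1 N, ‖b v‖ * ‖b v'‖ * BB x y α U v v' := by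
  set G : ℕ → ℝ → ℂ := fun u t => ∑ v ∈ Finset.Icc 1 N, (b v * e (α * ((u*v:ℕ):ℝ)^2)) * (ww x y t (u*v) : ℂ) with hG
  have hGi : ∀ u, Integrable (fun t => ‖G u t‖^2) := fun u =>
    quad_int (Finset.Icc 1 N) (fun v => b v * e (α * ((u*v:ℕ):ℝ)^2)) (fun v => u * v) x y
  have hpt : ∀ t, ‖∑ n ∈ Finset.Icc 1 N, (a * b) n * e (α * (n:ℝ)^2) * (ww x y t n : ℂ)‖^2 ≤
      U * ∑ u ∈ Finset.Ico U (2*U), ‖G u t‖^2 := by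
    intro t
    have h1 : ∑ n ∈ Finset.Icc 1 N, (a * b) n * e (α * (n:ℝ)^2) * (ww x y t n : ℂ) =
        ∑ u ∈ Finset.Icc 1 N, a u * G u t := by
      have := conv_expand a b (fun n => e (α * (n:ℝ)^2) * (ww x y t n : ℂ)) N (by
        intro n hn; simp [ww_zero hyx hN t n hn])
      simp only [mul_assoc] at this ⊢
      rw [this]
      apply Finset.sum_congr rfl; intro u _
      simp only [hG]
      rw [Finset.mul_sum]
      apply Finset.sum_congr rfl; intro v _
      ring
    rw [h1]
    set s := (Finset.Icc 1 N).filter (fun u => U ≤ u ∧ u < 2 * U) with hs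
    have h2 : ∑ u ∈ Finset.Icc 1 N, a u * G u t = ∑ u ∈ s, a u * G u t := by
      symm
      apply Finset.sum_filter_of_ne
      intro u _ hne
      exact ha2 u (left_ne_zero_of_mul hne)
    have hss : s ⊆ Finset.Ico U (2*U) := by
      intro u hu; simp only [hs, Finset.mem_filter] at hu; exact Finset.mem_Ico.mpr hu.2
    have hcard : (s.card : ℝ) ≤ U := by
      have := Finset.card_le_card hss
      rw [Nat.card_Ico] at this
      have : s.card ≤ U := by omega
      exact_mod_cast this
    have h3 : ‖∑ u ∈ s, a u * G u t‖ ≤ ∑ u ∈ s, ‖G u t‖ := by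
      refine le_trans (norm_sum_le _ _) (Finset.sum_le_sum ?_)
      intro u _
      rw [norm_mul]
      exact mul_le_of_le_one_left (norm_nonneg _) (ha u)
    rw [h2]
    calc _ ≤ (∑ u ∈ s, ‖G u t‖)^2 := by gcongr
      _ ≤ s.card * ∑ u ∈ s, ‖G u t‖^2 := sq_sum_le_card_mul_sum_sq
      _ ≤ U * ∑ u ∈ s, ‖G u t‖^2 := by
          apply mul_le_mul_of_nonneg_right hcard
          exact Finset.sum_nonneg (fun _ _ => by positivity)
      _ ≤ _ := by
          apply mul_le_mul_of_nonneg_left _ (by positivity)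
          exact Finset.sum_le_sum_of_subset_of_nonneg hss (fun _ _ _ => by positivity)
  have h4 : JJ x y α N (fun n => (a * b) n) ≤ U * ∑ u ∈ Finset.Ico U (2*U), ∫ t, ‖G u t‖^2 := by
    rw [← integral_finsetSum _ (fun u _ => hGi u), ← integral_const_mul]
    exact JJ_le_of_pt x y α N _ _ ((integrable_finsetSum _ (fun u _ => hGi u)).const_mul _) hpt
  refine le_trans h4 ?_
  apply mul_le_mul_of_nonneg_left _ (by positivity)
  have h5 : ((∑ u ∈ Finset.Ico U (2*U), ∫ t, ‖G u t‖^2 : ℝ) : ℂ) =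
     ∑ v ∈ Finset.Icc 1 N, ∑ v' ∈ Finset.Icc 1 N, b v * (starRingEnd ℂ) (b v') *
       ∑ u ∈ Finset.Ico U (2*U), e (α * ((v:ℝ)^2 - (v':ℝ)^2) * (u:ℝ)^2) * (WW x y (u*v) (u*v') : ℂ) := by
    push_cast
    have : ∀ u, ((∫ t, ‖G u t‖^2 : ℝ) : ℂ) = _ := fun u =>
      quad_exp (Finset.Icc 1 N) (fun v => b v * e (α * ((u*v:ℕ):ℝ)^2)) (fun v => u * v) x y
    simp only [this]
    rw [Finset.sum_comm]
    apply Finset.sum_congr rfl; intro v _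
    rw [Finset.sum_comm]
    apply Finset.sum_congr rfl; intro v' _
    rw [Finset.mul_sum]
    apply Finset.sum_congr rfl; intro u _
    rw [map_mul, e_neg_conj]
    have : e (α * ((v:ℝ)^2 - (v':ℝ)^2) * (u:ℝ)^2) = e (α * ((u*v:ℕ):ℝ)^2) * e (-(α * ((u*v':ℕ):ℝ)^2)) := by
      rw [← e_add]; congr 1; push_cast; ring
    rw [this]; ring
  have h6 : ∑ u ∈ Finset.Ico U (2*U), ∫ t, ‖G u t‖^2 ≤ ‖((∑ u ∈ Finset.Ico U (2*U), ∫ t, ‖G u t‖^2 : ℝ) : ℂ)‖ := by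
    rw [Complex.norm_real]; exact le_abs_self _
  refine le_trans h6 ?_
  rw [h5]
  refine le_trans (norm_sum_le _ _) (Finset.sum_le_sum ?_)
  intro v _
  refine le_trans (norm_sum_le _ _) (Finset.sum_le_sum ?_)
  intro v' _
  rw [norm_mul, norm_mul, RCLike.norm_conj]
  rfl

lemma BB_diag (x y α : ℝ) (hy : 0 ≤ y) (U v : ℕ) : BB x y α U v v ≤ U * y := by
  unfold BB
  refine le_trans (norm_sum_le _ _) ?_
  calc _ ≤ ∑ u ∈ Finset.Ico U (2*U), y := by
        apply Finset.sum_le_sum; intro u _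
        rw [norm_mul, e_norm, one_mul, Complex.norm_real, Real.norm_eq_abs, abs_of_nonneg (WW_nonneg _ _ _ _)]
        exact WW_le x y hy _ _
    _ = _ := by simp; left; omega

def RR (α : ℝ) (U v v' : ℕ) : ℝ :=
  U + 4 * ∑ r ∈ Finset.Icc 1 U, FF U (α * ((2 * r * ((v - v') * (v + v')) : ℕ) : ℝ))

lemma RR_nonneg (α : ℝ) (U v v' : ℕ) : 0 ≤ RR α U v v' := by
  unfold RR
  have : 0 ≤ ∑ r ∈ Finset.Icc 1 U, FF U (α * ((2 * r * ((v - v') * (v + v')) : ℕ) : ℝ)) :=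
    Finset.sum_nonneg (fun _ _ => FF_nonneg (by positivity) _)
  positivity

lemma BB_off (x y α : ℝ) (hy : 0 ≤ y) (U v v' : ℕ) (h : v' < v) :
    BB x y α U v v' ≤ y * Real.sqrt (RR α U v v') := by
  unfold BB
  apply key_bound x y hy U (2*U) (fun u => u * v) (fun u => u * v')
  · intro i j _ hij _; exact Nat.mul_le_mul_right _ hij
  · left
    intro i j _ hij _
    push_cast
    have h1 : (i:ℝ) ≤ j := by exact_mod_cast hij
    have h2 : (v':ℝ) ≤ v := by exact_mod_cast h.le
    have h3 : (v':ℝ)^2 ≤ (v:ℝ)^2 := by gcongr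
    have h4 : (i:ℝ)^2 ≤ (j:ℝ)^2 := by gcongr
    nlinarith
  · intro a b ha hb
    apply Real.le_sqrt_of_sq_le
    refine le_trans (weyl_bound (α * ((v:ℝ)^2 - (v':ℝ)^2)) a b U (by omega)) (le_of_eq ?_)
    unfold RR
    congr 2
    apply Finset.sum_congr rfl
    intro r _
    congr 1
    push_cast [Nat.cast_sub h.le]
    ring

lemma BB_supp (x y α : ℝ) (hx : 1 ≤ x) (hyx : y ≤ x) (U v v' : ℕ) (hU : 1 ≤ U) (h : BB x y α U v v' ≠ 0) :
    v ≤ ⌊2 * Real.sqrt x / U⌋₊ ∧ v' ≤ ⌊2 * Real.sqrt x / U⌋₊ ∧ (v' ≤ v → v - v' ≤ ⌊y / Real.sqrt x / U⌋₊) := by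
  have hx0 : (0:ℝ) < Real.sqrt x := Real.sqrt_pos.mpr (by linarith)
  have hsx : Real.sqrt x ^ 2 = x := Real.sq_sqrt (by linarith)
  have hU0 : (0:ℝ) < U := by exact_mod_cast hU
  have : ∃ u ∈ Finset.Ico U (2*U), WW x y (u*v) (u*v') ≠ 0 := by
    by_contra! hc
    apply h
    unfold BB
    rw [Finset.sum_eq_zero]
    · simp
    · intro u hu; rw [hc u hu]; simp
  obtain ⟨u, hu, hW⟩ := this
  obtain ⟨h1, h2, h3, h4, h5⟩ := WW_ne_zero hyx hW
  have hu' : (U:ℝ) ≤ u := by exact_mod_cast (Finset.mem_Ico.mp hu).1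
  push_cast at h1 h2 h3 h4 h5
  have aux : ∀ w : ℕ, ((u:ℝ)*w)^2 ≤ 3 * x → w ≤ ⌊2 * Real.sqrt x / U⌋₊ := by
    intro w hw
    apply Nat.le_floor
    rw [le_div_iff₀ hU0]
    have h6 : (u:ℝ) * w ≤ 2 * Real.sqrt x := by
      apply (le_abs_self _).trans (abs_le_of_sq_le_sq _ (by positivity))
      have : (2 * Real.sqrt x)^2 = 4 * x := by rw [mul_pow, hsx]; norm_num
      linarith
    calc (w:ℝ) * U ≤ w * u := by gcongr
      _ ≤ _ := by linarith
  refine ⟨aux v h2, aux v' h4, ?_⟩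
  intro hv
  apply Nat.le_floor
  rw [div_div, le_div_iff₀ (by positivity)]
  push_cast [Nat.cast_sub hv]
  have hv' : (v':ℝ) ≤ v := by exact_mod_cast hv
  have aux2 : ∀ w : ℕ, x < ((u:ℝ)*w)^2 → Real.sqrt x ≤ u * w := by
    intro w hw
    apply (le_abs_self _).trans (abs_le_of_sq_le_sq _ (by positivity))
    rw [hsx]; linarith
  have a1 := aux2 v h1
  have a2 := aux2 v' h3
  have h7 := le_trans (le_abs_self _) h5
  calc ((v:ℝ) - v') * (Real.sqrt x * U) ≤ (v - v') * ((u * v + u * v') * u) := by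
        have : 0 ≤ (v:ℝ) - v' := by linarith
        have : Real.sqrt x ≤ u * v + u * v' := by linarith
        gcongr
    _ = ((u:ℝ)*v)^2 - (u*v')^2 := by ring
    _ ≤ y := h7


lemma le_sqrt_self {t : ℝ} (h0 : 0 ≤ t) (h1 : t ≤ 1) : t ≤ Real.sqrt t := by
  have h2 : Real.sqrt t ≤ 1 := Real.sqrt_le_one.mpr h1
  have h3 := Real.sq_sqrt h0
  have h4 := Real.sqrt_nonneg t
  nlinarith

lemma sum_le_sum_supp {ι : Type*} (s t : Finset ι) (f g : ι → ℝ) (h : ∀ i ∈ s, f i ≠ 0 → i ∈ t ∧ f i ≤ g i)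
    (hg : ∀ i ∈ t, 0 ≤ g i) : ∑ i ∈ s, f i ≤ ∑ i ∈ t, g i := by
  rw [← Finset.sum_filter_ne_zero]
  calc _ ≤ ∑ i ∈ s with f i ≠ 0, g i := by
        apply Finset.sum_le_sum; intro i hi
        simp only [Finset.mem_filter] at hi
        exact (h i hi.1 hi.2).2
    _ ≤ _ := by
        apply Finset.sum_le_sum_of_subset_of_nonneg
        · intro i hi
          simp only [Finset.mem_filter] at hi
          exact (h i hi.1 hi.2).1
        · intro i hi _; exact hg i hi

def PP (V Δ : ℕ) : Finset (ℕ × ℕ) :=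
  ((Finset.Icc 1 V) ×ˢ (Finset.Icc 1 V)).filter (fun p => p.2 < p.1 ∧ p.1 - p.2 ≤ Δ)

lemma PP_sum_fst (V Δ : ℕ) (f : ℕ → ℝ) (hf : ∀ n, 0 ≤ f n) :
    ∑ p ∈ PP V Δ, f p.1 ≤ Δ * ∑ v ∈ Finset.Icc 1 V, f v := by
  unfold PP
  rw [Finset.sum_filter, Finset.sum_product, Finset.mul_sum]
  apply Finset.sum_le_sum; intro v hv
  rw [← Finset.sum_filter]
  simp only [Finset.sum_const, nsmul_eq_mul]
  apply mul_le_mul_of_nonneg_right _ (hf v)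
  have : ({x ∈ Finset.Icc 1 V | x < v ∧ v - x ≤ Δ}).card ≤ (Finset.Ico (v - Δ) v).card := by
    apply Finset.card_le_card
    intro w; simp only [Finset.mem_filter, Finset.mem_Icc, Finset.mem_Ico]; omega
  rw [Nat.card_Ico] at this
  exact_mod_cast (by omega : _ ≤ Δ)

lemma PP_sum_snd (V Δ : ℕ) (f : ℕ → ℝ) (hf : ∀ n, 0 ≤ f n) :
    ∑ p ∈ PP V Δ, f p.2 ≤ Δ * ∑ v ∈ Finset.Icc 1 V, f v := by
  unfold PP
  rw [Finset.sum_filter, Finset.sum_product_right, Finset.mul_sum]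
  apply Finset.sum_le_sum; intro v hv
  rw [← Finset.sum_filter]
  simp only [Finset.sum_const, nsmul_eq_mul]
  apply mul_le_mul_of_nonneg_right _ (hf v)
  have : ({x ∈ Finset.Icc 1 V | v < x ∧ x - v ≤ Δ}).card ≤ (Finset.Ioc v (v+Δ)).card := by
    apply Finset.card_le_card
    intro w; simp only [Finset.mem_filter, Finset.mem_Icc, Finset.mem_Ioc]; omega
  rw [Nat.card_Ioc] at this
  exact_mod_cast (by omega : _ ≤ Δ)

lemma PP_card (V Δ : ℕ) : ((PP V Δ).card : ℝ) ≤ Δ * V := by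
  have := PP_sum_fst V Δ (fun _ => 1) (fun _ => by norm_num)
  simpa using this

lemma PP_tau (V Δ E : ℕ) (Vr Y : ℝ) (h : (V:ℝ) ≤ Vr) (hV : 0 ≤ Vr) (hY : 1 ≤ Y) (hVY : Vr ≤ Y) :
    ∑ p ∈ PP V Δ, (tau p.1 ^ E * tau p.2 ^ E)^2 ≤ Δ * (Vr * (LL Y)^(2^(4*E))) := by
  have hm := tau_moment' (4*E) V Vr Y h hV hY hVY
  have h1 := PP_sum_fst V Δ (fun n => tau n ^ (4*E)) (fun n => by have := tau_nonneg n; positivity)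
  have h2 := PP_sum_snd V Δ (fun n => tau n ^ (4*E)) (fun n => by have := tau_nonneg n; positivity)
  have h3 : (Δ:ℝ) * ∑ v ∈ Finset.Icc 1 V, tau v ^ (4*E) ≤ Δ * (Vr * (LL Y)^(2^(4*E))) := by gcongr
  have h4 : ∑ p ∈ PP V Δ, (tau p.1 ^ E * tau p.2 ^ E)^2 ≤
     ∑ p ∈ PP V Δ, (tau p.1 ^ (4*E) / 2 + tau p.2 ^ (4*E) / 2) := by
    apply Finset.sum_le_sum; intro p _
    have e1 : tau p.1 ^ (4*E) = ((tau p.1 ^ E)^2)^2 := by rw [← pow_mul, ← pow_mul]; congr 1; ring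
    have e2 : tau p.2 ^ (4*E) = ((tau p.2 ^ E)^2)^2 := by rw [← pow_mul, ← pow_mul]; congr 1; ring
    rw [e1, e2, mul_pow]
    nlinarith [sq_nonneg ((tau p.1 ^ E)^2 - (tau p.2 ^ E)^2)]
  rw [Finset.sum_add_distrib, ← Finset.sum_div, ← Finset.sum_div] at h4
  linarith

lemma RR_sum (α : ℝ) (a : ℤ) (q : ℕ) (hq : 1 ≤ q) (hco : Int.gcd a q = 1)
    (hα : |α - a / q| ≤ 1 / (q:ℝ)^2) (U V Δ : ℕ) (hU : 1 ≤ U) (W Y : ℝ)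
    (hW : 4 * U * Δ * V ≤ W) (hY : 1 ≤ Y) (hWY : W ≤ Y) (hqY : q ≤ Y) :
    ∑ p ∈ PP V Δ, RR α U p.1 p.2 ≤ U * (Δ * V) + 4 * (3 * (LL Y)^9 * Real.sqrt ((W * U) * ((W/q + 1) * (U + q)))) := by
  have hU0 : (0:ℝ) < U := by exact_mod_cast hU
  unfold RR
  rw [Finset.sum_add_distrib, ← Finset.mul_sum]
  apply add_le_add
  · simp only [Finset.sum_const, nsmul_eq_mul]
    rw [mul_comm]
    exact mul_le_mul_of_nonneg_left (PP_card V Δ) hU0.le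
  · apply mul_le_mul_of_nonneg_left _ (by norm_num)
    refine le_trans ?_ (weighted_vino α a q hq hco hα U hU0 (4*U*Δ*V) W Y (by push_cast; exact hW) hY hWY hqY)
    have := Finset.sum_product (PP V Δ) (Finset.Icc 1 U)
      (fun i => FF U (α * ((2 * i.2 * ((i.1.1 - i.1.2) * (i.1.1 + i.1.2)) : ℕ) : ℝ)))
    rw [← this]
    apply multi_vino (PP V Δ ×ˢ Finset.Icc 1 U) (fun i => 2 * i.2 * ((i.1.1 - i.1.2) * (i.1.1 + i.1.2)))
      (fun i => i.2) (fun i => i.1.1 - i.1.2) α U hU0.le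
    · rintro ⟨⟨v, v'⟩, r⟩ hi
      simp only [PP, Finset.mem_product, Finset.mem_filter, Finset.mem_Icc] at hi ⊢
      obtain ⟨⟨⟨⟨h1, h2⟩, h3, h4⟩, h5, h6⟩, h7, h8⟩ := hi
      constructor
      · have : 1 ≤ v - v' := by omega
        have : 1 ≤ (v - v') * (v + v') := Nat.mul_pos (by omega) (by omega)
        have : 1 ≤ 2 * r := by omega
        exact Nat.mul_pos (by omega) (by omega)
      · calc 2 * r * ((v - v') * (v + v')) ≤ 2 * U * (Δ * (2 * V)) := by
              apply Nat.mul_le_mul (by omega)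
              apply Nat.mul_le_mul h6 (by omega)
          _ = _ := by ring
    · rintro ⟨⟨v, v'⟩, r⟩ hi
      exact Dvd.intro_left 2 rfl |>.mul_right _
    · rintro ⟨⟨v, v'⟩, r⟩ hi
      exact (Dvd.intro _ rfl).mul_left _
    · rintro ⟨⟨v, v'⟩, r⟩ hi ⟨⟨w, w'⟩, r2⟩ hj h1 h2 h3
      simp only [PP, Finset.mem_product, Finset.mem_filter, Finset.mem_Icc] at hi hj h1 h2 h3
      subst h2
      rw [h3] at h1
      have : v + v' = w + w' := by
        have hh := Nat.eq_of_mul_eq_mul_left (by omega) h1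
        exact Nat.eq_of_mul_eq_mul_left (by omega) hh
      simp only [Prod.mk.injEq, and_true]
      omega

set_option maxHeartbeats 1600000 in
theorem typeII (x y α : ℝ) (hx : 1 ≤ x) (hxy : Real.sqrt x ≤ y) (hyx : y ≤ x) (N U : ℕ)
    (hN : ∀ n : ℕ, (n:ℝ)^2 ≤ 3 * x → n ≤ N)
    (a : ℤ) (q : ℕ) (hq : 1 ≤ q) (hco : Int.gcd a q = 1) (hα : |α - a / q| ≤ 1 / (q:ℝ)^2)
    (δ : ℝ) (hδ0 : 0 < δ) (hδ1 : δ ≤ 1) (hq1 : 1 / q ≤ δ) (hq2 : q ≤ δ * y) (hU : 1 ≤ U) (hU1 : 1 / (U:ℝ) ≤ δ)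
    (hU2 : U * Real.sqrt x ≤ δ * y) (E : ℕ)
    (f b : ArithmeticFunction ℂ) (ha : ∀ u, ‖f u‖ ≤ 1) (ha2 : ∀ u, f u ≠ 0 → U ≤ u ∧ u < 2 * U)
    (hb : ∀ v, ‖b v‖ ≤ tau v ^ E) :
    JJ x y α N (fun n => (f * b) n) ≤ 38 * y^2 * LL (8*x) ^ (2^(4*E)+9) * Real.sqrt (Real.sqrt δ) := by
  refine le_trans (typeII_red x y α hyx N U hN f b ha ha2) ?_
  set s := Real.sqrt x with hs
  have hs1 : 1 ≤ s := by rw [hs]; exact Real.one_le_sqrt.mpr hx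
  have hs0 : 0 < s := by linarith
  have hss : s^2 = x := Real.sq_sqrt (by linarith)
  have hU0 : (1:ℝ) ≤ U := by exact_mod_cast hU
  have hUp : (0:ℝ) < U := by linarith
  have hqp : (0:ℝ) < q := by exact_mod_cast hq
  have hy0 : 0 < y := by linarith
  set ℓ := LL (8*x) with hℓ
  have hℓ1 : 1 ≤ ℓ := by
    rw [hℓ]; unfold LL; linarith [Real.log_nonneg (show 1 ≤ 8*x by linarith)]
  set V := ⌊2 * s / U⌋₊ with hV
  set Δ := ⌊y / s / U⌋₊ with hΔ
  have hVr : (V:ℝ) ≤ 2 * s / U := Nat.floor_le (by positivity)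
  have hΔr : (Δ:ℝ) ≤ y / s / U := Nat.floor_le (by positivity)
  have hVx : 2 * s / U ≤ 8 * x := by
    have h5 : 2 * s / U ≤ 2 * s := div_le_self (by positivity) hU0
    linarith
  have hDV : (y / s / U) * (2 * s / U) = 2 * y / U^2 := by field_simp
  set θ := Real.sqrt (Real.sqrt δ) with hθ
  have hθ4 : θ^2 = Real.sqrt δ := Real.sq_sqrt (Real.sqrt_nonneg _)
  have hθ0 : 0 ≤ θ := Real.sqrt_nonneg _
  have hδs : Real.sqrt δ ^ 2 = δ := Real.sq_sqrt hδ0.le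
  have hδ2 : δ ≤ Real.sqrt δ := le_sqrt_self hδ0.le hδ1
  have hθ1 : θ ≤ 1 := Real.sqrt_le_one.mpr (Real.sqrt_le_one.mpr hδ1)
  have hδ3 : δ ≤ θ := hδ2.trans (le_sqrt_self (Real.sqrt_nonneg δ) (Real.sqrt_le_one.mpr hδ1))
  rw [sum_symm_split _ _ (by intro v v'; rw [BB_symm]; ring)]
  -- diagonal
  have hd : ∑ v ∈ Finset.Icc 1 N, ‖b v‖ * ‖b v‖ * BB x y α U v v ≤ 2 * s * y * ℓ^(2^(2*E)) := by
    calc _ ≤ ∑ v ∈ Finset.Icc 1 V, tau v ^ (2*E) * (U * y) := by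
          apply sum_le_sum_supp
          · intro v hv hne
            have hB : BB x y α U v v ≠ 0 := right_ne_zero_of_mul hne
            have := (BB_supp x y α hx hyx U v v hU hB).1
            simp only [Finset.mem_Icc] at hv ⊢
            refine ⟨⟨hv.1, this⟩, ?_⟩
            have h1 := hb v
            have h2 := BB_diag x y α hy0.le U v
            have h3 := BB_nonneg x y α U v v
            have := tau_nonneg v
            calc _ ≤ (tau v ^ E * tau v ^ E) * (U * y) := by gcongr
              _ = _ := by rw [← pow_add]; congr 2; ring
          · intro v _; have := tau_nonneg v; positivity
      _ = (∑ v ∈ Finset.Icc 1 V, tau v ^ (2*E)) * (U * y) := by rw [Finset.sum_mul]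
      _ ≤ (2 * s / U * ℓ^(2^(2*E))) * (U * y) := by
          gcongr
          exact tau_moment' (2*E) V _ _ hVr (by positivity) (by linarith) hVx
      _ = _ := by field_simp
  -- off diagonal
  have ho : ∑ v ∈ Finset.Icc 1 N, ∑ v' ∈ Finset.Icc 1 N with v' < v, ‖b v‖ * ‖b v'‖ * BB x y α U v v' ≤
     y * ∑ p ∈ PP V Δ, (tau p.1 ^ E * tau p.2 ^ E) * Real.sqrt (RR α U p.1 p.2) := by
    have : ∑ v ∈ Finset.Icc 1 N, ∑ v' ∈ Finset.Icc 1 N with v' < v, ‖b v‖ * ‖b v'‖ * BB x y α U v v' =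
       ∑ p ∈ (Finset.Icc 1 N ×ˢ Finset.Icc 1 N).filter (fun p => p.2 < p.1), ‖b p.1‖ * ‖b p.2‖ * BB x y α U p.1 p.2 := by
      rw [Finset.sum_filter, Finset.sum_product]
      apply Finset.sum_congr rfl; intro v _
      rw [Finset.sum_filter]
    rw [this, Finset.mul_sum]
    apply sum_le_sum_supp
    · rintro ⟨v, v'⟩ hp hne
      have hB : BB x y α U v v' ≠ 0 := right_ne_zero_of_mul hne
      simp only [Finset.mem_filter, Finset.mem_product, Finset.mem_Icc] at hp
      obtain ⟨h1, h2, h3⟩ := BB_supp x y α hx hyx U v v' hU hB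
      constructor
      · simp only [PP, Finset.mem_filter, Finset.mem_product, Finset.mem_Icc]
        exact ⟨⟨⟨hp.1.1.1, h1⟩, hp.1.2.1, h2⟩, hp.2, h3 hp.2.le⟩
      · simp only
        have h4 := hb v
        have h5 := hb v'
        have h6 := BB_off x y α hy0.le U v v' hp.2
        have := tau_nonneg v
        have := tau_nonneg v'
        have := BB_nonneg x y α U v v'
        calc _ ≤ (tau v ^ E * tau v' ^ E) * (y * Real.sqrt (RR α U v v')) := by gcongr
          _ = _ := by ring
    · rintro ⟨v, v'⟩ _
      have := tau_nonneg v
      have := tau_nonneg v'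
      simp only; positivity
  have hT1 : ∑ p ∈ PP V Δ, (tau p.1 ^ E * tau p.2 ^ E)^2 ≤ 2 * y / U^2 * ℓ^(2^(4*E)) := by
    refine le_trans (PP_tau V Δ E _ _ hVr (by positivity) (show 1 ≤ 8*x by linarith) hVx) ?_
    rw [← hDV, mul_assoc]
    gcongr
  have hT2 : ∑ p ∈ PP V Δ, RR α U p.1 p.2 ≤ 146 * ℓ^9 * y * Real.sqrt δ := by
    have hdv : (Δ:ℝ) * V ≤ 2 * y / U^2 := by rw [← hDV]; gcongr
    have hqy : (q:ℝ) ≤ y := by linarith [mul_le_of_le_one_left hy0.le hδ1]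
    refine le_trans (RR_sum α a q hq hco hα U V Δ hU (8*y/U) (8*x) ?_ (by linarith) ?_ (by linarith)) ?_
    · calc 4 * U * Δ * V = 4 * U * ((Δ:ℝ) * V) := by ring
        _ ≤ 4 * U * (2 * y / U^2) := by gcongr
        _ = _ := by field_simp; norm_num
    · have h5 : 8 * y / U ≤ 8 * y := div_le_self (by positivity) hU0
      linarith
    · have e1 : (8*y/U*U) * ((8*y/U/q+1)*(U+q)) = 8*y*(8*y*(1/q) + 8*y*(1/(U:ℝ)) + U + q) := by field_simp; ring
      have hUd : (U:ℝ) ≤ δ * y := (le_mul_of_one_le_right hUp.le hs1).trans hU2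
      have e2 : 8*y*(8*y*(1/q) + 8*y*(1/(U:ℝ)) + U + q) ≤ (12 * y * Real.sqrt δ)^2 := by
        rw [mul_pow, mul_pow, hδs]
        have : 8*y*(1/q) + 8*y*(1/(U:ℝ)) + U + q ≤ 8*y*δ + 8*y*δ + δ*y+δ*y := by gcongr
        calc _ ≤ 8*y*(8*y*δ + 8*y*δ + δ*y+δ*y) := by gcongr
          _ = _ := by ring
      have e3 : Real.sqrt ((8*y/U*U) * ((8*y/U/q+1)*(U+q))) ≤ 12 * y * Real.sqrt δ := by
        rw [e1]; exact Real.sqrt_le_iff.mpr ⟨by positivity, e2⟩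
      have e4 : U * ((Δ:ℝ) * V) ≤ 2 * ℓ^9 * y * Real.sqrt δ := by
        calc U * ((Δ:ℝ) * V) ≤ U * (2 * y / U^2) := by gcongr
          _ = 2 * y * (1/(U:ℝ)) := by field_simp
          _ ≤ 2 * y * Real.sqrt δ := by gcongr; linarith
          _ = 2 * 1 * y * Real.sqrt δ := by ring
          _ ≤ _ := by gcongr; exact one_le_pow₀ hℓ1
      calc _ ≤ 2 * ℓ^9 * y * Real.sqrt δ + 4 * (3 * ℓ^9 * (12 * y * Real.sqrt δ)) := by gcongr
        _ = _ := by ring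
  have hC : ∑ p ∈ PP V Δ, (tau p.1 ^ E * tau p.2 ^ E) * Real.sqrt (RR α U p.1 p.2) ≤ 18 * (y / U) * ℓ^(2^(4*E)+9) * θ := by
    refine le_trans (Real.sum_mul_le_sqrt_mul_sqrt _ _ _) ?_
    rw [← Real.sqrt_mul (Finset.sum_nonneg (fun _ _ => sq_nonneg _))]
    have : ∀ p : ℕ × ℕ, Real.sqrt (RR α U p.1 p.2) ^ 2 = RR α U p.1 p.2 := fun p => Real.sq_sqrt (RR_nonneg _ _ _ _)
    simp only [this]
    apply Real.sqrt_le_iff.mpr ⟨by positivity, ?_⟩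
    calc _ ≤ (2 * y / U^2 * ℓ^(2^(4*E))) * (146 * ℓ^9 * y * Real.sqrt δ) := by
          apply mul_le_mul hT1 hT2 (Finset.sum_nonneg (fun _ _ => RR_nonneg _ _ _ _)) (by positivity)
      _ = 292 * (y/U)^2 * (ℓ^(2^(4*E)+9) * 1) * θ^2 := by rw [hθ4, pow_add]; ring
      _ ≤ 324 * (y/U)^2 * (ℓ^(2^(4*E)+9) * ℓ^(2^(4*E)+9)) * θ^2 := by
          gcongr
          · norm_num
          · exact one_le_pow₀ hℓ1
      _ = _ := by ring
  have hp2 : ℓ^(2^(2*E)) ≤ ℓ^(2^(4*E)+9) := by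
    apply pow_le_pow_right₀ hℓ1
    have : 2^(2*E) ≤ 2^(4*E) := Nat.pow_le_pow_right (by norm_num) (by omega)
    omega
  calc _ ≤ U * (2 * s * y * ℓ^(2^(2*E)) + 2 * (y * (18 * (y / U) * ℓ^(2^(4*E)+9) * θ))) := by
        apply mul_le_mul_of_nonneg_left _ hUp.le
        apply add_le_add hd
        apply mul_le_mul_of_nonneg_left _ (by norm_num)
        exact ho.trans (mul_le_mul_of_nonneg_left hC hy0.le)
    _ = 2 * (U * s) * y * ℓ^(2^(2*E)) + 36 * y^2 * ℓ^(2^(4*E)+9) * θ := by field_simp; ring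
    _ ≤ 2 * (θ * y) * y * ℓ^(2^(4*E)+9) + 36 * y^2 * ℓ^(2^(4*E)+9) * θ := by
        have hUs : U * s ≤ θ * y := hU2.trans (mul_le_mul_of_nonneg_right hδ3 hy0.le)
        have : 2 * (U * s) * y * ℓ^(2^(2*E)) ≤ 2 * (θ * y) * y * ℓ^(2^(4*E)+9) :=
          mul_le_mul (by gcongr) hp2 (by positivity) (by positivity)
        linarith
    _ = _ := by ring


def tI (x y α : ℝ) (u u' : ℕ) (p : ℕ × ℕ) : ℂ :=
  e (α * (((u * p.1 : ℕ):ℝ)^2 - ((u' * p.2 : ℕ):ℝ)^2)) * (WW x y (u * p.1) (u' * p.2) : ℂ)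

lemma tI_ne {x y α : ℝ} {u u' : ℕ} {p : ℕ × ℕ} (h : tI x y α u u' p ≠ 0) : WW x y (u * p.1) (u' * p.2) ≠ 0 := by
  intro h0; apply h; unfold tI; rw [h0]; simp

lemma tI_conj (x y α : ℝ) (u u' : ℕ) (p : ℕ × ℕ) : (starRingEnd ℂ) (tI x y α u u' p) = tI x y α u' u p.swap := by
  unfold tI
  rw [map_mul, Complex.conj_ofReal, e_neg_conj, WW_comm]
  congr 2
  simp only [Prod.fst_swap, Prod.snd_swap]; ring

lemma Sh_eq (x y α : ℝ) (hyx : y ≤ x) (N : ℕ) (hN : ∀ n : ℕ, (n:ℝ)^2 ≤ 3 * x → n ≤ N)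
    (u u' h J : ℕ) (hu : 1 ≤ u) (hu' : 1 ≤ u') (hJ : ∀ n : ℕ, (n:ℝ)^2 ≤ 3 * x → n < Nat.lcm u u' * J)
    (hne : ((Finset.Icc 1 N ×ˢ Finset.Icc 1 N).filter (fun p => u * p.1 = u' * p.2 + h)).Nonempty) :
    Nat.gcd u u' ∣ h ∧ ∃ q0 : ℕ, ∑ p ∈ (Finset.Icc 1 N ×ˢ Finset.Icc 1 N).filter (fun p => u * p.1 = u' * p.2 + h), tI x y α u u' p
     = ∑ j ∈ Finset.Ico 0 J, e (α * ((((q0 + h) + Nat.lcm u u' * j : ℕ):ℝ)^2 - ((q0 + Nat.lcm u u' * j : ℕ):ℝ)^2)) *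
        (WW x y ((q0 + h) + Nat.lcm u u' * j) (q0 + Nat.lcm u u' * j) : ℂ) := by
  obtain ⟨g, u1, u1', hg, hcop, rfl, rfl⟩ : ∃ g u1 u1', 0 < g ∧ Nat.Coprime u1 u1' ∧ u = u1 * g ∧ u' = u1' * g := by
    obtain ⟨g, u1, u1', h1, h2, h3, h4⟩ := Nat.exists_coprime' (m := u) (n := u') (Nat.gcd_pos_of_pos_left _ hu)
    exact ⟨g, u1, u1', h1, h2, h3, h4⟩
  have hu1 : 0 < u1 := Nat.pos_of_mul_pos_right hu
  have hu1' : 0 < u1' := Nat.pos_of_mul_pos_right hu'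
  have hlcm : Nat.lcm (u1 * g) (u1' * g) = u1 * g * u1' := by
    rw [Nat.lcm_mul_right, hcop.lcm_eq_mul]; ring
  have hgcd : Nat.gcd (u1 * g) (u1' * g) = g := by
    rw [Nat.gcd_mul_right, hcop.gcd_eq_one, one_mul]
  rw [hlcm] at hJ ⊢
  rw [hgcd]
  obtain ⟨p0, hp0, hmin⟩ := Finset.exists_min_image _ (fun p : ℕ × ℕ => p.2) hne
  simp only [Finset.mem_filter, Finset.mem_product, Finset.mem_Icc] at hp0 hmin
  obtain ⟨k0, k0'⟩ := p0
  simp only at hp0 hmin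
  constructor
  · have h1 : g ∣ u1' * g * k0' + h := by rw [← hp0.2]; exact ⟨u1 * k0, by ring⟩
    exact (Nat.dvd_add_right ⟨u1' * k0', by ring⟩).mp h1
  refine ⟨u1' * g * k0', ?_⟩
  symm
  have ek : ∀ j, u1' * g * k0' + h + u1 * g * u1' * j = u1 * g * (k0 + u1' * j) := by
    intro j; rw [← hp0.2]; ring
  have ek' : ∀ j, u1' * g * k0' + u1 * g * u1' * j = u1' * g * (k0' + u1 * j) := by
    intro j; ring
  have hf : ∀ j, e (α * ((((u1' * g * k0' + h) + u1 * g * u1' * j : ℕ):ℝ)^2 - ((u1' * g * k0' + u1 * g * u1' * j : ℕ):ℝ)^2)) *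
        (WW x y ((u1' * g * k0' + h) + u1 * g * u1' * j) (u1' * g * k0' + u1 * g * u1' * j) : ℂ) =
        tI x y α (u1*g) (u1'*g) (k0 + u1' * j, k0' + u1 * j) := by
    intro j
    unfold tI
    simp only
    rw [ek, ek']
  simp only [hf]
  apply Finset.sum_bij_ne_zero (fun j _ _ => (k0 + u1' * j, k0' + u1 * j))
  · intro j _ hne
    obtain ⟨h1, h2, h3, h4, h5⟩ := WW_ne_zero hyx (tI_ne hne)
    simp only at h1 h2 h3 h4
    have a1 := hN _ h2
    have a2 := hN _ h4
    simp only [Finset.mem_filter, Finset.mem_product, Finset.mem_Icc]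
    refine ⟨⟨⟨by omega, ?_⟩, by omega, ?_⟩, ?_⟩
    · exact le_trans (Nat.le_mul_of_pos_left _ (by omega)) a1
    · exact le_trans (Nat.le_mul_of_pos_left _ (by omega)) a2
    · rw [← ek, ← ek']; ring
  · intro j _ _ j' _ _ heq
    simp only [Prod.mk.injEq] at heq
    have := heq.2
    have : u1 * j = u1 * j' := by omega
    exact Nat.eq_of_mul_eq_mul_left hu1 this
  · rintro ⟨k, k'⟩ hp hne
    obtain ⟨h1, h2, h3, h4, h5⟩ := WW_ne_zero hyx (tI_ne hne)
    have hm := hmin (k, k') (by simpa only [Finset.mem_filter, Finset.mem_product, Finset.mem_Icc] using hp)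
    simp only [Finset.mem_filter, Finset.mem_product, Finset.mem_Icc] at hp hm
    simp only at h1 h2
    have hk : k0 ≤ k := by
      have : u1 * g * k0 ≤ u1 * g * k := by
        rw [hp.2, hp0.2]; exact Nat.add_le_add_right (Nat.mul_le_mul_left _ hm) _
      exact Nat.le_of_mul_le_mul_left this (by omega)
    obtain ⟨d, rfl⟩ := Nat.exists_eq_add_of_le hk
    obtain ⟨d', rfl⟩ := Nat.exists_eq_add_of_le hm
    have hd : u1 * d = u1' * d' := by
      have h6 : u1 * g * (k0 + d) = u1' * g * (k0' + d') + h := hp.2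
      have h7 : u1 * g * k0 = u1' * g * k0' + h := hp0.2
      have : g * (u1 * d) = g * (u1' * d') := by
        have e1 : u1 * g * (k0 + d) = u1 * g * k0 + g * (u1 * d) := by ring
        have e2 : u1' * g * (k0' + d') = u1' * g * k0' + g * (u1' * d') := by ring
        omega
      exact Nat.eq_of_mul_eq_mul_left hg this
    have hdv : u1 ∣ d' := hcop.dvd_of_dvd_mul_left ⟨d, hd.symm⟩
    obtain ⟨j, rfl⟩ := hdv
    have hd2 : d = u1' * j := by
      have : u1 * d = u1 * (u1' * j) := by rw [hd]; ring
      exact Nat.eq_of_mul_eq_mul_left hu1 this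
    subst hd2
    refine ⟨j, ?_, hne, rfl⟩
    have a1 := hJ _ h2
    simp only [Finset.mem_Ico, Nat.zero_le, true_and]
    by_contra hc
    push Not at hc
    have : u1 * g * u1' * J ≤ u1 * g * (k0 + u1' * j) := by
      calc u1 * g * u1' * J ≤ u1 * g * u1' * j := Nat.mul_le_mul_left _ hc
        _ = u1 * g * (u1' * j) := by ring
        _ ≤ _ := Nat.mul_le_mul_left _ (by omega)
    omega
  · intro j _ _; rfl

lemma Sh_bound (x y α : ℝ) (hy : 0 ≤ y) (hyx : y ≤ x) (N : ℕ) (hN : ∀ n : ℕ, (n:ℝ)^2 ≤ 3 * x → n ≤ N)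
    (u u' h J : ℕ) (hu : 1 ≤ u) (hu' : 1 ≤ u') (hJ : ∀ n : ℕ, (n:ℝ)^2 ≤ 3 * x → n < Nat.lcm u u' * J) (K : ℝ)
    (hK : 0 ≤ K) (hJK : J ≤ Nat.gcd u u' * K) (hgh : Nat.gcd u u' ∣ h) :
    ‖∑ p ∈ (Finset.Icc 1 N ×ˢ Finset.Icc 1 N).filter (fun p => u * p.1 = u' * p.2 + h), tI x y α u u' p‖ ≤
      2 * y * (Nat.gcd u u' * FF K (α * ((2 * (h / Nat.gcd u u') * (u * u') : ℕ):ℝ))) := by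
  have hg1 : 1 ≤ Nat.gcd u u' := Nat.gcd_pos_of_pos_left _ hu
  have hg : (1:ℝ) ≤ Nat.gcd u u' := by exact_mod_cast hg1
  have hFF := FF_nonneg hK (α * ((2 * (h / Nat.gcd u u') * (u * u') : ℕ):ℝ))
  rcases Finset.eq_empty_or_nonempty ((Finset.Icc 1 N ×ˢ Finset.Icc 1 N).filter (fun p => u * p.1 = u' * p.2 + h)) with h0 | hne
  · rw [h0, Finset.sum_empty, norm_zero]; positivity
  obtain ⟨-, q0, heq⟩ := Sh_eq x y α hyx N hN u u' h J hu hu' hJ hne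
  rw [heq]
  have hph : ((2 * (h / Nat.gcd u u') * (u * u') : ℕ):ℝ) = 2 * h * Nat.lcm u u' := by
    obtain ⟨h1, rfl⟩ := hgh
    rw [Nat.mul_div_cancel_left _ hg1]
    have : (u * u' : ℕ) = Nat.gcd u u' * Nat.lcm u u' := (Nat.gcd_mul_lcm u u').symm
    rw [this]; push_cast; ring
  have hmain : ∀ a b, 0 ≤ a → b ≤ J → ‖∑ j ∈ Finset.Ico a b, e (α * ((((q0 + h) + Nat.lcm u u' * j : ℕ):ℝ)^2 - ((q0 + Nat.lcm u u' * j : ℕ):ℝ)^2))‖ ≤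
      2 * (Nat.gcd u u' * FF K (α * ((2 * (h / Nat.gcd u u') * (u * u') : ℕ):ℝ))) := by
    intro a b _ hb
    have e1 : ∀ j : ℕ, e (α * ((((q0 + h) + Nat.lcm u u' * j : ℕ):ℝ)^2 - ((q0 + Nat.lcm u u' * j : ℕ):ℝ)^2)) =
       e (α * h * (2 * q0 + h)) * e (α * ((2 * (h / Nat.gcd u u') * (u * u') : ℕ):ℝ) * j) := by
      intro j
      rw [← e_add, hph]; congr 1; push_cast; ring
    simp only [e1]
    rw [← Finset.mul_sum, norm_mul, e_norm, one_mul]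
    have hb' : (b:ℝ) ≤ J := by exact_mod_cast hb
    have ha' : (0:ℝ) ≤ a := by positivity
    refine le_trans (geom_bound _ a b (Nat.gcd u u' * K) (by positivity) (by linarith)) ?_
    exact mul_le_mul_of_nonneg_left (FF_mul_le hK hg _) (by norm_num)
  have := key_bound x y hy 0 J (fun j => (q0 + h) + Nat.lcm u u' * j) (fun j => q0 + Nat.lcm u u' * j) _ _ ?_ ?_ hmain
  · refine le_trans this (le_of_eq (by ring))
  · intro i j _ hij _
    exact Nat.add_le_add_left (Nat.mul_le_mul_left _ hij) _
  · left
    intro i j _ hij _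
    push_cast
    have : (i:ℝ) ≤ j := by exact_mod_cast hij
    have h3 : 0 ≤ (h:ℝ) * Nat.lcm u u' * (j - i) := by
      apply mul_nonneg (by positivity); linarith
    nlinarith


def pI (α K : ℝ) (u u' h : ℕ) : ℝ := Nat.gcd u u' * FF K (α * ((2 * (h / Nat.gcd u u') * (u * u') : ℕ):ℝ))

lemma pI_nonneg (α K : ℝ) (hK : 0 ≤ K) (u u' h : ℕ) : 0 ≤ pI α K u u' h := by
  unfold pI
  have := FF_nonneg hK (α * ((2 * (h / Nat.gcd u u') * (u * u') : ℕ):ℝ))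
  positivity

lemma pI_symm (α K : ℝ) (u u' h : ℕ) : pI α K u u' h = pI α K u' u h := by
  unfold pI; rw [Nat.gcd_comm, mul_comm u u']

lemma CCp (x y α : ℝ) (hx : 1 ≤ x) (hy : 0 ≤ y) (hyx : y ≤ x) (N : ℕ) (hN : ∀ n : ℕ, (n:ℝ)^2 ≤ 3 * x → n ≤ N)
    (u u' J : ℕ) (hu : 1 ≤ u) (hu' : 1 ≤ u') (hJ : ∀ n : ℕ, (n:ℝ)^2 ≤ 3 * x → n < Nat.lcm u u' * J) (K : ℝ)
    (hK : 0 ≤ K) (hJK : J ≤ Nat.gcd u u' * K) :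
    ‖∑ p ∈ (Finset.Icc 1 N ×ˢ Finset.Icc 1 N).filter (fun p => u' * p.2 < u * p.1), tI x y α u u' p‖ ≤
     ∑ h ∈ (Finset.Icc 1 ⌊y / Real.sqrt x⌋₊).filter (fun h => Nat.gcd u u' ∣ h), 2 * y * pI α K u u' h := by
  rw [← Finset.sum_fiberwise_of_maps_to (t := Finset.Icc 1 (u * N)) (g := fun p : ℕ × ℕ => u * p.1 - u' * p.2)
    (by
      rintro ⟨k, k'⟩ hp
      simp only [Finset.mem_filter, Finset.mem_product, Finset.mem_Icc] at hp ⊢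
      have := Nat.mul_le_mul_left u hp.1.1.2
      omega)]
  refine le_trans (norm_sum_le _ _) ?_
  have hfil : ∀ h ∈ Finset.Icc 1 (u*N), ((Finset.Icc 1 N ×ˢ Finset.Icc 1 N).filter (fun p => u' * p.2 < u * p.1)).filter (fun p => u * p.1 - u' * p.2 = h)
     = (Finset.Icc 1 N ×ˢ Finset.Icc 1 N).filter (fun p => u * p.1 = u' * p.2 + h) := by
    intro h hh
    simp only [Finset.mem_Icc] at hh
    rw [Finset.filter_filter]
    apply Finset.filter_congr
    intro p _
    constructor
    · rintro ⟨h1, h2⟩; omega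
    · intro h1; omega
  apply sum_le_sum_supp
  · intro h hh hne
    rw [hfil h hh] at hne ⊢
    have hne2 := norm_ne_zero_iff.mp hne
    have hnon : ((Finset.Icc 1 N ×ˢ Finset.Icc 1 N).filter (fun p => u * p.1 = u' * p.2 + h)).Nonempty := by
      by_contra hc
      rw [Finset.not_nonempty_iff_eq_empty] at hc
      rw [hc] at hne2; simp at hne2
    obtain ⟨hg, -⟩ := Sh_eq x y α hyx N hN u u' h J hu hu' hJ hnon
    refine ⟨?_, Sh_bound x y α hy hyx N hN u u' h J hu hu' hJ K hK hJK hg⟩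
    simp only [Finset.mem_filter, Finset.mem_Icc] at hh ⊢
    refine ⟨⟨hh.1, ?_⟩, hg⟩
    obtain ⟨p, hp, hpne⟩ := Finset.exists_ne_zero_of_sum_ne_zero hne2
    simp only [Finset.mem_filter] at hp
    obtain ⟨h1, h2, h3, h4, h5⟩ := WW_ne_zero hyx (tI_ne hpne)
    rw [hp.2] at h5
    have hs0 : 0 < Real.sqrt x := Real.sqrt_pos.mpr (by linarith)
    have h6 : Real.sqrt x ≤ ((u' * p.2 : ℕ):ℝ) := by
      apply (le_abs_self _).trans (abs_le_of_sq_le_sq _ (by positivity))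
      rw [Real.sq_sqrt (by linarith)]; linarith
    apply Nat.le_floor
    rw [le_div_iff₀ hs0]
    have h7 := le_trans (le_abs_self _) h5
    rw [Nat.cast_add] at h7
    have : (0:ℝ) ≤ h := by positivity
    nlinarith
  · intro h _
    have := pI_nonneg α K hK u u' h
    positivity

lemma CC_tot (x y α : ℝ) (hx : 1 ≤ x) (hy : 0 ≤ y) (hyx : y ≤ x) (N : ℕ) (hN : ∀ n : ℕ, (n:ℝ)^2 ≤ 3 * x → n ≤ N)
    (u u' J : ℕ) (hu : 1 ≤ u) (hu' : 1 ≤ u') (hJ : ∀ n : ℕ, (n:ℝ)^2 ≤ 3 * x → n < Nat.lcm u u' * J) (K : ℝ)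
    (hK : 0 ≤ K) (hJK : J ≤ Nat.gcd u u' * K) :
    ‖∑ p ∈ (Finset.Icc 1 N ×ˢ Finset.Icc 1 N), tI x y α u u' p‖ ≤
     2 * y * (Nat.gcd u u' * K) + 
     4 * y * ∑ h ∈ (Finset.Icc 1 ⌊y / Real.sqrt x⌋₊).filter (fun h => Nat.gcd u u' ∣ h), pI α K u u' h := by
  set box := Finset.Icc 1 N ×ˢ Finset.Icc 1 N with hbox
  have hsplit : ∑ p ∈ box, tI x y α u u' p = ∑ p ∈ box.filter (fun p => u * p.1 = u' * p.2 + 0), tI x y α u u' p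
     + ∑ p ∈ box.filter (fun p => u' * p.2 < u * p.1), tI x y α u u' p
     + ∑ p ∈ box.filter (fun p => u * p.1 < u' * p.2), tI x y α u u' p := by
    rw [Finset.sum_filter, Finset.sum_filter, Finset.sum_filter, ← Finset.sum_add_distrib, ← Finset.sum_add_distrib]
    apply Finset.sum_congr rfl
    intro p _
    rcases lt_trichotomy (u * p.1) (u' * p.2) with h | h | h
    · simp [h, h.ne, h.le]
    · simp [h]
    · simp [h, h.ne', h.le]
  have h0 := Sh_bound x y α hy hyx N hN u u' 0 J hu hu' hJ K hK hJK (dvd_zero _)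
  have h1 := CCp x y α hx hy hyx N hN u u' J hu hu' hJ K hK hJK
  have h2 := CCp x y α hx hy hyx N hN u' u J hu' hu (by rw [Nat.lcm_comm]; exact hJ) K hK (by rw [Nat.gcd_comm]; exact hJK)
  have h3 : ‖∑ p ∈ box.filter (fun p => u * p.1 < u' * p.2), tI x y α u u' p‖ =
      ‖∑ p ∈ box.filter (fun p => u * p.2 < u' * p.1), tI x y α u' u p‖ := by
    rw [← RCLike.norm_conj, map_sum]
    congr 1
    apply Finset.sum_nbij' (fun p => p.swap) (fun p => p.swap)
    · rintro ⟨k, k'⟩ hp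
      simp only [hbox, Finset.mem_filter, Finset.mem_product, Prod.swap_prod_mk] at hp ⊢
      tauto
    · rintro ⟨k, k'⟩ hp
      simp only [hbox, Finset.mem_filter, Finset.mem_product, Prod.swap_prod_mk] at hp ⊢
      tauto
    · intro p _; simp
    · intro p _; simp
    · intro p _; exact tI_conj _ _ _ _ _ _
  rw [Nat.gcd_comm u' u] at h2
  simp only [pI_symm α K u' u] at h2
  have h4 := FF_le hK (α * ((2 * (0 / Nat.gcd u u') * (u * u') : ℕ):ℝ))
  rw [hsplit]
  refine le_trans (norm_add₃_le) ?_
  rw [h3]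
  have h5 : 2 * y * (Nat.gcd u u' * FF K (α * ((2 * (0 / Nat.gcd u u') * (u * u') : ℕ):ℝ))) ≤ 2 * y * (Nat.gcd u u' * K) := by gcongr
  rw [← Finset.mul_sum] at h1 h2
  linarith

lemma typeI_red (x y α : ℝ) (hyx : y ≤ x) (N : ℕ) (hN : ∀ n : ℕ, (n:ℝ)^2 ≤ 3 * x → n ≤ N)
    (b : ArithmeticFunction ℂ) :
    JJ x y α N (fun n => (b * (ArithmeticFunction.zeta : ArithmeticFunction ℂ)) n) ≤
     ∑ u ∈ Finset.Icc 1 N, ∑ u' ∈ Finset.Icc 1 N, ‖b u‖ * ‖b u'‖ * 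
      ‖∑ p ∈ (Finset.Icc 1 N ×ˢ Finset.Icc 1 N), tI x y α u u' p‖ := by
  have h1 : JJ x y α N (fun n => (b * (ArithmeticFunction.zeta : ArithmeticFunction ℂ)) n) =
     ∫ t, ‖∑ i ∈ Finset.Icc 1 N ×ˢ Finset.Icc 1 N, (b i.1 * e (α * ((i.1 * i.2 : ℕ):ℝ)^2)) * (ww x y t (i.1 * i.2) : ℂ)‖^2 := by
    unfold JJ
    congr 1; funext t; congr 2
    have := conv_expand b (ArithmeticFunction.zeta : ArithmeticFunction ℂ) (fun n => e (α * (n:ℝ)^2) * (ww x y t n : ℂ)) N (by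
        intro n hn; simp [ww_zero hyx hN t n hn])
    simp only [mul_assoc] at this ⊢
    rw [this, Finset.sum_product]
    apply Finset.sum_congr rfl; intro u _
    apply Finset.sum_congr rfl; intro v hv
    simp only [Finset.mem_Icc] at hv
    have : v ≠ 0 := by omega
    simp [ArithmeticFunction.natCoe_apply, ArithmeticFunction.zeta_apply, this]
  have h2 := quad_exp (Finset.Icc 1 N ×ˢ Finset.Icc 1 N) (fun i => b i.1 * e (α * ((i.1 * i.2 : ℕ):ℝ)^2)) (fun i => i.1 * i.2) x y
  rw [← h1] at h2
  have h3 : ((JJ x y α N (fun n => (b * (ArithmeticFunction.zeta : ArithmeticFunction ℂ)) n) : ℝ) : ℂ) =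
     ∑ u ∈ Finset.Icc 1 N, ∑ u' ∈ Finset.Icc 1 N, b u * (starRingEnd ℂ) (b u') * 
      ∑ p ∈ (Finset.Icc 1 N ×ˢ Finset.Icc 1 N), tI x y α u u' p := by
    rw [h2, Finset.sum_product]
    apply Finset.sum_congr rfl; intro u _
    calc _ = ∑ k ∈ Finset.Icc 1 N, ∑ u' ∈ Finset.Icc 1 N, ∑ k' ∈ Finset.Icc 1 N, b u * (starRingEnd ℂ) (b u') * tI x y α u u' (k, k') := by
          apply Finset.sum_congr rfl; intro k _
          rw [Finset.sum_product]
          apply Finset.sum_congr rfl; intro u' _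
          apply Finset.sum_congr rfl; intro k' _
          unfold tI
          simp only
          have : e (α * (((u * k : ℕ):ℝ)^2 - ((u' * k' : ℕ):ℝ)^2)) = e (α * ((u * k : ℕ):ℝ)^2) * e (-(α * ((u' * k' : ℕ):ℝ)^2)) := by
            rw [← e_add]; congr 1; ring
          rw [this, map_mul, e_neg_conj]; ring
      _ = _ := by
          rw [Finset.sum_comm]
          apply Finset.sum_congr rfl; intro u' _
          rw [Finset.sum_product, Finset.mul_sum]
          apply Finset.sum_congr rfl; intro k _
          rw [Finset.mul_sum]
  have h6 : JJ x y α N (fun n => (b * (ArithmeticFunction.zeta : ArithmeticFunction ℂ)) n) ≤ ‖((JJ x y α N (fun n => (b * (ArithmeticFunction.zeta : ArithmeticFunction ℂ)) n) : ℝ) : ℂ)‖ := by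
    rw [Complex.norm_real]; exact le_abs_self _
  refine le_trans h6 ?_
  rw [h3]
  refine le_trans (norm_sum_le _ _) (Finset.sum_le_sum ?_)
  intro v _
  refine le_trans (norm_sum_le _ _) (Finset.sum_le_sum ?_)
  intro v' _
  rw [norm_mul, norm_mul, RCLike.norm_conj]


lemma mult_count (X g : ℕ) : (((Finset.Icc 1 X).filter (fun h => g ∣ h)).card : ℝ) * g ≤ X := by
  have : (Finset.Icc 1 X) = Finset.Ioc 0 X := rfl
  rw [this, Nat.Ioc_filter_dvd_card_eq_div]
  exact_mod_cast Nat.div_mul_le_self X g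

lemma gcd_sum (Q u : ℕ) (hu : 1 ≤ u) : ∑ u' ∈ Finset.Icc 1 Q, (Nat.gcd u u' : ℝ) ≤ Q * tau u := by
  calc ∑ u' ∈ Finset.Icc 1 Q, (Nat.gcd u u' : ℝ) ≤ ∑ u' ∈ Finset.Icc 1 Q, ∑ d ∈ u.divisors, (if d ∣ u' then (d:ℝ) else 0) := by
        apply Finset.sum_le_sum; intro u' _
        have := Finset.single_le_sum (f := fun d => (if d ∣ u' then (d:ℝ) else 0)) (s := u.divisors)
          (fun d _ => by positivity) (a := Nat.gcd u u') (by
            rw [Nat.mem_divisors]; exact ⟨Nat.gcd_dvd_left _ _, by omega⟩)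
        simpa [Nat.gcd_dvd_right] using this
    _ = ∑ d ∈ u.divisors, (((Finset.Icc 1 Q).filter (fun h => d ∣ h)).card : ℝ) * d := by
        rw [Finset.sum_comm]
        apply Finset.sum_congr rfl; intro d _
        rw [← Finset.sum_filter]; simp
    _ ≤ ∑ d ∈ u.divisors, (Q:ℝ) := Finset.sum_le_sum (fun d _ => mult_count Q d)
    _ = _ := by simp [tau, mul_comm]

def TT (X Q : ℕ) : Finset (ℕ × ℕ × ℕ) :=
  (Finset.Icc 1 X ×ˢ (Finset.Icc 1 Q ×ˢ Finset.Icc 1 Q)).filter (fun i => Nat.gcd i.2.1 i.2.2 ∣ i.1)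

lemma TT_sum (X Q : ℕ) (f : ℕ → ℕ → ℕ → ℝ) :
    ∑ i ∈ TT X Q, f i.1 i.2.1 i.2.2 = ∑ u ∈ Finset.Icc 1 Q, ∑ u' ∈ Finset.Icc 1 Q,
      ∑ h ∈ (Finset.Icc 1 X).filter (fun h => Nat.gcd u u' ∣ h), f h u u' := by
  unfold TT
  rw [Finset.sum_filter, Finset.sum_product_right, Finset.sum_product]
  apply Finset.sum_congr rfl; intro u _
  apply Finset.sum_congr rfl; intro u' _
  rw [Finset.sum_filter]

lemma TT_const (X Q : ℕ) (f : ℕ → ℕ → ℝ) (hf : ∀ u u', 0 ≤ f u u') :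
    ∑ i ∈ TT X Q, f i.2.1 i.2.2 * Nat.gcd i.2.1 i.2.2 ≤ X * ∑ u ∈ Finset.Icc 1 Q, ∑ u' ∈ Finset.Icc 1 Q, f u u' := by
  rw [TT_sum X Q (fun h u u' => f u u' * Nat.gcd u u'), Finset.mul_sum]
  apply Finset.sum_le_sum; intro u _
  rw [Finset.mul_sum]
  apply Finset.sum_le_sum; intro u' _
  simp only [Finset.sum_const, nsmul_eq_mul]
  have := mult_count X (Nat.gcd u u')
  have := hf u u'
  calc _ = f u u' * ((((Finset.Icc 1 X).filter (fun h => Nat.gcd u u' ∣ h)).card : ℝ) * Nat.gcd u u') := by ring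
    _ ≤ f u u' * X := by gcongr
    _ = _ := by ring

lemma TT_first (α K : ℝ) (hK : 0 ≤ K) (X Q E : ℕ) :
    ∑ i ∈ TT X Q, (tau i.2.1 ^ E * tau i.2.2 ^ E)^2 * pI α K i.2.1 i.2.2 i.1 ≤
     X * K * (∑ u ∈ Finset.Icc 1 Q, tau u ^ (2*E))^2 := by
  calc _ ≤ ∑ i ∈ TT X Q, ((tau i.2.1 ^ (2*E) * tau i.2.2 ^ (2*E)) * K) * Nat.gcd i.2.1 i.2.2 := by
        apply Finset.sum_le_sum; rintro ⟨h, u, u'⟩ _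
        unfold pI
        simp only
        have := FF_le hK (α * ((2 * (h / Nat.gcd u u') * (u * u') : ℕ):ℝ))
        have := tau_nonneg u
        have := tau_nonneg u'
        calc _ ≤ (tau u ^ E * tau u' ^ E)^2 * (Nat.gcd u u' * K) := by gcongr
          _ = _ := by rw [mul_pow, ← pow_mul, ← pow_mul, mul_comm E 2]; ring
    _ ≤ _ := TT_const X Q (fun u u' => (tau u ^ (2*E) * tau u' ^ (2*E)) * K) (fun u u' => by
        have := tau_nonneg u
        have := tau_nonneg u'
        positivity)
    _ = _ := by
        rw [sq, Finset.sum_mul_sum, mul_assoc]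
        congr 1
        rw [Finset.mul_sum]
        apply Finset.sum_congr rfl; intro u _
        rw [Finset.mul_sum]
        apply Finset.sum_congr rfl; intro u' _
        ring

lemma TT_second (α : ℝ) (a : ℤ) (q : ℕ) (hq : 1 ≤ q) (hco : Int.gcd a q = 1)
    (hα : |α - a / q| ≤ 1 / (q:ℝ)^2) (K : ℝ) (hK : 0 < K) (X Q : ℕ) (W Y G Qr : ℝ) (hG : 0 < G)
    (hW : 2 * X * Q^2 ≤ W) (hY : 1 ≤ Y) (hWY : W ≤ Y) (hqY : q ≤ Y) (hQ : Q ≤ Qr) (hQY : Qr ≤ Y) :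
    ∑ i ∈ TT X Q, pI α K i.2.1 i.2.2 i.1 ≤ G * (3 * (LL Y)^9 * Real.sqrt ((W * K) * ((W/q + 1) * (K + q))))
      + X * K / G * (Qr^2 * (LL Y)^2) := by
  have hQr : 0 ≤ Qr := le_trans (by positivity) hQ
  calc _ ≤ ∑ i ∈ TT X Q, (G * FF K (α * ((2 * (i.1 / Nat.gcd i.2.1 i.2.2) * (i.2.1 * i.2.2) : ℕ):ℝ)) +
        (Nat.gcd i.2.1 i.2.2 * (K / G)) * Nat.gcd i.2.1 i.2.2) := by
        apply Finset.sum_le_sum; rintro ⟨h, u, u'⟩ _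
        unfold pI
        simp only
        have h1 := FF_le hK.le (α * ((2 * (h / Nat.gcd u u') * (u * u') : ℕ):ℝ))
        have h2 := FF_nonneg hK.le (α * ((2 * (h / Nat.gcd u u') * (u * u') : ℕ):ℝ))
        rcases le_or_gt (Nat.gcd u u' : ℝ) G with h3 | h3
        · have : 0 ≤ (Nat.gcd u u' * (K / G)) * (Nat.gcd u u' : ℝ) := by positivity
          have : Nat.gcd u u' * FF K (α * ((2 * (h / Nat.gcd u u') * (u * u') : ℕ):ℝ)) ≤
             G * FF K (α * ((2 * (h / Nat.gcd u u') * (u * u') : ℕ):ℝ)) := by gcongr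
          linarith
        · have h4 : 0 ≤ G * FF K (α * ((2 * (h / Nat.gcd u u') * (u * u') : ℕ):ℝ)) := by positivity
          have h5 : Nat.gcd u u' * FF K (α * ((2 * (h / Nat.gcd u u') * (u * u') : ℕ):ℝ)) ≤ Nat.gcd u u' * K := by gcongr
          have h6 : Nat.gcd u u' * K ≤ (Nat.gcd u u' * (K / G)) * (Nat.gcd u u' : ℝ) := by
            have : K ≤ K / G * Nat.gcd u u' := by
              rw [div_mul_eq_mul_div, le_div_iff₀ hG]
              gcongr
            calc Nat.gcd u u' * K ≤ Nat.gcd u u' * (K / G * Nat.gcd u u') := by gcongr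
              _ = _ := by ring
          linarith
    _ = G * ∑ i ∈ TT X Q, FF K (α * ((2 * (i.1 / Nat.gcd i.2.1 i.2.2) * (i.2.1 * i.2.2) : ℕ):ℝ)) +
        ∑ i ∈ TT X Q, (Nat.gcd i.2.1 i.2.2 * (K / G)) * Nat.gcd i.2.1 i.2.2 := by
        rw [Finset.sum_add_distrib, Finset.mul_sum]
    _ ≤ _ := by
        apply add_le_add
        · apply mul_le_mul_of_nonneg_left _ hG.le
          refine le_trans ?_ (weighted_vino α a q hq hco hα K hK (2*X*Q^2) W Y (by push_cast; exact hW) hY hWY hqY)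
          apply multi_vino (TT X Q) (fun i => 2 * (i.1 / Nat.gcd i.2.1 i.2.2) * (i.2.1 * i.2.2))
            (fun i => i.2.1) (fun i => i.2.2) α K hK.le
          · rintro ⟨h, u, u'⟩ hi
            simp only [TT, Finset.mem_filter, Finset.mem_product, Finset.mem_Icc] at hi ⊢
            obtain ⟨⟨⟨h1, h2⟩, ⟨h3, h4⟩, h5, h6⟩, h7⟩ := hi
            have h8 : 0 < h / Nat.gcd u u' := Nat.div_pos (Nat.le_of_dvd h1 h7) (Nat.gcd_pos_of_pos_left _ h3)
            have h9 : h / Nat.gcd u u' ≤ h := Nat.div_le_self _ _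
            constructor
            · have : 0 < u * u' := Nat.mul_pos h3 h5
              have : 0 < 2 * (h / Nat.gcd u u') := by omega
              exact Nat.mul_pos this ‹0 < u * u'›
            · rw [sq]
              exact Nat.mul_le_mul (by omega) (Nat.mul_le_mul h4 h6)
          · rintro ⟨h, u, u'⟩ hi
            exact (Dvd.intro _ rfl).mul_left _
          · rintro ⟨h, u, u'⟩ hi
            exact (Dvd.intro_left _ rfl).mul_left _
          · rintro ⟨h, u, u'⟩ hi ⟨h', v, v'⟩ hj h1 h2 h3
            simp only [TT, Finset.mem_filter, Finset.mem_product, Finset.mem_Icc] at hi hj h1 h2 h3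
            subst h2; subst h3
            have h4 : 0 < u * u' := Nat.mul_pos hi.1.2.1.1 hi.1.2.2.1
            have h5 := Nat.eq_of_mul_eq_mul_right h4 h1
            have h6 : h / Nat.gcd u u' = h' / Nat.gcd u u' := by omega
            have h7 : h = h' := by
              rw [← Nat.div_mul_cancel hi.2, h6, Nat.div_mul_cancel hj.2]
            rw [h7]
        · refine le_trans (TT_const X Q (fun u u' => Nat.gcd u u' * (K / G)) (fun u u' => by positivity)) ?_
          have h1 : ∑ u ∈ Finset.Icc 1 Q, ∑ u' ∈ Finset.Icc 1 Q, (Nat.gcd u u' : ℝ) * (K/G) ≤ (Qr^2 * (LL Y)^2) * (K/G) := by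
            simp only [← Finset.sum_mul]
            apply mul_le_mul_of_nonneg_right _ (by positivity)
            calc _ ≤ ∑ u ∈ Finset.Icc 1 Q, Qr * tau u ^ 1 := by
                  apply Finset.sum_le_sum; intro u hu
                  refine le_trans (gcd_sum Q u (Finset.mem_Icc.mp hu).1) ?_
                  have := tau_nonneg u
                  rw [pow_one]; gcongr
              _ = Qr * ∑ u ∈ Finset.Icc 1 Q, tau u ^ 1 := by rw [Finset.mul_sum]
              _ ≤ Qr * (Qr * (LL Y)^(2^1)) := by
                  gcongr
                  exact tau_moment' 1 Q Qr Y hQ hQr hY hQY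
              _ = _ := by ring
          calc _ ≤ X * ((Qr^2 * (LL Y)^2) * (K/G)) := by gcongr
            _ = _ := by ring

lemma diag_sum (Q E : ℕ) (Qr Y : ℝ) (hY : 1 ≤ Y) (hQ : Q ≤ Qr) (hQY : Qr ≤ Y) :
    ∑ u ∈ Finset.Icc 1 Q, ∑ u' ∈ Finset.Icc 1 Q, tau u ^ E * tau u' ^ E * (Nat.gcd u u' : ℝ) ≤ Qr^2 * (LL Y)^(2^(2*E+1)) := by
  have hQr : 0 ≤ Qr := le_trans (by positivity) hQ
  have h1 : ∑ u ∈ Finset.Icc 1 Q, ∑ u' ∈ Finset.Icc 1 Q, tau u ^ (2*E) * (Nat.gcd u u' : ℝ) ≤ Qr^2 * (LL Y)^(2^(2*E+1)) := by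
    calc _ ≤ ∑ u ∈ Finset.Icc 1 Q, Qr * tau u ^ (2*E+1) := by
          apply Finset.sum_le_sum; intro u hu
          rw [← Finset.mul_sum]
          have := gcd_sum Q u (Finset.mem_Icc.mp hu).1
          have h0 := tau_nonneg u
          calc _ ≤ tau u ^ (2*E) * (Qr * tau u) := by
                gcongr
                exact this.trans (by gcongr)
            _ = _ := by ring
      _ = Qr * ∑ u ∈ Finset.Icc 1 Q, tau u ^ (2*E+1) := by rw [Finset.mul_sum]
      _ ≤ Qr * (Qr * (LL Y)^(2^(2*E+1))) := by
          gcongr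
          exact tau_moment' (2*E+1) Q Qr Y hQ hQr hY hQY
      _ = _ := by ring
  have h2 : ∑ u ∈ Finset.Icc 1 Q, ∑ u' ∈ Finset.Icc 1 Q, tau u' ^ (2*E) * (Nat.gcd u u' : ℝ) ≤ Qr^2 * (LL Y)^(2^(2*E+1)) := by
    rw [Finset.sum_comm]
    refine le_trans (le_of_eq ?_) h1
    apply Finset.sum_congr rfl; intro u _
    apply Finset.sum_congr rfl; intro u' _
    rw [Nat.gcd_comm]
  have h3 : ∑ u ∈ Finset.Icc 1 Q, ∑ u' ∈ Finset.Icc 1 Q, tau u ^ E * tau u' ^ E * (Nat.gcd u u' : ℝ) ≤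
    ∑ u ∈ Finset.Icc 1 Q, ∑ u' ∈ Finset.Icc 1 Q, (tau u ^ (2*E) * (Nat.gcd u u' : ℝ) / 2 + tau u' ^ (2*E) * (Nat.gcd u u' : ℝ) / 2) := by
    apply Finset.sum_le_sum; intro u _
    apply Finset.sum_le_sum; intro u' _
    have e1 : tau u ^ (2*E) = (tau u ^ E)^2 := by rw [← pow_mul]; congr 1; ring
    have e2 : tau u' ^ (2*E) = (tau u' ^ E)^2 := by rw [← pow_mul]; congr 1; ring
    rw [e1, e2]
    have : (0:ℝ) ≤ Nat.gcd u u' := by positivity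
    nlinarith [mul_nonneg this (sq_nonneg ((tau u ^ E) - (tau u' ^ E)))]
  simp only [Finset.sum_add_distrib, ← Finset.sum_div] at h3
  linarith


lemma typeI_J (x M : ℝ) (hx : 1 ≤ x) (hM : 1 ≤ M) (hMs : M^2 ≤ Real.sqrt x) (u u' : ℕ) (hu : M ≤ u) (hu' : M ≤ u') :
    ∃ J : ℕ, (∀ n : ℕ, (n:ℝ)^2 ≤ 3 * x → n < Nat.lcm u u' * J) ∧ (J:ℝ) ≤ Nat.gcd u u' * (3 * Real.sqrt x / M^2) := by
  set s := Real.sqrt x with hs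
  have hs1 : 1 ≤ s := by rw [hs]; exact Real.one_le_sqrt.mpr hx
  have hss : s^2 = x := Real.sq_sqrt (by linarith)
  have hu0 : (0:ℝ) < u := by linarith
  have hu0' : (0:ℝ) < u' := by linarith
  have hun : 0 < u := by exact_mod_cast hu0
  have hun' : 0 < u' := by exact_mod_cast hu0'
  have hg : (1:ℝ) ≤ Nat.gcd u u' := by exact_mod_cast Nat.gcd_pos_of_pos_left u' hun
  have hl : (0:ℝ) < Nat.lcm u u' := by exact_mod_cast Nat.lcm_pos hun hun'
  have hgl : (Nat.gcd u u' : ℝ) * Nat.lcm u u' = u * u' := by exact_mod_cast Nat.gcd_mul_lcm u u'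
  have hM0 : 0 < M := by linarith
  refine ⟨⌊2 * s / Nat.lcm u u'⌋₊ + 1, ?_, ?_⟩
  · intro n hn
    have h1 : (n:ℝ) ≤ 2 * s := by
      apply (le_abs_self _).trans (abs_le_of_sq_le_sq _ (by positivity))
      nlinarith
    have h2 := Nat.lt_floor_add_one (2 * s / Nat.lcm u u')
    rw [div_lt_iff₀ hl] at h2
    have : (n:ℝ) < ((Nat.lcm u u' * (⌊2 * s / Nat.lcm u u'⌋₊ + 1) : ℕ):ℝ) := by
      push_cast; linarith
    exact_mod_cast this
  · push_cast
    have h1 : (⌊2 * s / Nat.lcm u u'⌋₊ : ℝ) ≤ 2 * s / Nat.lcm u u' := Nat.floor_le (by positivity)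
    have h2 : 2 * s / Nat.lcm u u' ≤ Nat.gcd u u' * (2 * s / M^2) := by
      rw [div_le_iff₀ hl]
      calc 2 * s = M^2 * (2 * s / M^2) := by field_simp
        _ ≤ (u * u') * (2 * s / M^2) := by
            gcongr; nlinarith
        _ = _ := by rw [← hgl]; ring
    have h3 : 1 ≤ Nat.gcd u u' * (s / M^2) := by
      have : 1 ≤ s / M^2 := by rw [le_div_iff₀ (by positivity)]; linarith
      nlinarith
    calc _ ≤ Nat.gcd u u' * (2 * s / M^2) + Nat.gcd u u' * (s / M^2) := by linarith
      _ = _ := by ring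

lemma typeI_pre (x y α : ℝ) (hx : 1 ≤ x) (hy : 0 ≤ y) (hyx : y ≤ x) (N : ℕ) (hN : ∀ n : ℕ, (n:ℝ)^2 ≤ 3 * x → n ≤ N)
    (M : ℝ) (hM : 1 ≤ M) (hMs : M^2 ≤ Real.sqrt x) (Q E : ℕ) (K : ℝ) (hK : K = 3 * Real.sqrt x / M^2)
    (b : ArithmeticFunction ℂ) (hb : ∀ v, ‖b v‖ ≤ tau v ^ E) (hb2 : ∀ v, b v ≠ 0 → M ≤ v ∧ v ≤ Q) :
    JJ x y α N (fun n => (b * (ArithmeticFunction.zeta : ArithmeticFunction ℂ)) n) ≤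
    2 * y * K * (∑ u ∈ Finset.Icc 1 Q, ∑ u' ∈ Finset.Icc 1 Q, tau u ^ E * tau u' ^ E * (Nat.gcd u u' : ℝ)) +
    4 * y * ∑ i ∈ TT ⌊y / Real.sqrt x⌋₊ Q, (tau i.2.1 ^ E * tau i.2.2 ^ E) * pI α K i.2.1 i.2.2 i.1 := by
  have hK0 : 0 ≤ K := by rw [hK]; positivity
  refine le_trans (typeI_red x y α hyx N hN b) ?_
  rw [TT_sum ⌊y / Real.sqrt x⌋₊ Q (fun h u u' => (tau u ^ E * tau u' ^ E) * pI α K u u' h)]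
  have e1 : ∀ f : ℕ → ℕ → ℝ, ∀ R : ℕ, ∑ u ∈ Finset.Icc 1 R, ∑ u' ∈ Finset.Icc 1 R, f u u' = ∑ p ∈ Finset.Icc 1 R ×ˢ Finset.Icc 1 R, f p.1 p.2 := by
    intro f R; rw [Finset.sum_product]
  simp only [e1]
  rw [Finset.mul_sum, Finset.mul_sum, ← Finset.sum_add_distrib]
  apply sum_le_sum_supp
  · rintro ⟨u, u'⟩ hp hne
    simp only at hne ⊢
    have hne1 := hb2 u (by intro h0; apply hne; simp [h0])
    have hne2 := hb2 u' (by intro h0; apply hne; simp [h0])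
    simp only [Finset.mem_product, Finset.mem_Icc] at hp ⊢
    refine ⟨⟨⟨hp.1.1, hne1.2⟩, hp.2.1, hne2.2⟩, ?_⟩
    obtain ⟨J, hJ1, hJ2⟩ := typeI_J x M hx hM hMs u u' hne1.1 hne2.1
    rw [← hK] at hJ2
    have := CC_tot x y α hx hy hyx N hN u u' J hp.1.1 hp.2.1 hJ1 K hK0 hJ2
    have h1 := hb u
    have h2 := hb u'
    have := tau_nonneg u
    have := tau_nonneg u'
    rw [← Finset.mul_sum]
    calc _ ≤ (tau u ^ E * tau u' ^ E) * (2 * y * (Nat.gcd u u' * K) + 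
         4 * y * ∑ h ∈ (Finset.Icc 1 ⌊y / Real.sqrt x⌋₊).filter (fun h => Nat.gcd u u' ∣ h), pI α K u u' h) := by gcongr
      _ = _ := by ring
  · rintro ⟨u, u'⟩ _
    have := tau_nonneg u
    have := tau_nonneg u'
    have : 0 ≤ ∑ h ∈ (Finset.Icc 1 ⌊y / Real.sqrt x⌋₊).filter (fun h => Nat.gcd u u' ∣ h), tau u ^ E * tau u' ^ E * pI α K u u' h :=
      Finset.sum_nonneg (fun h _ => by have := pI_nonneg α K hK0 u u' h; positivity)
    simp only
    positivity

lemma aux_Q (Qr s x : ℝ) (h : Qr^2 ≤ 4 * s) (hs : 1 ≤ s) (hx : s^2 = x) : Qr ≤ 8 * x := by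
  nlinarith [sq_nonneg (Qr - 1), mul_self_nonneg (s - 1)]

set_option maxHeartbeats 1600000 in
theorem typeI (x y α : ℝ) (hx : 1 ≤ x) (hyx : y ≤ x) (N : ℕ)
    (hN : ∀ n : ℕ, (n:ℝ)^2 ≤ 3 * x → n ≤ N)
    (a : ℤ) (q : ℕ) (hq : 1 ≤ q) (hco : Int.gcd a q = 1) (hα : |α - a / q| ≤ 1 / (q:ℝ)^2)
    (δ : ℝ) (hδ0 : 0 < δ) (hδ1 : δ ≤ 1) (hq1 : 1 / q ≤ δ) (hq2 : q ≤ δ * y)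
    (M D : ℝ) (hM : 1 ≤ M) (hMs : M^2 ≤ δ * Real.sqrt x) (hD : 1 ≤ D) (hDδ : δ * D^2 ≤ 1) (hsy : Real.sqrt x ≤ δ * y)
    (Q E : ℕ) (hQ : Q ≤ 2 * M * D)
    (b : ArithmeticFunction ℂ) (hb : ∀ v, ‖b v‖ ≤ tau v ^ E) (hb2 : ∀ v, b v ≠ 0 → M ≤ v ∧ v ≤ Q) :
    JJ x y α N (fun n => (b * (ArithmeticFunction.zeta : ArithmeticFunction ℂ)) n) ≤
      164 * y^2 * D^2 * LL (8*x) ^ (2^(2*E+1)+9) * Real.sqrt (Real.sqrt (Real.sqrt δ)) := by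
  set s := Real.sqrt x with hs
  have hs1 : 1 ≤ s := by rw [hs]; exact Real.one_le_sqrt.mpr hx
  have hs0 : 0 < s := by linarith
  have hss : s^2 = x := Real.sq_sqrt (by linarith)
  have hqp : (0:ℝ) < q := by exact_mod_cast hq
  have hy0 : 0 < y := (mul_pos_iff_of_pos_left hδ0).mp (by linarith)
  have hM0 : 0 < M := by linarith
  have hsy1 : s ≤ y := hsy.trans (mul_le_of_le_one_left hy0.le hδ1)
  have hMs1 : M^2 ≤ s := hMs.trans (mul_le_of_le_one_left hs0.le hδ1)
  set ℓ := LL (8*x) with hℓ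
  have hℓ1 : 1 ≤ ℓ := by
    rw [hℓ]; unfold LL; linarith [Real.log_nonneg (show 1 ≤ 8*x by linarith)]
  set K := 3 * s / M^2 with hK
  have hK0 : 0 < K := by positivity
  set X := ⌊y / s⌋₊ with hX
  have hXr : (X:ℝ) ≤ y / s := Nat.floor_le (by positivity)
  set Qr := 2 * M * D with hQr
  have hQr0 : 0 < Qr := by positivity
  have hKQ : K * Qr^2 = 12 * s * D^2 := by rw [hK, hQr]; field_simp; norm_num
  have hHKQ : y / s * K * Qr^2 = 12 * y * D^2 := by rw [mul_assoc, hKQ]; field_simp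
  set W := 2 * (y / s) * Qr^2 with hW
  have hWK : W * K = 24 * y * D^2 := by
    calc W * K = 2 * (y / s * K * Qr^2) := by rw [hW]; ring
      _ = _ := by rw [hHKQ]; ring
  have hWe : W ≤ 8 * δ * y * D^2 := by
    calc W = 8 * (y / s) * M^2 * D^2 := by rw [hW, hQr]; ring
      _ ≤ 8 * (y / s) * (δ * s) * D^2 := by gcongr
      _ = _ := by field_simp
  have hWx : W ≤ 8 * x := by
    calc W ≤ _ := hWe
      _ = 8 * y * (δ * D^2) := by ring
      _ ≤ 8 * y * 1 := by gcongr
      _ ≤ _ := by linarith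
  have hQx : Qr ≤ 8 * x := by
    have h1 : Qr^2 ≤ 4 * s := by
      calc Qr^2 = 4 * M^2 * D^2 := by rw [hQr]; ring
        _ ≤ 4 * (δ * s) * D^2 := by gcongr
        _ = 4 * s * (δ * D^2) := by ring
        _ ≤ 4 * s * 1 := by gcongr
        _ = _ := by ring
    exact aux_Q _ _ _ h1 hs1 hss
  have hqx : (q:ℝ) ≤ 8 * x := by linarith [mul_le_of_le_one_left hy0.le hδ1]
  set θ := Real.sqrt (Real.sqrt δ) with hθ
  have hsδ : 0 < Real.sqrt δ := Real.sqrt_pos.mpr hδ0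
  have hθ4 : θ^2 = Real.sqrt δ := Real.sq_sqrt (Real.sqrt_nonneg _)
  have hθ0 : 0 < θ := Real.sqrt_pos.mpr hsδ
  have hδs : Real.sqrt δ ^ 2 = δ := Real.sq_sqrt hδ0.le
  have hδ2 : δ ≤ Real.sqrt δ := le_sqrt_self hδ0.le hδ1
  have hθ1 : θ ≤ 1 := Real.sqrt_le_one.mpr (Real.sqrt_le_one.mpr hδ1)
  have hδ3 : δ ≤ θ := hδ2.trans (le_sqrt_self hsδ.le (Real.sqrt_le_one.mpr hδ1))
  set φ := Real.sqrt θ with hφ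
  have hφ2 : φ^2 = θ := Real.sq_sqrt hθ0.le
  have hφ0 : 0 ≤ φ := Real.sqrt_nonneg _
  have hφ1 : φ ≤ 1 := Real.sqrt_le_one.mpr hθ1
  have hδ4 : δ ≤ φ := hδ3.trans (le_sqrt_self hθ0.le hθ1)
  set n := 2^(2*E+1) with hn
  refine le_trans (typeI_pre x y α hx hy0.le hyx N hN M hM hMs1 Q E K hK b hb hb2) ?_
  have hd := diag_sum Q E Qr (8*x) (by linarith) hQ hQx
  have h1 : ∑ i ∈ TT X Q, (tau i.2.1 ^ E * tau i.2.2 ^ E)^2 * pI α K i.2.1 i.2.2 i.1 ≤ 12 * y * D^2 * ℓ^n := by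
    refine le_trans (TT_first α K hK0.le X Q E) ?_
    have := tau_moment' (2*E) Q Qr (8*x) hQ hQr0.le (by linarith) hQx
    have h0 : 0 ≤ ∑ u ∈ Finset.Icc 1 Q, tau u ^ (2*E) := Finset.sum_nonneg (fun u _ => by have := tau_nonneg u; positivity)
    calc _ ≤ y / s * K * (Qr * ℓ^(2^(2*E)))^2 := by gcongr
      _ = (y / s * K * Qr^2) * ℓ^n := by
          rw [mul_pow, ← pow_mul, hn, pow_succ]; ring
      _ = _ := by rw [hHKQ]
  have h2 : ∑ i ∈ TT X Q, pI α K i.2.1 i.2.2 i.1 ≤ 102 * y * D^2 * ℓ^9 * θ := by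
    refine le_trans (TT_second α a q hq hco hα K hK0 X Q W (8*x) (1/θ) Qr (by positivity) ?_ (by linarith) hWx hqx hQ hQx) ?_
    · rw [hW]; gcongr
    · have e1 : (W * K) * ((W/q+1)*(K+q)) = (W*K) * ((W * K) * (1/q) + W + K + q) := by field_simp; ring
      have hKd : K ≤ 3 * δ * y := by
        have h5 : K ≤ 3 * s := div_le_self (by positivity) (one_le_pow₀ hM)
        linarith
      have hD2 : 1 ≤ D^2 := one_le_pow₀ hD
      have e2 : (W*K) * ((W * K) * (1/q) + W + K + q) ≤ (30 * y * D^2 * Real.sqrt δ)^2 := by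
        rw [hWK]
        have f1 : 24 * y * D^2 * (1/q) + W + K + q ≤ 24 * y * D^2 * δ + 8 * δ * y * D^2 + 3 * δ * y * D^2 + δ * y * D^2 := by
          have g1 : 3 * δ * y * 1 ≤ 3 * δ * y * D^2 := by gcongr
          have g2 : δ * y * 1 ≤ δ * y * D^2 := by gcongr
          have g3 : 24 * y * D^2 * (1/q) ≤ 24 * y * D^2 * δ := by gcongr
          linarith
        calc _ ≤ 24 * y * D^2 * (24 * y * D^2 * δ + 8 * δ * y * D^2 + 3 * δ * y * D^2 + δ * y * D^2) := by gcongr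
          _ = 864 * (y * D^2)^2 * δ := by ring
          _ ≤ 900 * (y * D^2)^2 * δ := by gcongr; norm_num
          _ = 900 * (y * D^2)^2 * (Real.sqrt δ)^2 := by rw [hδs]
          _ = _ := by ring
      have e3 : Real.sqrt ((W * K) * ((W/q+1)*(K+q))) ≤ 30 * y * D^2 * Real.sqrt δ := by
        rw [e1]; exact Real.sqrt_le_iff.mpr ⟨by positivity, e2⟩
      have e4 : X * K / (1/θ) * (Qr^2 * ℓ^2) ≤ 12 * y * D^2 * ℓ^9 * θ := by
        calc _ = (X * K * Qr^2) * ℓ^2 * θ := by field_simp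
          _ ≤ (y / s * K * Qr^2) * ℓ^9 * θ := by
              gcongr
              · norm_num
          _ = _ := by rw [hHKQ]
      calc _ ≤ 1/θ * (3 * ℓ^9 * (30 * y * D^2 * Real.sqrt δ)) + 12 * y * D^2 * ℓ^9 * θ := by gcongr
        _ = _ := by rw [← hθ4]; field_simp; ring
  have h3 : ∑ i ∈ TT X Q, (tau i.2.1 ^ E * tau i.2.2 ^ E) * pI α K i.2.1 i.2.2 i.1 ≤ 35 * y * D^2 * ℓ^(n+9) * φ := by
    have hp : ∀ i : ℕ × ℕ × ℕ, Real.sqrt (pI α K i.2.1 i.2.2 i.1) ^ 2 = pI α K i.2.1 i.2.2 i.1 := fun i => Real.sq_sqrt (pI_nonneg α K hK0.le _ _ _)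
    calc _ = ∑ i ∈ TT X Q, ((tau i.2.1 ^ E * tau i.2.2 ^ E) * Real.sqrt (pI α K i.2.1 i.2.2 i.1)) * Real.sqrt (pI α K i.2.1 i.2.2 i.1) := by
          apply Finset.sum_congr rfl; intro i _
          rw [mul_assoc (tau i.2.1 ^ E * tau i.2.2 ^ E), ← sq, hp]
      _ ≤ _ := Real.sum_mul_le_sqrt_mul_sqrt _ _ _
      _ ≤ _ := by
          rw [← Real.sqrt_mul (Finset.sum_nonneg (fun _ _ => sq_nonneg _))]
          apply Real.sqrt_le_iff.mpr ⟨by positivity, ?_⟩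
          simp only [mul_pow _ (Real.sqrt _), hp]
          calc _ ≤ (12 * y * D^2 * ℓ^n) * (102 * y * D^2 * ℓ^9 * θ) := by
                apply mul_le_mul h1 h2 (Finset.sum_nonneg (fun _ _ => pI_nonneg α K hK0.le _ _ _)) (by positivity)
            _ = 1224 * (y * D^2)^2 * (ℓ^(n+9) * 1) * φ^2 := by rw [hφ2, pow_add]; ring
            _ ≤ 1225 * (y * D^2)^2 * (ℓ^(n+9) * ℓ^(n+9)) * φ^2 := by
                gcongr
                · norm_num
                · exact one_le_pow₀ hℓ1
            _ = _ := by ring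
  calc _ ≤ 2 * y * K * (Qr^2 * ℓ^n) + 4 * y * (35 * y * D^2 * ℓ^(n+9) * φ) := by gcongr
    _ = 24 * y * D^2 * ℓ^n * s + 140 * y^2 * D^2 * ℓ^(n+9) * φ := by
        have : 2 * y * K * (Qr^2 * ℓ^n) = 2 * y * (K * Qr^2) * ℓ^n := by ring
        rw [this, hKQ]; ring
    _ ≤ 24 * y * D^2 * ℓ^(n+9) * (φ * y) + 140 * y^2 * D^2 * ℓ^(n+9) * φ := by
        have : s ≤ φ * y := hsy.trans (by gcongr)
        gcongr
        omega
    _ = _ := by ring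


def sm (w d : ℕ) : Prop := ∀ p : ℕ, p.Prime → p ∣ d → p < w
def ro (w d : ℕ) : Prop := ∀ p : ℕ, p.Prime → p ∣ d → w ≤ p
def piP (w l : ℕ) : ℕ := if l = 1 then w else min (Nat.minFac l) w
def FFs (D w f : ℕ) : Prop := sm w f ∧ D < f ∧ f / Nat.minFac f ≤ D

def cS (D w k d : ℕ) : ℤ := (if d ≤ D then 1 else 0) + 
  (if D < d ∧ d / Nat.minFac d ≤ D ∧ Nat.minFac d ≤ piP w (k / d) then 1 else 0)

lemma cS_pair (D w k d p : ℕ) (hk : 1 ≤ k) (hD : 1 ≤ D) (hp : p = Nat.minFac k) (hk1 : k ≠ 1) (hpw : p < w)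
    (hpd : ¬ p ∣ d) (hd : p * d ∣ k) : cS D w k d = cS D w k (p * d) := by
  have hpp : p.Prime := by rw [hp]; exact Nat.minFac_prime hk1
  have hd1 : 1 ≤ d := by
    rcases Nat.eq_zero_or_pos d with h | h
    · subst h; simp at hpd
    · exact h
  obtain ⟨m, hm⟩ := hd
  have hm1 : 1 ≤ m := by
    rcases Nat.eq_zero_or_pos m with h | h
    · subst h; omega
    · exact h
  have hmf : Nat.minFac (p * d) = p := by
    apply le_antisymm
    · exact Nat.minFac_le_of_dvd hpp.two_le (Dvd.intro _ rfl)
    · rw [hp]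
      apply Nat.minFac_le_of_dvd
      · exact (Nat.minFac_prime (by
          intro h; have := Nat.eq_one_of_mul_eq_one_right h; exact hpp.one_lt.ne' (hp.trans this))).two_le
      · have : p * d ∣ k := ⟨m, hm⟩
        rw [hp] at this
        exact (Nat.minFac_dvd _).trans this
  have hkd : k / (p * d) = m := by
    rw [hm]; exact Nat.mul_div_cancel_left _ (Nat.mul_pos hpp.pos hd1)
  have hkd2 : k / d = p * m := by
    rw [hm, show p * d * m = d * (p * m) by ring]; exact Nat.mul_div_cancel_left _ hd1
  have c1 : p ≤ piP w m := by
    unfold piP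
    split_ifs with h
    · omega
    · apply le_min _ hpw.le
      rw [hp]
      exact Nat.minFac_le_of_dvd (Nat.minFac_prime h).two_le ((Nat.minFac_dvd m).trans ⟨p * d, by rw [hm]; ring⟩)
  have c2 : D < d → ¬ (Nat.minFac d ≤ piP w (k / d)) := by
    intro hDd hle
    rw [hkd2] at hle
    have h1 : p * m ≠ 1 := by
      intro h; have := Nat.eq_one_of_mul_eq_one_right h; exact hpp.one_lt.ne' this
    unfold piP at hle
    rw [if_neg h1] at hle
    have h2 := le_trans hle (min_le_left _ _)
    have h3 : Nat.minFac (p * m) ≤ p := Nat.minFac_le_of_dvd hpp.two_le (Dvd.intro _ rfl)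
    have h4 : p ≤ Nat.minFac d := by
      rw [hp]
      exact Nat.minFac_le_of_dvd (Nat.minFac_prime (by omega)).two_le ((Nat.minFac_dvd d).trans ⟨p * m, by rw [hm]; ring⟩)
    have h5 : Nat.minFac d = p := by omega
    exact hpd (h5 ▸ Nat.minFac_dvd d)
  unfold cS
  rw [hmf, hkd, Nat.mul_div_cancel_left _ hpp.pos]
  have hdp : d ≤ p * d := Nat.le_mul_of_pos_left _ hpp.pos
  by_cases h1 : d ≤ D
  · by_cases h2 : p * d ≤ D
    · have : ¬ D < d := by omega
      have : ¬ D < p * d := by omega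
      clear hm hkd hkd2 hp hmf; split_ifs <;> first | rfl | (exfalso; tauto)
    · have : ¬ D < d := by omega
      have : D < p * d := by omega
      clear hm hkd hkd2 hp hmf; split_ifs <;> first | rfl | (exfalso; tauto)
  · have h3 : D < d := by omega
    have h4 : ¬ p * d ≤ D := by omega
    have h5 := c2 h3
    clear hm hkd hkd2 hp hmf; split_ifs <;> first | rfl | (exfalso; tauto)

lemma sieve_id (D w k : ℕ) (hk : 1 ≤ k) (hD : 1 ≤ D) :
    (if ro w k then 1 else 0 : ℤ) = ∑ d ∈ k.divisors.filter (fun d => sm w d), ArithmeticFunction.moebius d * cS D w k d := by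
  have hsq : ∑ d ∈ k.divisors.filter (fun d => sm w d), ArithmeticFunction.moebius d * cS D w k d =
    ∑ d ∈ k.divisors.filter (fun d => sm w d ∧ Squarefree d), ArithmeticFunction.moebius d * cS D w k d := by
    rw [← Finset.filter_filter]
    symm
    apply Finset.sum_filter_of_ne
    intro d _ hne
    exact ArithmeticFunction.moebius_ne_zero_iff_squarefree.mp (left_ne_zero_of_mul hne)
  rw [hsq]
  by_cases hr : ro w k
  · rw [if_pos hr]
    have : k.divisors.filter (fun d => sm w d ∧ Squarefree d) = {1} := by
      ext d
      simp only [Finset.mem_filter, Nat.mem_divisors, Finset.mem_singleton]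
      constructor
      · rintro ⟨⟨h1, h2⟩, h3, h4⟩
        by_contra hd
        have hp := Nat.minFac_prime hd
        have := h3 _ hp (Nat.minFac_dvd d)
        have := hr _ hp ((Nat.minFac_dvd d).trans h1)
        omega
      · rintro rfl
        refine ⟨⟨one_dvd _, by omega⟩, ?_, squarefree_one⟩
        intro p hp h1
        exact absurd (Nat.dvd_one.mp h1) hp.one_lt.ne'
    rw [this]
    have : ¬ D < 1 := by omega
    simp [cS, hD, this]
  · rw [if_neg hr]
    symm
    have hr2 : ∃ p : ℕ, p.Prime ∧ p ∣ k ∧ p < w := by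
      unfold ro at hr; push Not at hr; exact hr
    obtain ⟨p', hp', hpk', hpw'⟩ := hr2
    have hk1 : k ≠ 1 := by
      rintro rfl; exact hp'.one_lt.ne' (Nat.dvd_one.mp hpk')
    obtain ⟨p, hp⟩ : ∃ p, p = Nat.minFac k := ⟨_, rfl⟩
    have hpp : p.Prime := by rw [hp]; exact Nat.minFac_prime hk1
    have hpk : p ∣ k := by rw [hp]; exact Nat.minFac_dvd k
    have hpw : p < w := lt_of_le_of_lt (by rw [hp]; exact Nat.minFac_le_of_dvd hp'.two_le hpk') hpw'
    have hmem : ∀ d, d ∈ k.divisors.filter (fun d => sm w d ∧ Squarefree d) → ¬ p ∣ d → 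
        p * d ∈ k.divisors.filter (fun d => sm w d ∧ Squarefree d) := by
      intro d hd hpd
      simp only [Finset.mem_filter, Nat.mem_divisors] at hd ⊢
      have hcop : Nat.Coprime p d := (Nat.Prime.coprime_iff_not_dvd hpp).mpr hpd
      refine ⟨⟨hcop.mul_dvd_of_dvd_of_dvd hpk hd.1.1, hd.1.2⟩, ?_, ?_⟩
      · intro r hr hrd
        rcases (Nat.Prime.dvd_mul hr).mp hrd with h | h
        · rw [(Nat.prime_dvd_prime_iff_eq hr hpp).mp h]; exact hpw
        · exact hd.2.1 r hr h
      · rw [Nat.squarefree_mul hcop]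
        exact ⟨hpp.prime.squarefree, hd.2.2⟩
    have hmem2 : ∀ d, p * d ∈ k.divisors.filter (fun d => sm w d ∧ Squarefree d) → 
        d ∈ k.divisors.filter (fun d => sm w d ∧ Squarefree d) ∧ ¬ p ∣ d := by
      intro d hd
      simp only [Finset.mem_filter, Nat.mem_divisors] at hd ⊢
      refine ⟨⟨⟨(Dvd.intro_left _ rfl).trans hd.1.1, hd.1.2⟩, ?_, hd.2.2.squarefree_of_dvd (Dvd.intro_left _ rfl)⟩, ?_⟩
      · intro r hr hrd
        exact hd.2.1 r hr (hrd.mul_left _)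
      · rintro ⟨m, rfl⟩
        have := hd.2.2 p ⟨m, by ring⟩
        exact hpp.one_lt.ne' (Nat.isUnit_iff.mp this)
    have hmu : ∀ d, ¬ p ∣ d → ArithmeticFunction.moebius (p * d) = - ArithmeticFunction.moebius d := by
      intro d hpd
      have hcop : Nat.Coprime p d := (Nat.Prime.coprime_iff_not_dvd hpp).mpr hpd
      rw [ArithmeticFunction.isMultiplicative_moebius.map_mul_of_coprime hcop, ArithmeticFunction.moebius_apply_prime hpp]
      ring
    apply Finset.sum_involution (fun d _ => if p ∣ d then d / p else p * d)
    · intro d hd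
      split_ifs with h
      · obtain ⟨m, rfl⟩ := h
        rw [Nat.mul_div_cancel_left _ hpp.pos]
        obtain ⟨h1, h2⟩ := hmem2 m hd
        have h3 : p * m ∣ k := (Nat.mem_divisors.mp (Finset.mem_filter.mp hd).1).1
        rw [hmu m h2, cS_pair D w k m p hk hD hp hk1 hpw h2 h3]; ring
      · have h3 : p * d ∣ k := (Nat.mem_divisors.mp (Finset.mem_filter.mp (hmem d hd h)).1).1
        rw [hmu d h, cS_pair D w k d p hk hD hp hk1 hpw h h3]; ring
    · intro d hd _
      split_ifs with h
      · obtain ⟨m, rfl⟩ := h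
        rw [Nat.mul_div_cancel_left _ hpp.pos]
        obtain ⟨h1, h2⟩ := hmem2 m hd
        intro h3; apply h2; rw [h3]; exact Dvd.intro _ rfl
      · intro h3; apply h; rw [← h3]; exact Dvd.intro _ rfl
    · intro d hd
      split_ifs with h
      · obtain ⟨m, rfl⟩ := h
        rw [Nat.mul_div_cancel_left _ hpp.pos]
        exact (hmem2 m hd).1
      · exact hmem d hd h
    · intro d hd
      by_cases h : p ∣ d
      · obtain ⟨m, rfl⟩ := h
        have hpm : p ∣ p * m := Dvd.intro _ rfl
        simp only [hpm, if_true, Nat.mul_div_cancel_left _ hpp.pos]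
        rw [if_neg (hmem2 m hd).2]
      · rw [if_neg h, if_pos (Dvd.intro _ rfl), Nat.mul_div_cancel_left _ hpp.pos]


lemma orth (Q : ℕ) (hQ : 1 ≤ Q) (m : ℤ) (hm : |m| < Q) :
    ∑ j ∈ Finset.Icc 1 Q, e ((j:ℝ) * (m / Q)) = if m = 0 then (Q:ℂ) else 0 := by
  have hQ0 : (Q:ℝ) ≠ 0 := by positivity
  split_ifs with h
  · subst h; simp [e_zero]
  · have h1 : ∀ j : ℕ, e ((j:ℝ) * (m / Q)) = e ((m:ℝ)/Q) ^ j := by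
      intro j; rw [mul_comm, e_nat_mul]
    simp only [h1]
    have hne : e ((m:ℝ)/Q) ≠ 1 := by
      intro he
      unfold e at he
      rw [Complex.exp_eq_one_iff] at he
      obtain ⟨n, hn⟩ := he
      have hpi : (2 * Real.pi * Complex.I : ℂ) ≠ 0 := Complex.two_pi_I_ne_zero
      have h2 : (((m:ℝ)/Q : ℝ) : ℂ) = (n:ℂ) := by
        apply mul_right_cancel₀ hpi
        rw [← hn]; push_cast; ring
      have h3 : (m:ℝ)/Q = n := by exact_mod_cast h2
      rw [div_eq_iff hQ0] at h3
      have h4 : m = n * Q := by exact_mod_cast h3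
      have : (Q:ℤ) ∣ m := ⟨n, by rw [h4]; ring⟩
      exact h (Int.eq_zero_of_abs_lt_dvd this hm)
    have hQp : e ((m:ℝ)/Q) ^ Q = 1 := by
      rw [← e_nat_mul, div_mul_cancel₀ _ hQ0, e_int]
    have : ∑ j ∈ Finset.Icc 1 Q, e ((m:ℝ)/Q) ^ j = e ((m:ℝ)/Q) * ∑ j ∈ Finset.range Q, e ((m:ℝ)/Q) ^ j := by
      rw [Finset.mul_sum, Finset.range_eq_Ico, Finset.sum_Ico_eq_sum_range]
      rw [← Finset.Ico_succ_right_eq_Icc, Finset.sum_Ico_eq_sum_range]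
      simp only [Nat.sub_zero]
      apply Finset.sum_congr (by simp)
      intro j _
      rw [Nat.zero_add, Nat.add_comm, pow_succ']
    rw [this, geom_sum_eq hne, hQp]; simp

/-- Fourier coefficient of the initial segment indicator. -/
def GG (Q j b : ℕ) : ℂ := (1 / (Q:ℂ)) * ∑ c ∈ Finset.Ico b Q, e ((j:ℝ) / Q * c)

def om (Q j : ℕ) : ℝ := 2 / (Q:ℝ) * FF Q ((j:ℝ)/Q)

lemma om_pos (Q j : ℕ) (hQ : 1 ≤ Q) : 0 < om Q j := by
  unfold om FF
  have : (0:ℝ) < Q := by positivity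
  have := dn_nonneg ((j:ℝ)/Q)
  positivity

lemma GG_le (Q j b : ℕ) : ‖GG Q j b‖ ≤ om Q j := by
  unfold GG om
  rw [norm_mul]
  have h := geom_bound ((j:ℝ)/Q) b Q Q (Nat.cast_nonneg _) (by
    have : (0:ℝ) ≤ b := Nat.cast_nonneg _
    linarith)
  have h2 : ‖(1 / (Q:ℂ))‖ = 1 / (Q:ℝ) := by simp
  rw [h2]
  calc _ ≤ 1 / (Q:ℝ) * (2 * FF Q ((j:ℝ)/Q)) := by gcongr
    _ = _ := by ring

lemma om_sum (Q : ℕ) (hQ : 1 ≤ Q) : ∑ j ∈ Finset.Icc 1 Q, om Q j ≤ 32 * (2 + Real.log Q) := by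
  have hQ0 : (0:ℝ) < Q := by positivity
  have h := vino (1/(Q:ℝ)) 1 Q hQ (by simp) (by simp) Q hQ0 Q
  have h2 : ∑ j ∈ Finset.Icc 1 Q, om Q j = 2 / (Q:ℝ) * ∑ j ∈ Finset.Icc 1 Q, FF Q (1/(Q:ℝ) * j) := by
    rw [Finset.mul_sum]; apply Finset.sum_congr rfl; intro j _
    unfold om; congr 2; ring
  rw [h2]
  calc _ ≤ 2 / (Q:ℝ) * (8*((Q:ℝ)/Q+1)*(Q+Q*(1+Real.log Q))) := by gcongr
    _ = _ := by field_simp; ring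

lemma GG_id (Q a b : ℕ) (ha : a < Q) :
    (if b ≤ a then 1 else 0 : ℂ) = ∑ j ∈ Finset.Icc 1 Q, GG Q j b * e (-((j:ℝ) * a / Q)) := by
  have hQ : 1 ≤ Q := by omega
  have hQ0 : (Q:ℂ) ≠ 0 := by norm_cast; omega
  have h1 : ∀ j : ℕ, GG Q j b * e (-((j:ℝ) * a / Q)) = (1/(Q:ℂ)) * ∑ c ∈ Finset.Ico b Q, e ((j:ℝ) * (((c:ℤ)-(a:ℤ) : ℤ) / Q)) := by
    intro j
    unfold GG
    rw [mul_assoc, Finset.sum_mul]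
    congr 1
    apply Finset.sum_congr rfl; intro c _
    rw [← e_add]; congr 1; push_cast; ring
  simp only [h1]
  rw [← Finset.mul_sum, Finset.sum_comm]
  have h2 : ∀ c ∈ Finset.Ico b Q, ∑ j ∈ Finset.Icc 1 Q, e ((j:ℝ) * (((c:ℤ)-(a:ℤ) : ℤ) / Q)) = if c = a then (Q:ℂ) else 0 := by
    intro c hc
    rw [Finset.mem_Ico] at hc
    rw [orth Q hQ _ (by rw [abs_lt]; constructor <;> omega)]
    congr 1
    apply propext; omega
  rw [Finset.sum_congr rfl h2, Finset.sum_ite_eq']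
  split_ifs with h3 h4 h4
  · field_simp
  · rw [Finset.mem_Ico] at h4; omega
  · rw [Finset.mem_Ico] at h4; omega
  · simp


def fA (D w : ℕ) (ij : ℕ × ℕ) : ArithmeticFunction ℂ :=
  ⟨fun d => if FFs D w d ∧ Nat.log 2 d = ij.1 then
    (ArithmeticFunction.moebius d : ℂ) * (GG (w+1) ij.2 (Nat.minFac d) / (om (w+1) ij.2 : ℂ)) else 0, by simp⟩

def gA (w : ℕ) (ij : ℕ × ℕ) : ArithmeticFunction ℂ :=
  ⟨fun l => if l = 0 then 0 else e (-((ij.2:ℝ) * (piP w l) / ((w+1 : ℕ):ℝ))), by simp⟩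

def SIA (D w : ℕ) : ArithmeticFunction ℂ :=
  ⟨fun d => if d ≤ D ∧ sm w d then (ArithmeticFunction.moebius d : ℂ) else 0, by simp⟩

def sA (D w : ℕ) : Finset (ℕ × ℕ) :=
  ((Finset.range (Nat.log 2 (D*w) + 1)).filter (fun i => D < 2^(i+1))) ×ˢ Finset.Icc 1 (w+1)

lemma mu_norm (d : ℕ) : ‖(ArithmeticFunction.moebius d : ℂ)‖ ≤ 1 := by
  rw [Complex.norm_intCast]
  exact_mod_cast ArithmeticFunction.abs_moebius_le_one

lemma piP_lt (w l : ℕ) : piP w l < w + 1 := by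
  unfold piP; split_ifs
  · omega
  · have := min_le_right (Nat.minFac l) w; omega

lemma FFs_le (D w d : ℕ) (h : FFs D w d) (hD : 1 ≤ D) : d ≤ D * w := by
  obtain ⟨h1, h2, h3⟩ := h
  have h4 := h1 _ (Nat.minFac_prime (by omega : d ≠ 1)) (Nat.minFac_dvd d)
  calc d = (d / d.minFac) * d.minFac := (Nat.div_mul_cancel (Nat.minFac_dvd d)).symm
    _ ≤ D * w := Nat.mul_le_mul h3 h4.le

lemma decomp_id (D w k : ℕ) (hD : 1 ≤ D) (hk : 1 ≤ k) :
    (if ro w k then 1 else 0 : ℂ) = (SIA D w * (ArithmeticFunction.zeta : ArithmeticFunction ℂ)) k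
      + ∑ i ∈ sA D w, (om (w+1) i.2 : ℂ) * (fA D w i * gA w i) k := by
  have h0 := sieve_id D w k hk hD
  have h1 : (if ro w k then 1 else 0 : ℂ) = ((if ro w k then 1 else 0 : ℤ) : ℂ) := by split_ifs <;> simp
  rw [h1, h0]
  have e1 : (SIA D w * (ArithmeticFunction.zeta : ArithmeticFunction ℂ)) k =
      ∑ d ∈ k.divisors, (if d ≤ D ∧ sm w d then (ArithmeticFunction.moebius d : ℂ) else 0) := by
    rw [ArithmeticFunction.coe_mul_zeta_apply]; rfl
  have e2 : ∀ i : ℕ × ℕ, (om (w+1) i.2 : ℂ) * (fA D w i * gA w i) k = ∑ d ∈ k.divisors,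
      if FFs D w d ∧ Nat.log 2 d = i.1 then (ArithmeticFunction.moebius d : ℂ) * 
        (GG (w+1) i.2 (Nat.minFac d) * e (-((i.2:ℝ) * (piP w (k/d)) / ((w+1 : ℕ):ℝ)))) else 0 := by
    intro i
    rw [ArithmeticFunction.mul_apply, Nat.sum_divisorsAntidiagonal (f := fun a b => fA D w i a * gA w i b), Finset.mul_sum]
    apply Finset.sum_congr rfl
    intro d hd
    have hd' := Nat.mem_divisors.mp hd
    have hkd : k / d ≠ 0 := by
      have := Nat.div_pos (Nat.le_of_dvd hk hd'.1) (Nat.pos_of_dvd_of_pos hd'.1 hk); omega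
    simp only [fA, gA, ArithmeticFunction.coe_mk, if_neg hkd]
    have ho : (om (w+1) i.2 : ℂ) ≠ 0 := by exact_mod_cast (om_pos (w+1) i.2 (by omega)).ne'
    split_ifs
    · field_simp
    · simp
  rw [e1, Finset.sum_congr rfl (fun i _ => e2 i), Finset.sum_comm, ← Finset.sum_add_distrib, Finset.sum_filter]
  rw [Int.cast_sum]
  apply Finset.sum_congr rfl
  intro d hd
  unfold sA
  rw [Finset.sum_product]
  rw [Int.cast_ite, Int.cast_mul, Int.cast_zero]
  by_cases hF : FFs D w d
  · have hF' := hF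
    obtain ⟨hs, hDd, hdm⟩ := hF'
    have hmem : Nat.log 2 d ∈ (Finset.range (Nat.log 2 (D*w) + 1)).filter (fun i => D < 2^(i+1)) := by
      rw [Finset.mem_filter, Finset.mem_range]
      refine ⟨?_, ?_⟩
      · have := Nat.log_mono_right (b := 2) (FFs_le D w d hF hD); omega
      · exact hDd.trans (Nat.lt_pow_succ_log_self (by norm_num) d)
    have h3 : ∀ i ∈ (Finset.range (Nat.log 2 (D*w) + 1)).filter (fun i => D < 2^(i+1)),
      ∑ j ∈ Finset.Icc 1 (w+1), (if FFs D w d ∧ Nat.log 2 d = i then (ArithmeticFunction.moebius d : ℂ) * 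
        (GG (w+1) j (Nat.minFac d) * e (-((j:ℝ) * (piP w (k/d)) / ((w+1 : ℕ):ℝ)))) else 0) =
      if Nat.log 2 d = i then (ArithmeticFunction.moebius d : ℂ) * (if Nat.minFac d ≤ piP w (k/d) then 1 else 0) else 0 := by
      intro i _
      by_cases hi : Nat.log 2 d = i
      · simp only [hF, hi, and_self, if_true]
        rw [← Finset.mul_sum, ← GG_id (w+1) (piP w (k/d)) (Nat.minFac d) (piP_lt _ _)]
      · simp [hi]
    rw [Finset.sum_congr rfl h3, Finset.sum_ite_eq, if_pos hmem, if_pos hs]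
    have h4 : ¬ d ≤ D := by omega
    simp [cS, h4, hDd, hdm]
  · have h3 : ∀ i ∈ (Finset.range (Nat.log 2 (D*w) + 1)).filter (fun i => D < 2^(i+1)),
      ∑ j ∈ Finset.Icc 1 (w+1), (if FFs D w d ∧ Nat.log 2 d = i then (ArithmeticFunction.moebius d : ℂ) * 
        (GG (w+1) j (Nat.minFac d) * e (-((j:ℝ) * (piP w (k/d)) / ((w+1 : ℕ):ℝ)))) else 0) = 0 := by
      intro i _; simp [hF]
    rw [Finset.sum_congr rfl h3, Finset.sum_const_zero, add_zero]
    by_cases hs : sm w d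
    · have h5 : ¬ (D < d ∧ d / Nat.minFac d ≤ D ∧ Nat.minFac d ≤ piP w (k / d)) := by
        rintro ⟨h6, h7, _⟩; exact hF ⟨hs, h6, h7⟩
      simp [cS, h5, hs]
    · simp [hs]

lemma gA_norm (w : ℕ) (i) (v : ℕ) : ‖gA w i v‖ ≤ 1 := by
  simp only [gA, ArithmeticFunction.coe_mk]
  split_ifs
  · simp
  · rw [e_norm]

lemma SIA_norm (D w d : ℕ) : ‖SIA D w d‖ ≤ 1 := by
  simp only [SIA, ArithmeticFunction.coe_mk]
  split_ifs
  · exact mu_norm d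
  · simp

lemma SIA_supp (D w d : ℕ) (h : SIA D w d ≠ 0) : 1 ≤ d ∧ d ≤ D := by
  have h0 : d ≠ 0 := by rintro rfl; simp at h
  simp only [SIA, ArithmeticFunction.coe_mk] at h
  refine ⟨by omega, ?_⟩
  by_contra h2
  simp [h2] at h

lemma fA_norm (D w : ℕ) (i) (d : ℕ) : ‖fA D w i d‖ ≤ 1 := by
  simp only [fA, ArithmeticFunction.coe_mk]
  split_ifs
  · have ho := om_pos (w+1) i.2 (by omega)
    rw [norm_mul, norm_div, Complex.norm_real, Real.norm_of_nonneg ho.le]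
    have h1 := mu_norm d
    have h2 : ‖GG (w+1) i.2 (Nat.minFac d)‖ / om (w+1) i.2 ≤ 1 := by
      rw [div_le_one ho]; exact GG_le _ _ _
    exact mul_le_one₀ h1 (by positivity) h2
  · simp

lemma fA_supp (D w : ℕ) (i) (d : ℕ) (h : fA D w i d ≠ 0) : 2^i.1 ≤ d ∧ d < 2 * 2^i.1 := by
  have h0 : d ≠ 0 := by rintro rfl; simp at h
  simp only [fA, ArithmeticFunction.coe_mk] at h
  split_ifs at h with h2
  · rw [← h2.2]
    refine ⟨Nat.pow_log_le_self 2 h0, ?_⟩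
    rw [← pow_succ']; exact Nat.lt_pow_succ_log_self (by norm_num) d
  · exact absurd rfl h

lemma sA_mem (D w : ℕ) (i) (hD : 1 ≤ D) (hw : 1 ≤ w) (h : i ∈ sA D w) : D ≤ 2 * 2^i.1 ∧ 2^i.1 ≤ D * w := by
  unfold sA at h
  rw [Finset.mem_product, Finset.mem_filter, Finset.mem_range] at h
  refine ⟨by rw [← pow_succ']; exact h.1.2.le, ?_⟩
  apply Nat.pow_le_of_le_log
  · exact (Nat.mul_pos hD hw).ne'
  · omega

lemma om_tot (D w : ℕ) : ∑ i ∈ sA D w, om (w+1) i.2 ≤ ((Nat.log 2 (D*w) : ℝ) + 1) * (32 * (2 + Real.log ((w+1 : ℕ):ℝ))) := by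
  unfold sA
  rw [Finset.sum_product]
  simp only []
  rw [Finset.sum_const, nsmul_eq_mul]
  have h0 : 0 ≤ ∑ j ∈ Finset.Icc 1 (w+1), om (w+1) j := Finset.sum_nonneg (fun j _ => (om_pos _ _ (by omega)).le)
  have h1 := om_sum (w+1) (by omega)
  apply mul_le_mul _ h1 h0 (by positivity)
  have : ((Finset.range (Nat.log 2 (D*w) + 1)).filter (fun i => D < 2^(i+1))).card ≤ Nat.log 2 (D*w) + 1 := by
    refine (Finset.card_filter_le _ _).trans ?_
    simp
  exact_mod_cast this


def PhA (w : ℕ) : ArithmeticFunction ℂ := ⟨fun k => if k = 0 then 0 else if ro w k then 1 else 0, by simp⟩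

lemma conv_tau (A g : ArithmeticFunction ℂ) (E : ℕ) (hA : ∀ v, ‖A v‖ ≤ tau v ^ E) (hg : ∀ v, ‖g v‖ ≤ 1) (v : ℕ) :
    ‖(A * g) v‖ ≤ tau v ^ (E+1) := by
  rcases Nat.eq_zero_or_pos v with h | h
  · subst h; simp only [ArithmeticFunction.map_zero, norm_zero]; exact pow_nonneg (tau_nonneg _) _
  rw [ArithmeticFunction.mul_apply, Nat.sum_divisorsAntidiagonal (f := fun a b => A a * g b)]
  calc _ ≤ ∑ d ∈ v.divisors, ‖A d * g (v/d)‖ := norm_sum_le _ _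
    _ ≤ ∑ d ∈ v.divisors, tau v ^ E := by
        apply Finset.sum_le_sum
        intro d hd
        rw [norm_mul]
        have hd' := Nat.mem_divisors.mp hd
        calc _ ≤ tau d ^ E * 1 := mul_le_mul (hA d) (hg _) (norm_nonneg _) (pow_nonneg (tau_nonneg _) _)
          _ ≤ tau v ^ E := by
            rw [mul_one]
            exact pow_le_pow_left₀ (tau_nonneg _) (tau_mono hd'.1 hd'.2) _
    _ = tau v ^ (E+1) := by
        rw [Finset.sum_const, nsmul_eq_mul, pow_succ']; rfl

lemma PhA_decomp (A : ArithmeticFunction ℂ) (D w n : ℕ) (hD : 1 ≤ D) :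
    (A * PhA w) n = ((A * SIA D w) * (ArithmeticFunction.zeta : ArithmeticFunction ℂ)) n +
      ∑ i ∈ sA D w, (om (w+1) i.2 : ℂ) * (fA D w i * (A * gA w i)) n := by
  rw [mul_assoc A]
  have h1 : ∀ i, fA D w i * (A * gA w i) = A * (fA D w i * gA w i) := by intro i; ring
  simp only [h1]
  rw [ArithmeticFunction.mul_apply, ArithmeticFunction.mul_apply]
  have h2 : ∀ i, (A * (fA D w i * gA w i)) n = ∑ p ∈ n.divisorsAntidiagonal, A p.1 * (fA D w i * gA w i) p.2 := by
    intro i; rw [ArithmeticFunction.mul_apply]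
  simp only [h2, Finset.mul_sum]
  rw [Finset.sum_comm, ← Finset.sum_add_distrib]
  apply Finset.sum_congr rfl
  intro p hp
  have hp' := Nat.mem_divisorsAntidiagonal.mp hp
  have hp2 : 1 ≤ p.2 := by
    rcases Nat.eq_zero_or_pos p.2 with h | h
    · rw [h] at hp'; omega
    · exact h
  have h3 : PhA w p.2 = (if ro w p.2 then 1 else 0 : ℂ) := by
    simp only [PhA, ArithmeticFunction.coe_mk]; rw [if_neg (by omega)]
  rw [h3, decomp_id D w p.2 hD hp2, mul_add, Finset.mul_sum]
  congr 1
  apply Finset.sum_congr rfl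
  intro i _; ring

lemma comb (x y α : ℝ) (hx : 1 ≤ x) (hxy : √x ≤ y) (hyx : y ≤ x) (N : ℕ) (hN : ∀ n:ℕ, (n:ℝ)^2 ≤ 3*x → n ≤ N)
    (a : ℤ) (q : ℕ) (hq : 1 ≤ q) (hco : Int.gcd a q = 1) (hα : |α - a/q| ≤ 1/(q:ℝ)^2)
    (δ₁ δ₂ : ℝ) (h10 : 0 < δ₁) (h11 : δ₁ ≤ 1) (h1q : 1/(q:ℝ) ≤ δ₁) (h1q2 : (q:ℝ) ≤ δ₁ * y)
    (h20 : 0 < δ₂) (h21 : δ₂ ≤ 1) (h2q : 1/(q:ℝ) ≤ δ₂) (h2q2 : (q:ℝ) ≤ δ₂ * y)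
    (M : ℝ) (hM : 1 ≤ M) (hMs : M^2 ≤ δ₁ * √x) (D w : ℕ) (hD : 1 ≤ D) (hw : 1 ≤ w) (hDδ : δ₁ * (D:ℝ)^2 ≤ 1)
    (hsy : √x ≤ δ₁ * y) (hD2 : 2 / (D:ℝ) ≤ δ₂) (hDw : (D:ℝ) * w * √x ≤ δ₂ * y)
    (E : ℕ) (A : ArithmeticFunction ℂ) (hA : ∀ v, ‖A v‖ ≤ tau v ^ E) (hA2 : ∀ v, A v ≠ 0 → M ≤ v ∧ (v:ℝ) < 2 * M) :
    JJ x y α N (fun n => (A * PhA w) n) ≤ 4 * (164*y^2*(D:ℝ)^2*LL (8*x)^(2^(2*(E+1)+1)+9)*√√√δ₁ + 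
      (∑ i ∈ sA D w, om (w+1) i.2)^2 * (38*y^2*LL (8*x)^(2^(4*(E+1))+9)*√√δ₂)) := by
  have hLL : 0 ≤ LL (8*x) := by
    unfold LL
    have := Real.log_nonneg (by linarith : 1 ≤ 8*x)
    linarith
  have hfun : (fun n => (A * PhA w) n) = (fun n => (fun n => ((A * SIA D w) * (ArithmeticFunction.zeta : ArithmeticFunction ℂ)) n) n +
      (fun n => ∑ i ∈ sA D w, (om (w+1) i.2 : ℂ) * (fun n => (fA D w i * (A * gA w i)) n) n) n) := by
    funext n; exact PhA_decomp A D w n hD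
  rw [hfun]
  have hD1 : (1:ℝ) ≤ D := by exact_mod_cast hD
  have hD0 : (0:ℝ) < D := by linarith
  apply JJ_add
  · refine le_trans (typeI x y α hx hyx N hN a q hq hco hα δ₁ h10 h11 h1q h1q2 M D hM hMs hD1 hDδ hsy
      ⌊2*M*D⌋₊ (E+1) (Nat.floor_le (by positivity)) (A * SIA D w) (conv_tau A _ E hA (SIA_norm D w)) ?_) ?_
    · intro v hv
      rw [ArithmeticFunction.mul_apply] at hv
      obtain ⟨p, hp, hne⟩ := Finset.exists_ne_zero_of_sum_ne_zero hv
      have hp' := Nat.mem_divisorsAntidiagonal.mp hp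
      obtain ⟨m1, m2⟩ := hA2 _ (left_ne_zero_of_mul hne)
      obtain ⟨d1, d2⟩ := SIA_supp D w _ (right_ne_zero_of_mul hne)
      have d1' : (1:ℝ) ≤ (p.2:ℝ) := by exact_mod_cast d1
      have d2' : (p.2:ℝ) ≤ D := by exact_mod_cast d2
      have hv' : (v:ℝ) = p.1 * p.2 := by rw [← hp'.1]; push_cast; ring
      constructor
      · rw [hv']
        calc M = M * 1 := by ring
          _ ≤ _ := mul_le_mul m1 d1' (by norm_num) (by positivity)
      · apply Nat.le_floor
        rw [hv']
        exact mul_le_mul m2.le d2' (by positivity) (by positivity)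
    · apply le_add_of_nonneg_right
      positivity
  · refine le_trans (JJ_sum (sA D w) (fun i => om (w+1) i.2) (fun i _ => (om_pos _ _ (by omega)).le) _ x y α N
      (38*y^2*LL (8*x)^(2^(4*(E+1))+9)*√√δ₂) ?_) ?_
    · intro i hi
      obtain ⟨u1, u2⟩ := sA_mem D w i hD hw hi
      have hU : 1 ≤ 2^i.1 := Nat.one_le_two_pow
      have u1' : (D:ℝ) ≤ 2 * ((2^i.1 : ℕ):ℝ) := by exact_mod_cast u1
      have u2' : ((2^i.1 : ℕ):ℝ) ≤ D * w := by exact_mod_cast u2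
      have hU' : (0:ℝ) < ((2^i.1 : ℕ):ℝ) := by exact_mod_cast hU
      exact typeII x y α hx hxy hyx N (2^i.1) hN a q hq hco hα δ₂ h20 h21 h2q h2q2 hU
        (by
          refine le_trans ?_ hD2
          rw [div_le_div_iff₀ hU' hD0]; linarith)
        (by
          refine le_trans ?_ hDw
          exact mul_le_mul_of_nonneg_right u2' (Real.sqrt_nonneg _))
        (E+1) (fA D w i) (A * gA w i) (fA_norm D w i) (fA_supp D w i) (conv_tau A _ E hA (gA_norm w i))
    · apply le_add_of_nonneg_left
      positivity


def amA (M : ℝ) (am : ℕ → ℂ) : ArithmeticFunction ℂ :=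
  ⟨fun m => if m = 0 then 0 else if M ≤ (m:ℝ) ∧ (m:ℝ) < 2 * M then am m else 0, by simp⟩

lemma Phi_eq (k : ℕ) (z : ℝ) (hk : 1 ≤ k) : (Phi k z : ℂ) = PhA ⌈z⌉₊ k := by
  have hk0 : k ≠ 0 := by omega
  have h0 : PhA ⌈z⌉₊ k = if ro ⌈z⌉₊ k then 1 else 0 := by
    simp only [PhA, ArithmeticFunction.coe_mk, if_neg hk0]
  have h1 : (∀ p : ℕ, p.Prime → p ∣ k → z ≤ (p:ℝ)) ↔ ro ⌈z⌉₊ k := by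
    simp only [ro, Nat.ceil_le]
  rw [h0, Phi]
  by_cases h : ro ⌈z⌉₊ k
  · rw [if_pos h, if_pos (h1.mpr h)]; simp
  · rw [if_neg h, if_neg (fun h2 => h (h1.mp h2))]; simp

lemma int_eq_JJ (x y α M z : ℝ) (hx : 1 ≤ x) (hyx : y ≤ x) (am : ℕ → ℂ) (N : ℕ)
    (hN : ∀ n:ℕ, (n:ℝ)^2 ≤ 3*x → n ≤ N) :
    (∫ t in x..(2 * x),
        ‖∑ m ∈ Finset.Icc 1 N, ∑ k ∈ Finset.Icc 1 N,
          (if M ≤ (m : ℝ) ∧ (m : ℝ) < 2 * M ∧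
              t < ((m : ℝ) * (k : ℝ)) ^ 2 ∧ ((m : ℝ) * (k : ℝ)) ^ 2 ≤ t + y
           then am m * (Phi k z : ℂ) * e (α * ((m : ℝ) * (k : ℝ)) ^ 2) else 0)‖ ^ 2) =
    JJ x y α N (fun n => (amA M am * PhA ⌈z⌉₊) n) := by
  rw [intervalIntegral.integral_of_le (by linarith), ← integral_indicator measurableSet_Ioc]
  unfold JJ
  congr 1
  funext t
  by_cases ht : t ∈ Set.Ioc x (2*x)
  · rw [Set.indicator_of_mem ht]
    congr 2
    have h := conv_expand (amA M am) (PhA ⌈z⌉₊) (fun n => e (α * (n:ℝ)^2) * (ww x y t n : ℂ)) N (by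
      intro n hn; rw [ww_zero hyx hN t n hn]; simp)
    simp only [mul_assoc] at h ⊢
    rw [h]
    apply Finset.sum_congr rfl; intro m hm
    apply Finset.sum_congr rfl; intro k hk
    rw [Finset.mem_Icc] at hm hk
    rw [← Phi_eq k z hk.1]
    simp only [amA, ArithmeticFunction.coe_mk, ww, Nat.cast_mul, ht.1, ht.2, true_and]
    rw [if_neg (by omega : m ≠ 0)]
    by_cases h1 : M ≤ (m : ℝ) ∧ (m : ℝ) < 2 * M
    · by_cases h2 : t < ((m : ℝ) * (k : ℝ)) ^ 2 ∧ ((m : ℝ) * (k : ℝ)) ^ 2 ≤ t + y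
      · rw [if_pos ⟨h1.1, h1.2, h2⟩, if_pos h1, if_pos h2]; simp
      · rw [if_neg (fun h => h2 h.2.2), if_pos h1, if_neg h2]; simp
    · rw [if_neg (fun h => h1 ⟨h.1, h.2.1⟩), if_neg h1]; simp
  · rw [Set.indicator_of_notMem ht]
    symm
    have : ∀ n : ℕ, ww x y t n = 0 := by
      intro n; unfold ww; rw [if_neg]; rintro ⟨h1, h2, _⟩; exact ht ⟨h1, h2⟩
    simp [this]

lemma amA_tau (M : ℝ) (am : ℕ → ℂ) (c : ℝ) (h : ∀ m : ℕ, 1 ≤ m → ‖am m‖ ≤ (m.divisors.card : ℝ) ^ c) (v : ℕ) :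
    ‖amA M am v‖ ≤ tau v ^ ⌈c⌉₊ := by
  simp only [amA, ArithmeticFunction.coe_mk]
  split_ifs with h1 h2
  · simpa using pow_nonneg (tau_nonneg _) _
  · refine (h v (by omega)).trans ?_
    rw [← Real.rpow_natCast]
    exact Real.rpow_le_rpow_of_exponent_le (one_le_tau (by omega)) (Nat.le_ceil c)
  · simpa using pow_nonneg (tau_nonneg _) _

lemma amA_supp (M : ℝ) (am : ℕ → ℂ) (v : ℕ) (h : amA M am v ≠ 0) : M ≤ v ∧ (v:ℝ) < 2 * M := by
  simp only [amA, ArithmeticFunction.coe_mk] at h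
  split_ifs at h with h1 h2
  · exact absurd rfl h
  · exact h2
  · exact absurd rfl h

lemma sqrt_rpow (t b : ℝ) (ht : 0 < t) : √(t^b) = t^(b/2) := by
  rw [Real.sqrt_eq_rpow, ← Real.rpow_mul ht.le]; congr 1; ring

lemma om_tot' (D w : ℕ) (x : ℝ) (hD : 1 ≤ D) (hw : 1 ≤ w) (hx : 2 ≤ x) (h1 : (D:ℝ) * w ≤ x) (h2 : (w:ℝ) + 1 ≤ x)
    (hL : 1 ≤ Real.log x) : ∑ i ∈ sA D w, om (w+1) i.2 ≤ 288 * Real.log x ^ 2 := by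
  refine (om_tot D w).trans ?_
  set L := Real.log x with hLd
  have hDw : 0 < D * w := Nat.mul_pos hD hw
  have a1 : (Nat.log 2 (D*w) : ℝ) ≤ 2 * L := by
    have : (Nat.log 2 (D*w) : ℝ) ≤ Real.logb 2 ((D*w : ℕ):ℝ) := Real.natLog_le_logb _ _
    refine this.trans ?_
    unfold Real.logb
    have h3 : Real.log ((D*w : ℕ):ℝ) ≤ L := by
      apply Real.log_le_log
      · exact_mod_cast hDw
      · push_cast; exact h1
    have h4 := Real.log_two_gt_d9
    rw [div_le_iff₀ (by linarith)]
    have h5 : 2 * L * (1/2) ≤ 2 * L * Real.log 2 := by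
      apply mul_le_mul_of_nonneg_left <;> linarith
    linarith
  have a2 : Real.log ((w+1:ℕ):ℝ) ≤ L := by
    apply Real.log_le_log
    · positivity
    · push_cast; exact h2
  have a3 : 0 ≤ Real.log ((w+1:ℕ):ℝ) := Real.log_natCast_nonneg _
  calc _ ≤ (3 * L) * (32 * (3 * L)) := by
        apply mul_le_mul
        · linarith
        · linarith
        · positivity
        · positivity
    _ = _ := by ring

/-- final numeric combination -/
lemma final_num (L y A B1 B Dr S ℓ δ₁ δ₂ : ℝ) (K1 K2 K : ℕ) (hL : 4 ≤ L) (hK1 : K1 ≤ K) (hK2 : K2 ≤ K)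
    (hℓ1 : 1 ≤ ℓ) (hℓ : ℓ ≤ 2 * L) (hD0 : 0 ≤ Dr) (hD : Dr ≤ L ^ B1) (hS0 : 0 ≤ S) (hS : S ≤ 288 * L^2)
    (hδ1 : δ₁ = L ^ (-B)) (hδ2 : δ₂ = 4 * L ^ (-B1))
    (hB1 : (K:ℝ) + 4 - B1/4 ≤ -A) (hB : (K:ℝ) + 2 * B1 - B/8 ≤ -A) :
    4 * (164*y^2*Dr^2*ℓ^K1*√√√δ₁ + S^2 * (38*y^2*ℓ^K2*√√δ₂)) ≤ (2^K * 10^8) * y^2 * L^(-A) := by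
  have hL0 : 0 < L := by linarith
  have e1 : √√√δ₁ = L ^ (-B/8) := by
    rw [hδ1, sqrt_rpow _ _ hL0, sqrt_rpow _ _ hL0, sqrt_rpow _ _ hL0]; congr 1; ring
  have e2 : √√δ₂ ≤ 2 * L ^ (-B1/4) := by
    rw [hδ2, Real.sqrt_mul (by norm_num), sqrt_rpow _ _ hL0, Real.sqrt_mul (by positivity), sqrt_rpow _ _ hL0]
    have h4 : √√(4:ℝ) ≤ 2 := by
      rw [Real.sqrt_le_left (by norm_num), Real.sqrt_le_left (by norm_num)]; norm_num
    have : -B1/2/2 = -B1/4 := by ring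
    rw [this]
    gcongr
  have p1 : ∀ k, k ≤ K → ℓ^k ≤ 2^K * L^K := by
    intro k hk
    calc ℓ^k ≤ ℓ^K := pow_le_pow_right₀ hℓ1 hk
      _ ≤ (2*L)^K := by gcongr
      _ = _ := by rw [mul_pow]
  have q1 : Dr^2 ≤ L^(2*B1) := by
    calc Dr^2 ≤ (L^B1)^2 := by gcongr
      _ = _ := by rw [← Real.rpow_natCast, ← Real.rpow_mul hL0.le]; congr 1; push_cast; ring
  have t1 : Dr^2*ℓ^K1*√√√δ₁ ≤ 2^K * L^(-A) := by
    calc _ ≤ L^(2*B1) * (2^K * L^K) * L^(-B/8) := by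
          rw [e1]; gcongr; exact p1 _ hK1
      _ = 2^K * (L^((K:ℝ) + 2*B1 - B/8)) := by
          rw [show (K:ℝ) + 2*B1 - B/8 = 2*B1 + (K:ℝ) + (-B/8) by ring, Real.rpow_add hL0, Real.rpow_add hL0,
            Real.rpow_natCast]; ring
      _ ≤ _ := by
          gcongr; linarith
  have t2 : S^2*(ℓ^K2*√√δ₂) ≤ 288^2*2*2^K * L^(-A) := by
    calc _ ≤ (288*L^2)^2 * ((2^K * L^K) * (2*L^(-B1/4))) := by
          gcongr; exact p1 _ hK2
      _ = 288^2*2*2^K * (L^((K:ℝ) + 4 - B1/4)) := by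
          rw [show (K:ℝ) + 4 - B1/4 = (K:ℝ) + (4:ℕ) + (-B1/4) by push_cast; ring, Real.rpow_add hL0, Real.rpow_add hL0,
            Real.rpow_natCast, Real.rpow_natCast]; ring
      _ ≤ _ := by
          gcongr; linarith
  have hy : 0 ≤ y^2 := by positivity
  calc _ = y^2 * (656 * (Dr^2*ℓ^K1*√√√δ₁) + 152 * (S^2*(ℓ^K2*√√δ₂))) := by ring
    _ ≤ y^2 * (656 * (2^K * L^(-A)) + 152 * (288^2*2*2^K * L^(-A))) := by gcongr
    _ = (656 + 152*288^2*2) * (2^K * y^2 * L^(-A)) := by ring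
    _ ≤ 10^8 * (2^K * y^2 * L^(-A)) := by
        gcongr; norm_num
    _ = _ := by ring


/-- Lemma 3 of the paper. -/
theorem statement9 :
    ∀ A c : ℝ, 0 < A → 0 < c → ∃ B₀ : ℝ, 0 < B₀ ∧ ∃ C : ℝ, 0 < C ∧
    ∀ B : ℝ, B₀ ≤ B → ∃ x₀ : ℝ, ∀ x : ℝ, x₀ ≤ x →
    ∀ (y α M z : ℝ) (a q : ℤ) (am : ℕ → ℂ) (L : ℝ), L = Real.log x →
    x ^ (1/2 : ℝ) ≤ y → y ≤ x →
    L ^ B ≤ (q : ℝ) → (q : ℝ) ≤ y * L ^ (-B) → Int.gcd a q = 1 →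
    |α - (a : ℝ) / (q : ℝ)| < (q : ℝ) ^ (-2 : ℝ) →
    (∀ m : ℕ, 1 ≤ m → ‖am m‖ ≤ (m.divisors.card : ℝ) ^ c) →
    1 ≤ M → M ≤ x ^ (1/4 : ℝ) * L ^ (-2 * B) →
    2 ≤ z → z ≤ y * x ^ (-1/2 : ℝ) * L ^ (-2 * B) →
    (∫ t in x..(2 * x),
        ‖∑ m ∈ Finset.Icc 1 ⌊3 * x⌋₊, ∑ k ∈ Finset.Icc 1 ⌊3 * x⌋₊,
          (if M ≤ (m : ℝ) ∧ (m : ℝ) < 2 * M ∧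
              t < ((m : ℝ) * (k : ℝ)) ^ 2 ∧ ((m : ℝ) * (k : ℝ)) ^ 2 ≤ t + y
           then am m * (Phi k z : ℂ) * e (α * ((m : ℝ) * (k : ℝ)) ^ 2) else 0)‖ ^ 2)
      ≤ C * y ^ 2 * L ^ (-A) := by
  intro A c hA hc
  obtain ⟨E, hE⟩ : ∃ E : ℕ, E = ⌈c⌉₊ := ⟨_, rfl⟩
  obtain ⟨K, hK⟩ : ∃ K : ℕ, K = 2^(4*(E+1))+9 := ⟨_, rfl⟩
  have hK0 : (0:ℝ) ≤ K := Nat.cast_nonneg _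
  obtain ⟨B1, hB1⟩ : ∃ B1 : ℝ, B1 = 4 * (A + K + 4) := ⟨_, rfl⟩
  refine ⟨8 * (A + K + 2 * B1), by rw [hB1]; positivity, 2^K * 10^8, by positivity, ?_⟩
  intro B hB
  refine ⟨Real.exp 4, ?_⟩
  intro x hx y α M z a q am L hL hxy hyx hq1 hq2 hco hα ham hM1 hM2 hz1 hz2
  have hx0 : 0 < x := (Real.exp_pos 4).trans_le hx
  have hL4 : 4 ≤ L := by rw [hL, Real.le_log_iff_exp_le hx0]; exact hx
  have hx5 : 5 ≤ x := by
    have := Real.add_one_le_exp (4:ℝ); linarith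
  have hL0 : 0 < L := by linarith
  have hL1 : 1 ≤ L := by linarith
  have hB1p : 16 ≤ B1 := by rw [hB1]; linarith
  have hBB : 16 * B1 ≤ B := by linarith
  have hB0 : 0 < B := by linarith
  have hs : x ^ (1/2 : ℝ) = √x := (Real.sqrt_eq_rpow x).symm
  have hs0 : 0 < √x := Real.sqrt_pos.mpr hx0
  rw [hs] at hxy
  have hy0 : 0 < y := hs0.trans_le hxy
  -- lift q
  have hLB : 1 ≤ L ^ B := Real.one_le_rpow hL1 hB0.le
  have hqr : (1:ℝ) ≤ q := hLB.trans hq1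
  have hq1' : (1:ℤ) ≤ q := by exact_mod_cast hqr
  lift q to ℕ using (by omega)
  rw [Int.cast_natCast] at hq1 hq2 hα hqr
  have hqn : 1 ≤ q := by exact_mod_cast hqr
  have hq0 : (0:ℝ) < q := by linarith
  have hα' : |α - a / (q:ℝ)| ≤ 1/(q:ℝ)^2 := by
    refine hα.le.trans (le_of_eq ?_)
    rw [Real.rpow_neg hq0.le, one_div]; norm_num
  -- powers
  have hLm : ∀ u v : ℝ, u ≤ v → L ^ u ≤ L ^ v := fun u v h => Real.rpow_le_rpow_of_exponent_le hL1 h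
  have hneg : ∀ u : ℝ, L ^ (-u) = 1 / L ^ u := by intro u; rw [Real.rpow_neg hL0.le, one_div]
  have hpp : ∀ u : ℝ, 0 < L ^ u := fun u => Real.rpow_pos_of_pos hL0 u
  have hadd : ∀ u v : ℝ, L ^ u * L ^ v = L ^ (u+v) := fun u v => (Real.rpow_add hL0 u v).symm
  obtain ⟨D, hD⟩ : ∃ D : ℕ, D = ⌊L ^ B1⌋₊ := ⟨_, rfl⟩
  have hLB1 : 4 ≤ L ^ B1 := by
    calc (4:ℝ) ≤ L := hL4
      _ = L ^ (1:ℝ) := (Real.rpow_one L).symm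
      _ ≤ _ := hLm _ _ (by linarith)
  have hDle : (D:ℝ) ≤ L ^ B1 := by rw [hD]; exact Nat.floor_le (hpp _).le
  have hDge : L ^ B1 / 2 ≤ D := by
    have := Nat.lt_floor_add_one (L ^ B1); rw [← hD] at this; linarith
  have hD1r : (1:ℝ) ≤ D := by linarith
  have hD1 : 1 ≤ D := by exact_mod_cast hD1r
  obtain ⟨w, hw⟩ : ∃ w : ℕ, w = ⌈z⌉₊ := ⟨_, rfl⟩
  have hwz : (w:ℝ) ≤ 2 * z := by
    have := Nat.ceil_lt_add_one (by linarith : 0 ≤ z); rw [← hw] at this; linarith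
  have hw1 : 1 ≤ w := by rw [hw]; exact Nat.ceil_pos.mpr (by linarith)
  have hw1r : (1:ℝ) ≤ w := by exact_mod_cast hw1
  have hz3 : z * √x ≤ y * L ^ (-2*B) := by
    have h1 : x ^ (-1/2:ℝ) * √x = 1 := by
      rw [← hs, ← Real.rpow_add hx0]; norm_num
    calc z * √x ≤ (y * x ^ (-1/2:ℝ) * L ^ (-2*B)) * √x := by gcongr
      _ = y * L ^ (-2*B) * (x ^ (-1/2:ℝ) * √x) := by ring
      _ = _ := by rw [h1, mul_one]
  have hN : ∀ n:ℕ, (n:ℝ)^2 ≤ 3*x → n ≤ ⌊3*x⌋₊ := by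
    intro n hn
    apply Nat.le_floor
    refine le_trans ?_ hn
    exact_mod_cast Nat.le_self_pow (by norm_num) n
  have hDw : (D:ℝ) * w * √x ≤ 4 * L ^ (-B1) * y := by
    calc (D:ℝ) * w * √x ≤ L ^ B1 * (2 * z) * √x := by gcongr
      _ = 2 * L ^ B1 * (z * √x) := by ring
      _ ≤ 2 * L ^ B1 * (y * L ^ (-2*B)) := by
          have := (hpp B1).le
          gcongr
      _ = 2 * (L ^ B1 * L ^ (-2*B)) * y := by ring
      _ ≤ 4 * L ^ (-B1) * y := by
          rw [hadd]
          have h1 := hLm (B1 + -2*B) (-B1) (by linarith)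
          have h2 := hpp (-B1)
          have h3 : 2 * L ^ (B1 + -2*B) ≤ 4 * L ^ (-B1) := by linarith
          exact mul_le_mul_of_nonneg_right h3 hy0.le
  have hδ2 : 4 * L ^ (-B1) ≤ 1 := by
    rw [hneg, mul_one_div, div_le_one (hpp _)]; exact hLB1
  have hqinv : 1 / (q:ℝ) ≤ L ^ (-B) := by
    rw [hneg]; exact one_div_le_one_div_of_le (hpp _) hq1
  have hBB1 : L ^ (-B) ≤ 4 * L ^ (-B1) := by
    have h1 := hLm (-B) (-B1) (by linarith)
    have h2 := hpp (-B1)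
    linarith
  have hDwx : (D:ℝ) * w ≤ √x := by
    have h1 : (D:ℝ) * w * √x ≤ √x * √x := by
      rw [Real.mul_self_sqrt hx0.le]
      refine hDw.trans ?_
      calc _ ≤ 1 * y := mul_le_mul_of_nonneg_right hδ2 hy0.le
        _ ≤ x := by linarith
    exact le_of_mul_le_mul_right h1 hs0
  have hsx : √x + 1 ≤ x := by
    have h2 : 2 ≤ √x := Real.le_sqrt_of_sq_le (by linarith)
    have h3 := Real.mul_self_sqrt hx0.le
    have h4 : 2 * √x ≤ √x * √x := mul_le_mul_of_nonneg_right h2 hs0.le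
    linarith
  have hwx : (w:ℝ) ≤ √x := by
    refine le_trans ?_ hDwx
    exact le_mul_of_one_le_left (by linarith) hD1r
  rw [int_eq_JJ x y α M z (by linarith) hyx am _ hN, ← hw]
  have hcomb := comb x y α (by linarith) hxy hyx ⌊3*x⌋₊ hN a q hqn hco hα' (L ^ (-B)) (4 * L ^ (-B1))
    (hpp _) (by rw [hneg, div_le_one (hpp _)]; exact hLB) hqinv (by rw [mul_comm]; exact hq2)
    (by have := hpp (-B1); linarith) hδ2 (hqinv.trans hBB1)
    (by
      refine hq2.trans ?_
      rw [mul_comm]; exact mul_le_mul_of_nonneg_right hBB1 hy0.le)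
    M hM1
    (by
      have h0 : (x ^ (1/4:ℝ))^2 = √x := by
        rw [← Real.rpow_natCast, ← Real.rpow_mul hx0.le, ← hs]; norm_num
      have h1 : (L ^ (-2*B))^2 ≤ L ^ (-B) := by
        rw [← Real.rpow_natCast, ← Real.rpow_mul hL0.le]
        apply hLm; push_cast; linarith
      calc M^2 ≤ (x ^ (1/4:ℝ) * L ^ (-2*B))^2 := by gcongr
        _ = (L ^ (-2*B))^2 * √x := by rw [mul_pow, h0]; ring
        _ ≤ _ := mul_le_mul_of_nonneg_right h1 hs0.le)
    D w hD1 hw1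
    (by
      have h1 : (D:ℝ)^2 ≤ L ^ (2*B1) := by
        calc (D:ℝ)^2 ≤ (L^B1)^2 := by gcongr
          _ = _ := by rw [← Real.rpow_natCast, ← Real.rpow_mul hL0.le]; congr 1; push_cast; ring
      calc L ^ (-B) * (D:ℝ)^2 ≤ L ^ (-B) * L ^ (2*B1) := mul_le_mul_of_nonneg_left h1 (hpp _).le
        _ = L ^ (-B + 2*B1) := hadd _ _
        _ ≤ L ^ (0:ℝ) := hLm _ _ (by linarith)
        _ = 1 := Real.rpow_zero L)
    (by
      have h1 : 1 * √x ≤ z * √x := mul_le_mul_of_nonneg_right (by linarith) hs0.le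
      have h2 : y * L ^ (-2*B) ≤ y * L ^ (-B) := mul_le_mul_of_nonneg_left (hLm _ _ (by linarith)) hy0.le
      rw [mul_comm]; linarith)
    (by
      rw [hneg, mul_one_div, div_le_div_iff₀ (by linarith) (hpp _)]; linarith)
    hDw E (amA M am) (by rw [hE]; exact amA_tau M am c ham) (amA_supp M am)
  refine hcomb.trans ?_
  have hlog8 : Real.log (8*x) ≤ 3 + L := by
    rw [Real.log_mul (by norm_num) hx0.ne', ← hL, show (8:ℝ) = 2^3 by norm_num, Real.log_pow]
    have := Real.log_two_lt_d9
    push_cast; linarith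
  have hlog8' : 0 ≤ Real.log (8*x) := Real.log_nonneg (by linarith)
  refine final_num L y A B1 B D _ (LL (8*x)) _ _ _ _ K hL4 ?_ hK.ge ?_ ?_ (by linarith) hDle 
    (Finset.sum_nonneg (fun i _ => (om_pos _ _ (by omega)).le)) ?_ rfl rfl ?_ ?_
  · rw [hK]
    have : 2^(2*(E+1)+1) ≤ 2^(4*(E+1)) := Nat.pow_le_pow_right (by norm_num) (by omega)
    omega
  · unfold LL; linarith
  · unfold LL; linarith
  · rw [hL]
    exact om_tot' D w x hD1 hw1 (by linarith) (by linarith) (by linarith) (by rw [← hL]; exact hL1)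
  · rw [hB1]; linarith
  · linarith
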